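/- (Weak Pasting Lemma for conservative diffeomorphisms, Euclidean version.) Let n ≥ 2 and let f : ℝⁿ → ℝⁿ be a C² diffeomorphism with det Df(y) = 1 for every y, and with sup_y ‖Df(y)‖_op < ∞ and sup_y ‖D²f(y)‖ < ∞. Then for every x ∈ ℝⁿ, every α ∈ (0,1) and every ε > 0, there exist r > 0 and a diffeomorphism g : ℝⁿ → ℝⁿ of class C^{1+α} with det Dg(y) = 1 for every y, such that: g(y) = f(y) for all y ∉ B(x, r); g(y) = f(x) + Df(x)(y − x) for all y ∈ B(x, r/2); and sup_{y ∈ ℝⁿ} (‖g(y) − f(y)‖ + ‖Dg(y) − Df(y)‖_op) < ε. -/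

import Mathlib

noncomputable section

/-- A map is of class C^{1+α}: it is C¹ and its derivative is α-Hölder. -/
def C1Holder {n : ℕ} (α : ℝ) (g : EuclideanSpace ℝ (Fin n) → EuclideanSpace ℝ (Fin n)) : Prop :=
  ContDiff ℝ 1 g ∧ ∃ C : ℝ, 0 ≤ C ∧ ∀ x y, ‖fderiv ℝ g x - fderiv ℝ g y‖ ≤ C * ‖x - y‖ ^ α

namespace Pasting

open MeasureTheory Set Filter Topology

/-- Euclidean space of dimension `n`. -/
abbrev Eu (n : ℕ) := EuclideanSpace ℝ (Fin n)

variable {n : ℕ}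

/-- The linear form with coefficients `c`. -/
def gr (c : Fin n → ℝ) : Eu n →L[ℝ] ℝ := ∑ i, c i • EuclideanSpace.proj i

/-- The `i`-th vector of the standard basis. -/
def bv (i : Fin n) : Eu n := EuclideanSpace.single i 1

lemma bv_apply (i j : Fin n) : (bv i : Eu n) j = if j = i then 1 else 0 := by
  simp [bv]

lemma norm_bv (i : Fin n) : ‖(bv i : Eu n)‖ = 1 := by simp [bv]

lemma gr_apply (c : Fin n → ℝ) (v : Eu n) : gr c v = ∑ i, c i * v i := by
  simp [gr]

lemma gr_bv (c : Fin n → ℝ) (i : Fin n) : gr c (bv i) = c i := by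
  simp [gr_apply, bv_apply]

lemma eq_sum_bv (v : Eu n) : v = ∑ i, v i • bv i := by
  ext j
  simp [bv_apply]

lemma eq_gr (L : Eu n →L[ℝ] ℝ) : L = gr (fun i => L (bv i)) := by
  ext v
  conv_lhs => rw [eq_sum_bv v]
  simp [gr_apply, mul_comm]

lemma gr_injective : Function.Injective (gr : (Fin n → ℝ) → Eu n →L[ℝ] ℝ) := by
  intro c c' h
  ext i
  rw [← gr_bv c i, h, gr_bv]

lemma abs_apply_le_norm (v : Eu n) (i : Fin n) : |v i| ≤ ‖v‖ := by
  simpa using PiLp.norm_apply_le v i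

lemma norm_gr_le (c : Fin n → ℝ) : ‖gr c‖ ≤ ∑ i, |c i| := by
  refine ContinuousLinearMap.opNorm_le_bound _ (Finset.sum_nonneg fun i _ => abs_nonneg _) fun v => ?_
  rw [gr_apply, Finset.sum_mul]
  refine (norm_sum_le _ _).trans (Finset.sum_le_sum fun i _ => ?_)
  rw [norm_mul]
  exact mul_le_mul_of_nonneg_left (abs_apply_le_norm v i) (abs_nonneg _)

lemma norm_gr_le_of_abs_le {c : Fin n → ℝ} {B : ℝ} (h : ∀ i, |c i| ≤ B) : ‖gr c‖ ≤ n * B := by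
  refine (norm_gr_le c).trans ((Finset.sum_le_sum fun i _ => h i).trans (le_of_eq ?_))
  simp

/-- `a` is differentiable at `x` with partial derivatives `c`. -/
def HasP (a : Eu n → ℝ) (c : Fin n → ℝ) (x : Eu n) : Prop := HasFDerivAt a (gr c) x

namespace HasP
variable {a b : Eu n → ℝ} {c d : Fin n → ℝ} {x : Eu n}

lemma continuousAt (h : HasP a c x) : ContinuousAt a x := HasFDerivAt.continuousAt h

lemma congr_partials (h : HasP a c x) (e : ∀ i, c i = d i) : HasP a d x := by
  rwa [← show c = d from funext e]

lemma congr_fun (h : HasP a c x) (e : b =ᶠ[𝓝 x] a) : HasP b c x :=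
  HasFDerivAt.congr_of_eventuallyEq h e

lemma unique (h : HasP a c x) (h' : HasP a d x) (i : Fin n) : c i = d i :=
  congrFun (gr_injective (HasFDerivAt.unique h h')) i

lemma of_hasFDerivAt {L : Eu n →L[ℝ] ℝ} (h : HasFDerivAt a L x) :
    HasP a (fun i => L (bv i)) x := by
  unfold HasP
  rwa [← eq_gr]

lemma fderiv_bv (h : HasP a c x) (i : Fin n) : fderiv ℝ a x (bv i) = c i := by
  rw [HasFDerivAt.fderiv h, gr_bv]

lemma const (k : ℝ) : HasP (fun _ : Eu n => k) (fun _ => 0) x := by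
  have : HasFDerivAt (fun _ : Eu n => k) (0 : Eu n →L[ℝ] ℝ) x := hasFDerivAt_const k x
  exact (of_hasFDerivAt this).congr_partials fun i => rfl

lemma coord (l : Fin n) : HasP (fun y : Eu n => y l) (fun i => if l = i then 1 else 0) x := by
  have : HasFDerivAt (fun y : Eu n => y l) (EuclideanSpace.proj l : Eu n →L[ℝ] ℝ) x :=
    (EuclideanSpace.proj l : Eu n →L[ℝ] ℝ).hasFDerivAt
  exact (of_hasFDerivAt this).congr_partials fun i => by simp [bv_apply]

lemma add (h : HasP a c x) (h' : HasP b d x) :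
    HasP (fun y => a y + b y) (fun i => c i + d i) x :=
  (of_hasFDerivAt (HasFDerivAt.add h h')).congr_partials fun i => by simp [gr_bv]

lemma sub (h : HasP a c x) (h' : HasP b d x) :
    HasP (fun y => a y - b y) (fun i => c i - d i) x :=
  (of_hasFDerivAt (HasFDerivAt.sub h h')).congr_partials fun i => by simp [gr_bv]

lemma mul (h : HasP a c x) (h' : HasP b d x) :
    HasP (fun y => a y * b y) (fun i => c i * b x + a x * d i) x :=
  (of_hasFDerivAt (HasFDerivAt.mul h h')).congr_partials fun i => by
    simp [gr_bv]; ring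

lemma const_mul (k : ℝ) (h : HasP a c x) : HasP (fun y => k * a y) (fun i => k * c i) x :=
  (of_hasFDerivAt (HasFDerivAt.const_mul h k)).congr_partials fun i => by simp [gr_bv]

lemma sum {ι : Type*} {t : Finset ι} {a : ι → Eu n → ℝ} {c : ι → Fin n → ℝ}
    (h : ∀ l ∈ t, HasP (a l) (c l) x) :
    HasP (fun y => ∑ l ∈ t, a l y) (fun i => ∑ l ∈ t, c l i) x :=
  (of_hasFDerivAt (HasFDerivAt.fun_sum h)).congr_partials fun i => by simp [gr_bv]

lemma real_comp {φ : ℝ → ℝ} {φ' : ℝ} (hφ : HasDerivAt φ φ' (a x)) (h : HasP a c x) :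
    HasP (fun y => φ (a y)) (fun i => φ' * c i) x :=
  (of_hasFDerivAt (hφ.comp_hasFDerivAt x h)).congr_partials fun i => by simp [gr_bv]

lemma comp {Φ : Eu n → Eu n} {J : Fin n → Fin n → ℝ}
    (hΦ : ∀ l, HasP (fun y => Φ y l) (J l) x) (h : HasP a c (Φ x)) :
    HasP (fun y => a (Φ y)) (fun i => ∑ l, c l * J l i) x := by
  let D : Eu n →L[ℝ] Eu n :=
    (EuclideanSpace.equiv (Fin n) ℝ).symm.toContinuousLinearMap.comp
      (ContinuousLinearMap.pi fun l => gr (J l))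
  have hD : ∀ l v, D v l = gr (J l) v := fun l v => rfl
  have : HasFDerivAt Φ D x := by
    rw [← hasFDerivWithinAt_univ, hasFDerivWithinAt_euclidean]
    intro l
    rw [hasFDerivWithinAt_univ]
    exact hΦ l
  refine (of_hasFDerivAt (HasFDerivAt.comp x h this)).congr_partials fun i => ?_
  simp only [ContinuousLinearMap.comp_apply]
  rw [gr_apply]
  simp [hD, gr_bv]

end HasP

/-- Open unit ball. -/
def UB (n : ℕ) : Set (Eu n) := Metric.ball 0 1

lemma mem_UB {x : Eu n} : x ∈ UB n ↔ ‖x‖ < 1 := by simp [UB]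

lemma isOpen_UB : IsOpen (UB n) := Metric.isOpen_ball

lemma UB_nhds {x : Eu n} (hx : x ∈ UB n) : UB n ∈ 𝓝 x := isOpen_UB.mem_nhds hx

/-- Defining function of the unit ball. -/
def df (x : Eu n) : ℝ := 1 - ∑ i, x i ^ 2

lemma df_eq (x : Eu n) : df x = 1 - ‖x‖ ^ 2 := by
  simp [df, EuclideanSpace.norm_sq_eq]

lemma df_pos {x : Eu n} (hx : x ∈ UB n) : 0 < df x := by
  rw [mem_UB] at hx; rw [df_eq]; nlinarith [norm_nonneg x]

lemma df_le_one (x : Eu n) : df x ≤ 1 := by rw [df_eq]; nlinarith [norm_nonneg x]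

/-- Variable smoothing scale. -/
def sc (r : ℝ) (x : Eu n) : ℝ := r * df x ^ 2

/-- Partial derivatives of the smoothing scale. -/
def dsc (j : Fin n) (r : ℝ) (x : Eu n) : ℝ := r * (-4 * df x * x j)

lemma hasP_df (x : Eu n) : HasP (df : Eu n → ℝ) (fun j => -2 * x j) x := by
  have h : HasP (fun y : Eu n => ∑ i, y i * y i) _ x :=
    HasP.sum fun l _ => (HasP.coord (x := x) l).mul (HasP.coord l)
  refine (((HasP.const 1).sub h).congr_partials fun i => ?_).congr_fun
    (Eventually.of_forall fun y => by simp [df, sq])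
  simp [Finset.sum_add_distrib]; ring

lemma hasP_sc (r : ℝ) (x : Eu n) : HasP (sc r) (fun j => dsc j r x) x := by
  refine (((hasP_df x).mul (hasP_df x)).const_mul r).congr_fun
    (Eventually.of_forall fun y => by simp [sc, sq]) |>.congr_partials fun i => ?_
  simp [dsc]; ring

/-- Admissible scales. -/
def II (ρ : ℝ) : Set ℝ := {r | 0 < r ∧ r ≤ 1 / 100 ∧ r ≤ ρ}

lemma II_mono {ρ ρ' : ℝ} (h : ρ' ≤ ρ) : II ρ' ⊆ II ρ := fun _ hr => ⟨hr.1, hr.2.1, hr.2.2.trans h⟩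

section
variable {ρ r : ℝ} {x y : Eu n}

lemma sc_pos (hr : r ∈ II ρ) (hx : x ∈ UB n) : 0 < sc r x :=
  mul_pos hr.1 (pow_pos (df_pos hx) 2)

lemma sc_le_r (hr : r ∈ II ρ) (hx : x ∈ UB n) : sc r x ≤ r := by
  have := df_pos hx
  have := df_le_one x
  have := hr.1
  unfold sc
  nlinarith [mul_nonneg this.le (show 0 ≤ 1 - df x ^ 2 by nlinarith)]

lemma sc_le_df (hr : r ∈ II ρ) : sc r x ≤ df x ^ 2 / 100 := by
  have := hr.2.1
  unfold sc
  nlinarith [sq_nonneg (df x)]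

lemma sc_le_one (hr : r ∈ II ρ) (hx : x ∈ UB n) : sc r x ≤ 1 :=
  (sc_le_r hr hx).trans (by linarith [hr.2.1])

lemma df_close (hx : x ∈ UB n) (h : ‖y - x‖ ≤ df x ^ 2 / 100) : |df y - df x| ≤ df x / 10 := by
  have h1 := df_pos hx
  have h2 := df_le_one x
  have h3 := mem_UB.1 hx
  have h4 : |‖y‖ - ‖x‖| ≤ df x ^ 2 / 100 := (abs_norm_sub_norm_le y x).trans h
  have h0 : 0 ≤ ‖x‖ := norm_nonneg x
  rw [df_eq y, df_eq x, ← df_eq x] at *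
  have h5 : df x ^ 2 ≤ df x := by nlinarith
  rw [abs_le] at h4 ⊢
  rw [df_eq x] at *
  constructor <;> nlinarith

lemma mem_UB_of_close (hx : x ∈ UB n) (h : ‖y - x‖ ≤ df x ^ 2 / 100) : y ∈ UB n := by
  have h1 := df_pos hx
  have h2 := abs_le.1 (df_close hx h)
  have h3 : 0 < df y := by linarith
  rw [df_eq] at h3
  rw [mem_UB]
  nlinarith [norm_nonneg y]

lemma sc_close (hr : 0 < r) (hx : x ∈ UB n) (h : ‖y - x‖ ≤ df x ^ 2 / 100) :
    sc r x / 2 ≤ sc r y ∧ sc r y ≤ 2 * sc r x := by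
  have h1 := df_pos hx
  have h2 := abs_le.1 (df_close hx h)
  unfold sc
  have h3 : df x ^ 2 / 2 ≤ df y ^ 2 := by nlinarith
  have h4 : df y ^ 2 ≤ 2 * df x ^ 2 := by nlinarith
  constructor <;> nlinarith

end

lemma zpow_close {s t : ℝ} (hs : 0 < s) (h1 : s / 2 ≤ t) (h2 : t ≤ 2 * s) (p : ℤ) :
    t ^ p ≤ 2 ^ p.natAbs * s ^ p := by
  have ht : 0 < t := by linarith
  obtain ⟨k, rfl | rfl⟩ := p.eq_nat_or_neg
  · simp only [zpow_natCast, Int.natAbs_natCast, ← mul_pow]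
    gcongr
  · simp only [zpow_neg, zpow_natCast, Int.natAbs_neg, Int.natAbs_natCast]
    rw [← inv_pow, ← inv_pow, ← mul_pow]
    gcongr
    rw [← div_eq_mul_inv, inv_le_comm₀ ht (by positivity)]
    simpa [div_eq_mul_inv, mul_comm] using h1

lemma zpow_anti {s : ℝ} (hs : 0 < s) (hs1 : s ≤ 1) {p q : ℤ} (h : p ≤ q) : s ^ q ≤ s ^ p :=
  zpow_le_zpow_right_of_le_one₀ hs hs1 h

/-- Weighted uniform bound. -/
def WB (ρ : ℝ) (p : ℤ) (a : ℝ → Eu n → ℝ) : Prop :=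
  ∃ C : ℝ, 0 ≤ C ∧ ∀ r ∈ II ρ, ∀ x ∈ UB n, |a r x| ≤ C * sc r x ^ p

/-- Families of functions on the unit ball whose derivatives of order `j ≤ k` are bounded by
`C * sc ^ (e j)`. -/
def Cls (ρ : ℝ) : ℕ → (ℕ → ℤ) → (ℝ → Eu n → ℝ) → Prop
  | 0, e, a => WB ρ (e 0) a
  | k + 1, e, a => WB ρ (e 0) a ∧ ∃ a' : Fin n → ℝ → Eu n → ℝ,
      (∀ r ∈ II ρ, ∀ x ∈ UB n, HasP (a r) (fun i => a' i r x) x) ∧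
      ∀ i, Cls ρ k (fun j => e (j + 1)) (a' i)

section
variable {ρ : ℝ} {p q : ℤ} {a b : ℝ → Eu n → ℝ} {k : ℕ} {e e' : ℕ → ℤ}

lemma WB.mono (h : WB ρ p a) (hq : q ≤ p) : WB ρ q a := by
  obtain ⟨C, hC, h⟩ := h
  exact ⟨C, hC, fun r hr x hx => (h r hr x hx).trans
    (mul_le_mul_of_nonneg_left (zpow_anti (sc_pos hr hx) (sc_le_one hr hx) hq) hC)⟩

lemma WB.congr (h : WB ρ p a) (hb : ∀ r ∈ II ρ, ∀ x ∈ UB n, b r x = a r x) : WB ρ p b := by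
  obtain ⟨C, hC, h⟩ := h
  exact ⟨C, hC, fun r hr x hx => by rw [hb r hr x hx]; exact h r hr x hx⟩

lemma WB.add (h : WB ρ p a) (h' : WB ρ p b) : WB ρ p (fun r x => a r x + b r x) := by
  obtain ⟨C, hC, h⟩ := h
  obtain ⟨D, hD, h'⟩ := h'
  refine ⟨C + D, by positivity, fun r hr x hx => (abs_add_le _ _).trans ?_⟩
  rw [add_mul]
  exact add_le_add (h r hr x hx) (h' r hr x hx)

lemma WB.mul (h : WB ρ p a) (h' : WB ρ q b) : WB ρ (p + q) (fun r x => a r x * b r x) := by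
  obtain ⟨C, hC, h⟩ := h
  obtain ⟨D, hD, h'⟩ := h'
  refine ⟨C * D, by positivity, fun r hr x hx => ?_⟩
  have hs := sc_pos hr hx
  rw [abs_mul, zpow_add₀ hs.ne', mul_mul_mul_comm]
  exact mul_le_mul (h r hr x hx) (h' r hr x hx) (abs_nonneg _) (by positivity)

lemma Cls.wb (h : Cls ρ k e a) : WB ρ (e 0) a := by
  cases k with
  | zero => exact h
  | succ k => exact h.1

lemma Cls.rmono {ρ' : ℝ} (h : Cls ρ k e a) (hρ : ρ' ≤ ρ) : Cls ρ' k e a := by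
  have key : ∀ {p : ℤ} {a : ℝ → Eu n → ℝ}, WB ρ p a → WB ρ' p a := fun ⟨C, hC, h⟩ =>
    ⟨C, hC, fun r hr => h r (II_mono hρ hr)⟩
  induction k generalizing a e with
  | zero => exact key h
  | succ k ih =>
    obtain ⟨h0, a', h1, h2⟩ := h
    exact ⟨key h0, a', fun r hr => h1 r (II_mono hρ hr), fun i => ih (h2 i)⟩

lemma Cls.congr (h : Cls ρ k e a) (hb : ∀ r ∈ II ρ, ∀ x ∈ UB n, b r x = a r x) :
    Cls ρ k e b := by
  cases k with
  | zero => exact WB.congr h hb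
  | succ k =>
    obtain ⟨h0, a', h1, h2⟩ := h
    exact ⟨h0.congr hb, a', fun r hr x hx => (h1 r hr x hx).congr_fun
      (by filter_upwards [UB_nhds hx] with y hy using hb r hr y hy), h2⟩

lemma Cls.mono (h : Cls ρ k e a) (he : ∀ j ≤ k, e' j ≤ e j) : Cls ρ k e' a := by
  induction k generalizing a e e' with
  | zero => exact WB.mono h (he 0 le_rfl)
  | succ k ih =>
    obtain ⟨h0, a', h1, h2⟩ := h
    exact ⟨h0.mono (he 0 (Nat.zero_le _)), a', h1, fun i => ih (h2 i) fun j hj => he _ (by omega)⟩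

lemma Cls.le {l : ℕ} (h : Cls ρ k e a) (hl : l ≤ k) : Cls ρ l e a := by
  induction l generalizing a e k with
  | zero => exact h.wb
  | succ l ih =>
    obtain ⟨k, rfl⟩ : ∃ m, k = m + 1 := ⟨k - 1, by omega⟩
    obtain ⟨h0, a', h1, h2⟩ := h
    exact ⟨h0, a', h1, fun i => ih (h2 i) (by omega)⟩

lemma Cls.head (h : Cls ρ k e a) (h' : WB ρ p a) (he : e' 0 ≤ p)
    (he' : ∀ j ≤ k, 0 < j → e' j ≤ e j) : Cls ρ k e' a := by
  cases k with
  | zero => exact h'.mono he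
  | succ k =>
    obtain ⟨h0, a', h1, h2⟩ := h
    exact ⟨h'.mono he, a', h1, fun i => (h2 i).mono fun j hj => he' _ (by omega) (by omega)⟩

lemma Cls.add (h : Cls ρ k e a) (h' : Cls ρ k e b) : Cls ρ k e (fun r x => a r x + b r x) := by
  induction k generalizing a b e with
  | zero => exact WB.add h h'
  | succ k ih =>
    obtain ⟨h0, a', h1, h2⟩ := h
    obtain ⟨g0, b', g1, g2⟩ := h'
    exact ⟨h0.add g0, fun i r x => a' i r x + b' i r x,
      fun r hr x hx => (h1 r hr x hx).add (g1 r hr x hx), fun i => ih (h2 i) (g2 i)⟩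

lemma Cls.mul {e'' : ℕ → ℤ} (h : Cls ρ k e a) (h' : Cls ρ k e' b)
    (he : ∀ i j, i + j ≤ k → e'' (i + j) ≤ e i + e' j) :
    Cls ρ k e'' (fun r x => a r x * b r x) := by
  induction k generalizing a b e e' e'' with
  | zero => exact (WB.mul h h').mono (he 0 0 le_rfl)
  | succ k ih =>
    have hl := h.le (Nat.le_succ k)
    have hl' := h'.le (Nat.le_succ k)
    obtain ⟨h0, a', h1, h2⟩ := h
    obtain ⟨g0, b', g1, g2⟩ := h'
    refine ⟨(h0.mul g0).mono (he 0 0 (by omega)), fun i r x => a' i r x * b r x + a r x * b' i r x,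
      fun r hr x hx => (h1 r hr x hx).mul (g1 r hr x hx), fun i => Cls.add ?_ ?_⟩
    · exact ih (h2 i) hl' fun i j hij => by
        have := he (i + 1) j (by omega)
        rwa [show i + 1 + j = i + j + 1 by ring] at this
    · exact ih hl (g2 i) fun i j hij => he i (j + 1) (by omega)

lemma Cls.zero : Cls ρ k e (fun _ (_ : Eu n) => 0) := by
  have h0 : ∀ p, WB ρ p (fun _ (_ : Eu n) => 0) := fun p => ⟨0, le_rfl, fun r hr x hx => by simp⟩
  induction k generalizing e with
  | zero => exact h0 _
  | succ k ih => exact ⟨h0 _, fun _ _ _ => 0, fun r hr x hx => HasP.const 0, fun i => ih⟩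

lemma Cls.const (c : ℝ) (he : ∀ j ≤ k, e j ≤ 0) : Cls ρ k e (fun _ (_ : Eu n) => c) := by
  have h0 : WB ρ 0 (fun _ (_ : Eu n) => c) := ⟨|c|, abs_nonneg _, fun r hr x hx => by simp⟩
  cases k with
  | zero => exact h0.mono (he 0 le_rfl)
  | succ k => exact ⟨h0.mono (he 0 (by omega)), fun _ _ _ => 0, fun r hr x hx => HasP.const c,
      fun i => Cls.zero⟩

lemma WB.const_mul (c : ℝ) (h : WB ρ p a) : WB ρ p (fun r x => c * a r x) := by
  obtain ⟨C, hC, h⟩ := h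
  refine ⟨|c| * C, by positivity, fun r hr x hx => ?_⟩
  rw [abs_mul, mul_assoc]
  exact mul_le_mul_of_nonneg_left (h r hr x hx) (abs_nonneg c)

lemma Cls.const_mul (c : ℝ) (h : Cls ρ k e a) : Cls ρ k e (fun r x => c * a r x) := by
  induction k generalizing a e with
  | zero => exact WB.const_mul c h
  | succ k ih =>
    obtain ⟨h0, a', h1, h2⟩ := h
    exact ⟨h0.const_mul c, fun i r x => c * a' i r x,
      fun r hr x hx => (h1 r hr x hx).const_mul c, fun i => ih (h2 i)⟩

lemma Cls.neg (h : Cls ρ k e a) : Cls ρ k e (fun r x => - a r x) :=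
  (h.const_mul (-1)).congr fun r _ x _ => by ring

lemma Cls.sub (h : Cls ρ k e a) (h' : Cls ρ k e b) : Cls ρ k e (fun r x => a r x - b r x) :=
  (h.add h'.neg).congr fun r _ x _ => by ring

lemma Cls.sum {ι : Type*} {t : Finset ι} {a : ι → ℝ → Eu n → ℝ}
    (h : ∀ l ∈ t, Cls ρ k e (a l)) : Cls ρ k e (fun r x => ∑ l ∈ t, a l r x) := by
  classical
  induction t using Finset.induction_on with
  | empty => simpa using Cls.zero
  | insert l t hl ih =>
    simp only [Finset.sum_insert hl]
    exact (h l (Finset.mem_insert_self _ _)).add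
      (ih fun m hm => h m (Finset.mem_insert_of_mem hm))

lemma Cls.partials {a' : Fin n → ℝ → Eu n → ℝ} (h : Cls ρ (k + 1) e a)
    (h' : ∀ r ∈ II ρ, ∀ x ∈ UB n, HasP (a r) (fun i => a' i r x) x) (i : Fin n) :
    Cls ρ k (fun j => e (j + 1)) (a' i) := by
  obtain ⟨_, b', h1, h2⟩ := h
  exact (h2 i).congr fun r hr x hx => (h' r hr x hx).unique (h1 r hr x hx) i

lemma Cls.continuousOn (h : Cls ρ (k + 1) e a) {r : ℝ} (hr : r ∈ II ρ) :
    ContinuousOn (a r) (UB n) := by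
  obtain ⟨_, b', h1, h2⟩ := h
  exact fun x hx => (h1 r hr x hx).continuousAt.continuousWithinAt

end

/-- Differentiation under the integral sign for a finite measure. -/
lemma hasP_integral {Ω : Type*} [MeasurableSpace Ω] {μ : Measure Ω} [IsFiniteMeasure μ]
    {F : Eu n → Ω → ℝ} {c : Fin n → Eu n → Ω → ℝ} {x₀ : Eu n} {s : Set (Eu n)} {B : ℝ}
    (hs : s ∈ 𝓝 x₀) (hF : ∀ x ∈ s, AEStronglyMeasurable (F x) μ)
    (hFB : ∀ᵐ ω ∂μ, |F x₀ ω| ≤ B)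
    (hc : ∀ i, AEStronglyMeasurable (c i x₀) μ)
    (hcB : ∀ᵐ ω ∂μ, ∀ x ∈ s, ∀ i, |c i x ω| ≤ B)
    (hd : ∀ᵐ ω ∂μ, ∀ x ∈ s, HasP (fun y => F y ω) (fun i => c i x ω) x) :
    HasP (fun x => ∫ ω, F x ω ∂μ) (fun i => ∫ ω, c i x₀ ω ∂μ) x₀ := by
  have hm : AEStronglyMeasurable (fun ω => gr (fun i => c i x₀ ω)) μ := by
    unfold gr
    exact Finset.aestronglyMeasurable_fun_sum _ fun i _ => (hc i).smul_const _
  have hB : ∀ᵐ ω ∂μ, ∀ x ∈ s, ‖gr (fun i => c i x ω)‖ ≤ n * B := by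
    filter_upwards [hcB] with ω h x hx using norm_gr_le_of_abs_le (h x hx)
  have h0 := mem_of_mem_nhds hs
  have key := hasFDerivAt_integral_of_dominated_of_fderiv_le (μ := μ) (F := F)
    (F' := fun x ω => gr (fun i => c i x ω)) (bound := fun _ => n * B) hs
    (by filter_upwards [hs] with x hx using hF x hx)
    (Integrable.of_bound (hF x₀ h0) B (by simpa using hFB)) hm hB (integrable_const _) hd
  refine (HasP.of_hasFDerivAt key).congr_partials fun i => ?_
  have hi : Integrable (fun ω => gr (fun i => c i x₀ ω)) μ :=
    Integrable.of_bound hm (n * B) (by filter_upwards [hB] with ω h using h x₀ h0)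
  rw [ContinuousLinearMap.integral_apply hi]
  simp [gr_bv]

/-- Measurability on the unit ball. -/
def MeasU (ρ : ℝ) (a : ℝ → Eu n → ℝ) : Prop :=
  ∀ r ∈ II ρ, Measurable ((UB n).indicator (a r))

lemma measurableSet_UB : MeasurableSet (UB n) := isOpen_UB.measurableSet

section
variable {ρ : ℝ} {a b : ℝ → Eu n → ℝ} {k : ℕ} {e : ℕ → ℤ}

lemma measurable_indicator_of_continuousOn {a : Eu n → ℝ} (h : ContinuousOn a (UB n)) :
    Measurable ((UB n).indicator a) := by
  classical
  rw [← Set.piecewise_eq_indicator]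
  exact h.measurable_piecewise continuousOn_const measurableSet_UB

lemma Cls.measU (h : Cls ρ (k + 1) e a) : MeasU ρ a := fun _ hr =>
  measurable_indicator_of_continuousOn (h.continuousOn hr)

lemma measU_of_hasP {a' : Fin n → ℝ → Eu n → ℝ}
    (h : ∀ r ∈ II ρ, ∀ x ∈ UB n, HasP (a r) (fun i => a' i r x) x) (i : Fin n) :
    MeasU ρ (a' i) := by
  intro r hr
  have : (UB n).indicator (a' i r) = (UB n).indicator (fun x => fderiv ℝ (a r) x (bv i)) :=
    Set.indicator_congr fun x hx => ((h r hr x hx).fderiv_bv i).symm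
  rw [this]
  exact (measurable_fderiv_apply_const ℝ (a r) (bv i)).indicator measurableSet_UB

end

/-- Averaging kernels. -/
structure Ker {Ω : Type*} [MeasurableSpace Ω] (μ : Measure Ω) (ψ : Ω → ℝ) (b : Ω → Eu n) : Prop where
  meas : Measurable ψ
  measb : Measurable b
  bdd : ∃ C, 0 ≤ C ∧ ∀ᵐ ω ∂μ, |ψ ω| ≤ C
  bddb : ∀ᵐ ω ∂μ, ‖b ω‖ ≤ 1

/-- Variable scale averaging operator. -/
def Wop {Ω : Type*} [MeasurableSpace Ω] (μ : Measure Ω) (ψ : Ω → ℝ) (b : Ω → Eu n)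
    (K : ℝ → Eu n → ℝ) : ℝ → Eu n → ℝ :=
  fun r x => ∫ ω, ψ ω * K r (x - sc r x • b ω) ∂μ

section
variable {Ω : Type*} [MeasurableSpace Ω] {μ : Measure Ω} {ψ : Ω → ℝ}
  {b : Ω → Eu n} {ρ r : ℝ} {K : ℝ → Eu n → ℝ} {k : ℕ} {e : ℕ → ℤ} {p : ℤ} {x : Eu n}

lemma Ker.mul_coord (h : Ker μ ψ b) (l : Fin n) : Ker μ (fun ω => ψ ω * b ω l) b where
  meas := h.meas.mul ((EuclideanSpace.proj l : Eu n →L[ℝ] ℝ).measurable.comp h.measb)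
  measb := h.measb
  bdd := by
    obtain ⟨C, hC, hb⟩ := h.bdd
    refine ⟨C, hC, ?_⟩
    filter_upwards [hb, h.bddb] with ω h1 h2
    rw [abs_mul]
    nlinarith [abs_apply_le_norm (b ω) l, abs_nonneg (b ω l), abs_nonneg (ψ ω)]
  bddb := h.bddb

lemma close_of_norm_le {z : Eu n} (hr : r ∈ II ρ) (hx : x ∈ UB n) (hz : ‖z‖ ≤ 1) :
    ‖x - sc r x • z - x‖ ≤ df x ^ 2 / 100 := by
  have h1 := sc_le_df (n := n) (x := x) hr
  have h2 := sc_pos hr hx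
  rw [sub_sub_cancel_left, norm_neg, norm_smul, Real.norm_eq_abs, abs_of_pos h2]
  nlinarith

lemma shift_mem {z : Eu n} (hr : r ∈ II ρ) (hx : x ∈ UB n) (hz : ‖z‖ ≤ 1) :
    x - sc r x • z ∈ UB n := mem_UB_of_close hx (close_of_norm_le hr hx hz)

lemma shift_bound {z : Eu n} {C : ℝ} {c : Eu n → ℝ} (hC : 0 ≤ C)
    (h : ∀ x ∈ UB n, |c x| ≤ C * sc r x ^ p)
    (hr : r ∈ II ρ) (hx : x ∈ UB n) (hz : ‖z‖ ≤ 1) :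
    |c (x - sc r x • z)| ≤ C * 2 ^ p.natAbs * sc r x ^ p := by
  refine (h _ (shift_mem hr hx hz)).trans ?_
  have := sc_close hr.1 hx (close_of_norm_le hr hx hz)
  rw [mul_assoc]
  exact mul_le_mul_of_nonneg_left (zpow_close (sc_pos hr hx) this.1 this.2 p) hC

lemma Ker.aesm (h : Ker μ ψ b) (hK : MeasU ρ K) (hr : r ∈ II ρ) (hx : x ∈ UB n) :
    AEStronglyMeasurable (fun ω => K r (x - sc r x • b ω)) μ := by
  have : AEStronglyMeasurable (fun ω => (UB n).indicator (K r) (x - sc r x • b ω)) μ :=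
    ((hK r hr).comp (measurable_const.sub (h.measb.const_smul (sc r x)))).aestronglyMeasurable
  refine this.congr ?_
  filter_upwards [h.bddb] with ω hω
  rw [Set.indicator_of_mem (shift_mem hr hx hω)]

lemma Ker.aesm_mul (h : Ker μ ψ b) (hK : MeasU ρ K) (hr : r ∈ II ρ) (hx : x ∈ UB n) :
    AEStronglyMeasurable (fun ω => ψ ω * K r (x - sc r x • b ω)) μ :=
  h.meas.aestronglyMeasurable.mul (h.aesm hK hr hx)

lemma Ker.integrable [IsFiniteMeasure μ] (h : Ker μ ψ b) (hK : MeasU ρ K) (hb : WB ρ p K)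
    (hr : r ∈ II ρ) (hx : x ∈ UB n) :
    Integrable (fun ω => ψ ω * K r (x - sc r x • b ω)) μ := by
  obtain ⟨C, hC, hCb⟩ := hb
  obtain ⟨D, hD, hDb⟩ := h.bdd
  refine Integrable.of_bound (h.aesm_mul hK hr hx) (D * (C * 2 ^ p.natAbs * sc r x ^ p)) ?_
  filter_upwards [hDb, h.bddb] with ω h1 h2
  rw [norm_mul]
  exact mul_le_mul h1 (shift_bound hC (hCb r hr) hr hx h2) (abs_nonneg _) hD

lemma WB.wop [IsFiniteMeasure μ] (h : Ker μ ψ b) (hb : WB ρ p K) : WB ρ p (Wop μ ψ b K) := by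
  obtain ⟨C, hC, hCb⟩ := hb
  obtain ⟨D, hD, hDb⟩ := h.bdd
  refine ⟨D * (C * 2 ^ p.natAbs) * μ.real univ, by positivity, fun r hr x hx => ?_⟩
  have : ∀ᵐ ω ∂μ, ‖ψ ω * K r (x - sc r x • b ω)‖ ≤ D * (C * 2 ^ p.natAbs * sc r x ^ p) := by
    filter_upwards [hDb, h.bddb] with ω h1 h2
    rw [norm_mul]
    exact mul_le_mul h1 (shift_bound hC (hCb r hr) hr hx h2) (abs_nonneg _) hD
  refine (norm_integral_le_of_norm_le_const this).trans (le_of_eq ?_)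
  ring

lemma sc_near (hr : r ∈ II ρ) (hx : x ∈ UB n) :
    ∀ᶠ y in 𝓝 x, y ∈ UB n ∧ sc r x / 2 ≤ sc r y ∧ sc r y ≤ 2 * sc r x := by
  have hd := df_pos hx
  filter_upwards [Metric.closedBall_mem_nhds x (show 0 < df x ^ 2 / 100 by positivity)] with y hy
  rw [mem_closedBall_iff_norm] at hy
  exact ⟨mem_UB_of_close hx hy, sc_close hr.1 hx hy⟩

lemma abs_dsc_le (hr : r ∈ II ρ) (hx : x ∈ UB n) (j : Fin n) : |dsc j r x| ≤ 1 := by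
  have h1 := df_pos hx
  have h2 := df_le_one x
  have h3 := mem_UB.1 hx
  have h4 := abs_apply_le_norm x j
  have h5 := hr.2.1
  have h6 := hr.1
  unfold dsc
  rw [abs_mul, abs_mul, abs_mul, abs_of_pos h1, abs_of_pos h6]
  norm_num
  have : df x * |x j| ≤ 1 := by nlinarith [abs_nonneg (x j)]
  nlinarith [abs_nonneg (x j), mul_nonneg h1.le (abs_nonneg (x j))]

lemma hasP_shift (z x : Eu n) (l : Fin n) :
    HasP (fun y => (y - sc r y • z) l) (fun j => (if l = j then 1 else 0) - z l * dsc j r x) x :=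
  ((HasP.coord l).sub ((hasP_sc r x).const_mul (z l))).congr_fun
    (Eventually.of_forall fun y => by simp [mul_comm])

lemma HasP.comp_shift {a : Eu n → ℝ} {c : Fin n → ℝ} {z : Eu n} (h : HasP a c (x - sc r x • z)) :
    HasP (fun y => a (y - sc r y • z)) (fun j => c j - ∑ l, dsc j r x * (z l * c l)) x := by
  refine (HasP.comp (fun l => hasP_shift z x l) h).congr_partials fun j => ?_
  simp only [mul_sub, Finset.sum_sub_distrib]
  congr 1
  · simp
  · exact Finset.sum_congr rfl fun l _ => by ring

lemma hasP_wop [IsFiniteMeasure μ] (h : Ker μ ψ b) {K' : Fin n → ℝ → Eu n → ℝ} {q : ℤ}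
    (hK : ∀ r ∈ II ρ, ∀ x ∈ UB n, HasP (K r) (fun i => K' i r x) x)
    (hb : WB ρ p K) (hb' : ∀ i, WB ρ q (K' i)) (hr : r ∈ II ρ) (hx : x ∈ UB n) :
    HasP (Wop μ ψ b K r) (fun j => Wop μ ψ b (K' j) r x -
      ∑ l, dsc j r x * Wop μ (fun ω => ψ ω * b ω l) b (K' l) r x) x := by
  have hmK : MeasU ρ K := fun r hr => measurable_indicator_of_continuousOn
    fun x hx => (hK r hr x hx).continuousAt.continuousWithinAt
  have hmK' := measU_of_hasP hK
  obtain ⟨D, hD, hDb⟩ := h.bdd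
  obtain ⟨C, hC, hCb⟩ := hb
  choose C' hC' hCb' using hb'
  set M := ∑ i, C' i
  have hM : ∀ i, C' i ≤ M := fun i => Finset.single_le_sum (fun j _ => hC' j) (Finset.mem_univ i)
  have hM0 : 0 ≤ M := Finset.sum_nonneg fun j _ => hC' j
  have hsx := sc_pos hr hx
  set T := M * 2 ^ q.natAbs * (2 ^ q.natAbs * sc r x ^ q)
  have hT : 0 ≤ T := by positivity
  have hnear := sc_near hr hx
  set B := D * (T + n * T) + D * (C * 2 ^ p.natAbs * sc r x ^ p)
  have key : HasP (fun y => ∫ ω, ψ ω * K r (y - sc r y • b ω) ∂μ)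
      (fun j => ∫ ω, (ψ ω * (K' j r (x - sc r x • b ω) -
        ∑ l, dsc j r x * (b ω l * K' l r (x - sc r x • b ω)))) ∂μ) x := by
    refine hasP_integral (c := fun j x ω => ψ ω * (K' j r (x - sc r x • b ω) -
        ∑ l, dsc j r x * (b ω l * K' l r (x - sc r x • b ω)))) (B := B) hnear ?_ ?_ ?_ ?_ ?_
    · exact fun y hy => h.aesm_mul hmK hr hy.1
    · filter_upwards [hDb, h.bddb] with ω h1 h2
      rw [abs_mul]
      have := mul_le_mul h1 (shift_bound hC (hCb r hr) hr hx h2) (abs_nonneg _) hD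
      have h3 : 0 ≤ D * (T + n * T) := by positivity
      linarith
    · intro j
      refine h.meas.aestronglyMeasurable.mul ((h.aesm (hmK' j) hr hx).sub ?_)
      refine Finset.aestronglyMeasurable_fun_sum _ fun l _ => AEStronglyMeasurable.const_mul ?_ _
      exact (((EuclideanSpace.proj l : Eu n →L[ℝ] ℝ).measurable.comp
        h.measb).aestronglyMeasurable).mul (h.aesm (hmK' l) hr hx)
    · filter_upwards [hDb, h.bddb] with ω h1 h2 y hy j
      have hT' : ∀ i, |K' i r (y - sc r y • b ω)| ≤ T := fun i => by
        refine (shift_bound (hC' i) (hCb' i r hr) hr hy.1 h2).trans ?_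
        have := zpow_close hsx hy.2.1 hy.2.2 q
        have h7 := hM i
        exact mul_le_mul (mul_le_mul_of_nonneg_right h7 (by positivity)) this
          (zpow_pos (sc_pos hr hy.1) q).le (by positivity)
      have hsum : |∑ l, dsc j r y * (b ω l * K' l r (y - sc r y • b ω))| ≤ n * T := by
        refine (Finset.abs_sum_le_sum_abs _ _).trans ((Finset.sum_le_sum
          (g := fun _ => T) fun l _ => ?_).trans (by simp))
        rw [abs_mul, abs_mul]
        have h3 := abs_dsc_le hr hy.1 j
        have h4 := (abs_apply_le_norm (b ω) l).trans h2
        have h5 := hT' l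
        calc |dsc j r y| * (|b ω l| * |K' l r (y - sc r y • b ω)|) ≤ 1 * (1 * T) := by gcongr
          _ = T := by ring
      rw [abs_mul]
      have h5 : |K' j r (y - sc r y • b ω) -
        ∑ l, dsc j r y * (b ω l * K' l r (y - sc r y • b ω))| ≤ T + n * T :=
        (abs_sub _ _).trans (add_le_add (hT' j) hsum)
      have h6 : 0 ≤ D * (C * 2 ^ p.natAbs * sc r x ^ p) := by positivity
      have := mul_le_mul h1 h5 (abs_nonneg _) hD
      linarith
    · filter_upwards [h.bddb] with ω h2 y hy
      exact ((hK r hr _ (shift_mem hr hy.1 h2)).comp_shift).const_mul (ψ ω)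
  refine HasP.congr_partials key fun j => ?_
  have hI := fun l => (h.mul_coord l).integrable (hmK' l) ⟨C' l, hC' l, hCb' l⟩ hr hx
  simp only [Wop]
  simp_rw [← integral_const_mul]
  rw [← integral_finsetSum _ fun l _ => (hI l).const_mul _,
    ← integral_sub (h.integrable (hmK' j) ⟨C' j, hC' j, hCb' j⟩ hr hx)
      (integrable_finsetSum _ fun l _ => (hI l).const_mul _)]
  refine integral_congr_ae (Eventually.of_forall fun ω => ?_)
  simp only [mul_sub, Finset.mul_sum]
  congr 1
  exact Finset.sum_congr rfl fun l _ => by ring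

end

open scoped ContDiff

section
variable {ρ : ℝ} {k : ℕ} {e : ℕ → ℤ} {a b : ℝ → Eu n → ℝ}

lemma exists_bound_UB {g : Eu n → ℝ} (hg : Continuous g) : ∃ C, 0 ≤ C ∧ ∀ x ∈ UB n, |g x| ≤ C := by
  obtain ⟨C, hC⟩ := (isCompact_closedBall (0 : Eu n) 1).exists_bound_of_continuousOn hg.continuousOn
  refine ⟨max C 0, le_max_right _ _, fun x hx => (hC x ?_).trans (le_max_left _ _)⟩
  exact Metric.ball_subset_closedBall hx

lemma contDiff_partial {g : Eu n → ℝ} (hg : ContDiff ℝ ∞ g) (i : Fin n) :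
    ContDiff ℝ ∞ (fun x => fderiv ℝ g x (bv i)) :=
  (hg.fderiv_right (m := ∞) le_rfl).clm_apply contDiff_const

lemma hasP_of_contDiff {g : Eu n → ℝ} (hg : ContDiff ℝ ∞ g) (x : Eu n) :
    HasP g (fun i => fderiv ℝ g x (bv i)) x :=
  HasP.of_hasFDerivAt (hg.differentiable (by simp) x).hasFDerivAt

lemma Cls.smooth {g : Eu n → ℝ} (hg : ContDiff ℝ ∞ g) (he : ∀ j ≤ k, e j ≤ 0) :
    Cls ρ k e (fun _ => g) := by
  have h0 : ∀ {g : Eu n → ℝ}, ContDiff ℝ ∞ g → WB ρ 0 (fun _ => g) := fun {g} hg => by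
    obtain ⟨C, hC, h⟩ := exists_bound_UB hg.continuous
    exact ⟨C, hC, fun r hr x hx => by simpa using h x hx⟩
  induction k generalizing g e with
  | zero => exact (h0 hg).mono (he 0 le_rfl)
  | succ k ih =>
    exact ⟨(h0 hg).mono (he 0 (by omega)), fun i _ x => fderiv ℝ g x (bv i),
      fun r _ x _ => hasP_of_contDiff hg x,
      fun i => ih (contDiff_partial hg i) fun j hj => he _ (by omega)⟩

/-- The functions whose derivatives of order at most `k` are uniformly bounded. -/
abbrev zeroExp : ℕ → ℤ := fun _ => 0

lemma Cls.coord (l : Fin n) : Cls ρ k zeroExp (fun _ (x : Eu n) => x l) :=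
  Cls.smooth (EuclideanSpace.proj l : Eu n →L[ℝ] ℝ).contDiff fun _ _ => le_rfl

lemma Cls.param {φ : ℝ → ℝ} {C : ℝ} (hφ : ∀ r ∈ II ρ, |φ r| ≤ C) :
    Cls ρ k zeroExp (fun r (_ : Eu n) => φ r) := by
  have h0 : WB ρ 0 (fun r (_ : Eu n) => φ r) :=
    ⟨max C 0, le_max_right _ _, fun r hr x hx => by
      simpa using (Or.inl (hφ r hr) : |φ r| ≤ C ∨ |φ r| ≤ 0)⟩
  cases k with
  | zero => exact h0
  | succ k => exact ⟨h0, fun _ _ _ => 0, fun r hr x hx => HasP.const _, fun i => Cls.zero⟩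

lemma Cls.radius : Cls ρ k zeroExp (fun r (_ : Eu n) => r) :=
  Cls.param (C := 1) fun r hr => by rw [abs_of_pos hr.1]; linarith [hr.2.1]

lemma Cls.zmul (h : Cls ρ k zeroExp a) (h' : Cls ρ k e b) (he : ∀ i j, i ≤ j → e j ≤ e i) :
    Cls ρ k e (fun r x => a r x * b r x) :=
  h.mul h' fun i j _ => by simpa using he j (i + j) (by omega)

lemma contDiff_df : ContDiff ℝ ∞ (df : Eu n → ℝ) :=
  contDiff_const.sub (ContDiff.sum fun i _ =>
    ((EuclideanSpace.proj i : Eu n →L[ℝ] ℝ).contDiff).pow 2)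

lemma Cls.dscale (j : Fin n) : Cls ρ k zeroExp (dsc j : ℝ → Eu n → ℝ) :=
  Cls.radius.zmul ((Cls.smooth (g := fun x : Eu n => -4 * df x * x j)
    ((contDiff_const.mul contDiff_df).mul (EuclideanSpace.proj j : Eu n →L[ℝ] ℝ).contDiff)
    fun _ _ => le_rfl)) fun _ _ _ => le_rfl

lemma Cls.scale : Cls ρ k (fun j => 1 - j) (sc : ℝ → Eu n → ℝ) := by
  have h : Cls ρ k zeroExp (sc : ℝ → Eu n → ℝ) :=
    Cls.radius.zmul (Cls.smooth (contDiff_df.pow 2) fun _ _ => le_rfl) fun _ _ _ => le_rfl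
  refine h.head (p := 1) ⟨1, zero_le_one, fun r hr x hx => ?_⟩ (by simp) fun j _ _ => ?_
  · simp [abs_of_pos (sc_pos hr hx)]
  · simp; omega

lemma Cls.scaleInv : Cls ρ k (fun j => -1 - j) (fun r (x : Eu n) => (sc r x)⁻¹) := by
  have h0 : WB ρ (-1) (fun r (x : Eu n) => (sc r x)⁻¹) :=
    ⟨1, zero_le_one, fun r hr x hx => by simp [abs_of_pos (sc_pos hr hx)]⟩
  induction k with
  | zero => exact h0
  | succ k ih =>
    refine ⟨h0, fun i r x => dsc i r x * (-1 * ((sc r x)⁻¹ * (sc r x)⁻¹)),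
      fun r hr x hx => ?_, fun i => ?_⟩
    · have hs := (sc_pos hr hx).ne'
      refine (HasP.real_comp (hasDerivAt_inv hs) (hasP_sc r x)).congr_partials fun i => ?_
      field_simp
    · refine (Cls.dscale i).zmul (Cls.const_mul _ (ih.mul ih fun i j _ => ?_)) ?_
      · push_cast; omega
      · intro i j h; push_cast; omega

lemma Cls.smooth_inner {g : Eu n → ℝ} (hg : ContDiff ℝ ∞ g) (hv : ∀ x, 9 / 10 < ‖x‖ → g x = 0)
    (he : ∀ j ≤ k, e j ≤ 1) : Cls ρ k e (fun r x => r * g x) := by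
  have h0 : ∀ {g : Eu n → ℝ}, ContDiff ℝ ∞ g → (∀ x, 9 / 10 < ‖x‖ → g x = 0) →
      WB ρ 1 (fun r x => r * g x) := fun {g} hg hv => by
    obtain ⟨C, hC, h⟩ := exists_bound_UB hg.continuous
    refine ⟨100 * C, by positivity, fun r hr x hx => ?_⟩
    rw [zpow_one]
    beta_reduce
    have hs := (sc_pos hr hx).le
    rcases lt_or_ge (9 / 10) ‖x‖ with h1 | h1
    · rw [hv x h1, mul_zero, abs_zero]; positivity
    · rw [abs_mul, abs_of_pos hr.1]
      have h2 : 1 / 100 ≤ df x ^ 2 := by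
        have : 19 / 100 ≤ df x := by rw [df_eq]; nlinarith [norm_nonneg x]
        nlinarith
      have h3 := hr.1
      have h4 : r ≤ 100 * sc r x := by unfold sc; nlinarith
      calc r * |g x| ≤ (100 * sc r x) * C :=
            mul_le_mul h4 (h x hx) (abs_nonneg _) (by positivity)
        _ = _ := by ring
  induction k generalizing g e with
  | zero => exact (h0 hg hv).mono (he 0 le_rfl)
  | succ k ih =>
    refine ⟨(h0 hg hv).mono (he 0 (by omega)), fun i r x => r * fderiv ℝ g x (bv i),
      fun r _ x _ => (hasP_of_contDiff hg x).const_mul r,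
      fun i => ih (contDiff_partial hg i) (fun x hx => ?_) fun j hj => he _ (by omega)⟩
    have : g =ᶠ[𝓝 x] fun _ => 0 := by
      filter_upwards [(isOpen_lt continuous_const continuous_norm).mem_nhds hx] with y hy using hv y hy
    rw [this.fderiv_eq]; simp

end

section
variable {Ω : Type*} [MeasurableSpace Ω] {μ : Measure Ω} {ψ : Ω → ℝ}
  {b : Ω → Eu n} {ρ : ℝ} {K : ℝ → Eu n → ℝ} {k : ℕ} {e : ℕ → ℤ}

lemma Cls.wop [IsFiniteMeasure μ] (h : Ker μ ψ b) (hK : Cls ρ k e K)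
    (he : ∀ i j, i ≤ j → e j ≤ e i) : Cls ρ k e (Wop μ ψ b K) := by
  induction k generalizing K e ψ with
  | zero => exact WB.wop h hK
  | succ k ih =>
    obtain ⟨h0, K', h1, h2⟩ := hK
    have he' : ∀ i j, i ≤ j → e (j + 1) ≤ e (i + 1) := fun i j hij => he _ _ (by omega)
    refine ⟨WB.wop h h0, _, fun r hr x hx =>
      hasP_wop h h1 h0 (fun i => (h2 i).wb) hr hx, fun j => Cls.sub ?_ (Cls.sum fun l _ => ?_)⟩
    · exact ih h (h2 j) he'
    · exact (Cls.dscale j).zmul (ih (h.mul_coord l) (h2 l) he') he'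

end

/-- Smooth kernels supported in the closed unit ball. -/
structure Mol (m : Eu n → ℝ) : Prop where
  smooth : ContDiff ℝ ∞ m
  supp : ∀ z, 1 < ‖z‖ → m z = 0

namespace Mol
variable {m : Eu n → ℝ}

lemma hasP (h : Mol m) (z : Eu n) : HasP m (fun i => fderiv ℝ m z (bv i)) z :=
  hasP_of_contDiff h.smooth z

lemma pderiv (h : Mol m) (i : Fin n) : Mol (fun z => fderiv ℝ m z (bv i)) where
  smooth := contDiff_partial h.smooth i
  supp z hz := by
    have : m =ᶠ[𝓝 z] fun _ => 0 := by
      filter_upwards [(isOpen_lt continuous_const continuous_norm).mem_nhds hz] with y hy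
        using h.supp y hy
    rw [this.fderiv_eq]; simp

lemma mul_coord (h : Mol m) (l : Fin n) : Mol (fun z => m z * z l) where
  smooth := h.smooth.mul (EuclideanSpace.proj l : Eu n →L[ℝ] ℝ).contDiff
  supp z hz := by rw [h.supp z hz, zero_mul]

/-- The kernel produced by differentiating in the scale. -/
def euler (m : Eu n → ℝ) : Eu n → ℝ := fun z => n * m z + ∑ l, z l * fderiv ℝ m z (bv l)

lemma euler_mol (h : Mol m) : Mol (euler m) where
  smooth := (contDiff_const.mul h.smooth).add (ContDiff.sum fun l _ =>
    (EuclideanSpace.proj l : Eu n →L[ℝ] ℝ).contDiff.mul (h.pderiv l).smooth)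
  supp z hz := by simp [euler, h.supp z hz, (h.pderiv _).supp z hz]

lemma exists_bound (h : Mol m) : ∃ D, 0 ≤ D ∧ ∀ z, |m z| ≤ D := by
  obtain ⟨C, hC⟩ := (isCompact_closedBall (0 : Eu n) 1).exists_bound_of_continuousOn
    h.smooth.continuous.continuousOn
  refine ⟨max C 0, le_max_right _ _, fun z => ?_⟩
  rcases le_or_gt ‖z‖ 1 with hz | hz
  · exact (hC z (by simpa using hz)).trans (le_max_left _ _)
  · simp [h.supp z hz]

end Mol

/-- Lebesgue measure on the closed unit ball. -/
def ballMeas (n : ℕ) : Measure (Eu n) := volume.restrict (Metric.closedBall 0 1)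

instance : IsFiniteMeasure (ballMeas n) :=
  ⟨by simpa [ballMeas] using (isCompact_closedBall (0 : Eu n) 1).measure_lt_top⟩

/-- Variable scale convolution. -/
def Sop (m : Eu n → ℝ) (K : ℝ → Eu n → ℝ) : ℝ → Eu n → ℝ := Wop (ballMeas n) m (fun z => z) K

lemma ae_ballMeas : ∀ᵐ z ∂(ballMeas n), ‖z‖ ≤ 1 := by
  filter_upwards [ae_restrict_mem (Metric.isClosed_closedBall.measurableSet)] with z hz
  simpa using hz

lemma Mol.ker {m : Eu n → ℝ} (h : Mol m) : Ker (ballMeas n) m (fun z => z) where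
  meas := h.smooth.continuous.measurable
  measb := measurable_id
  bdd := by
    obtain ⟨D, hD, hb⟩ := h.exists_bound
    exact ⟨D, hD, Eventually.of_forall hb⟩
  bddb := ae_ballMeas

section
variable {m : Eu n → ℝ} {ρ r : ℝ} {K : ℝ → Eu n → ℝ} {x : Eu n} {p : ℤ} {k : ℕ} {e : ℕ → ℤ}

lemma sop_eq (h : Mol m) (hr : r ∈ II ρ) (hx : x ∈ UB n) :
    Sop m K r x = ∫ y in UB n, (sc r x)⁻¹ ^ n * m ((sc r x)⁻¹ • (x - y)) * K r y := by
  have hs := sc_pos hr hx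
  set s := sc r x with hsdef
  have h1 : Sop m K r x = ∫ z, m z * (UB n).indicator (K r) (x - s • z) := by
    unfold Sop Wop ballMeas
    rw [← integral_indicator Metric.isClosed_closedBall.measurableSet]
    congr 1
    ext z
    by_cases hz : z ∈ Metric.closedBall (0 : Eu n) 1
    · have hz' : ‖z‖ ≤ 1 := by simpa using hz
      rw [Set.indicator_of_mem hz, Set.indicator_of_mem (shift_mem hr hx hz')]
    · have hz' : 1 < ‖z‖ := by simpa using hz
      rw [Set.indicator_of_notMem hz, h.supp z hz', zero_mul]
  have h2 : ∀ z, m z * (UB n).indicator (K r) (x - s • z) =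
      (fun w => m (s⁻¹ • w) * (UB n).indicator (K r) (x - w)) (s • z) := fun z => by
    simp [smul_smul, inv_mul_cancel₀ hs.ne']
  have h3 : ∀ w, m (s⁻¹ • w) * (UB n).indicator (K r) (x - w) =
      (fun y => m (s⁻¹ • (x - y)) * (UB n).indicator (K r) y) (x - w) := fun w => by simp
  rw [h1]
  rw [integral_congr_ae (Eventually.of_forall h2), Measure.integral_comp_smul volume
      (fun w => m (s⁻¹ • w) * (UB n).indicator (K r) (x - w)) s,
    integral_congr_ae (Eventually.of_forall h3), integral_sub_left_eq_self (fun y => m (s⁻¹ • (x - y)) * (UB n).indicator (K r) y) volume x,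
    ← integral_indicator measurableSet_UB, smul_eq_mul, ← integral_const_mul]
  congr 1
  ext y
  rw [finrank_euclideanSpace_fin, abs_of_pos (by positivity), ← inv_pow]
  by_cases hy : y ∈ UB n
  · simp [Set.indicator_of_mem hy]; ring
  · simp [Set.indicator_of_notMem hy]

lemma hasP_rescaled (h : Mol m) (hr : r ∈ II ρ) (hx : x ∈ UB n) (y : Eu n) :
    HasP (fun x => (sc r x)⁻¹ ^ n * m ((sc r x)⁻¹ • (x - y)))
      (fun j => (sc r x)⁻¹ ^ n * (sc r x)⁻¹ * (fderiv ℝ m ((sc r x)⁻¹ • (x - y)) (bv j)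
        - dsc j r x * Mol.euler m ((sc r x)⁻¹ • (x - y)))) x := by
  have hs := (sc_pos hr hx).ne'
  have h1 : HasP (fun x => (sc r x)⁻¹) (fun j => -(sc r x ^ 2)⁻¹ * dsc j r x) x :=
    HasP.real_comp (hasDerivAt_inv hs) (hasP_sc r x)
  have h2 : HasP (fun x => (sc r x)⁻¹ ^ n) _ x :=
    HasP.real_comp (φ := fun t => t ^ n) (hasDerivAt_pow n _) h1
  have h3 : HasP (fun x => m ((sc r x)⁻¹ • (x - y))) _ x :=
    HasP.comp (Φ := fun x => (sc r x)⁻¹ • (x - y))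
      (fun l => (h1.mul ((HasP.coord l).sub (HasP.const (y l)))).congr_fun
        (Eventually.of_forall fun z => by simp)) (h.hasP _)
  refine (h2.mul h3).congr_partials fun j => ?_
  have hn : ∀ t : ℝ, t ≠ 0 → (n : ℝ) * t⁻¹ ^ (n - 1) = n * t⁻¹ ^ n * t := fun t ht => by
    cases n with
    | zero => simp
    | succ k => rw [Nat.add_sub_cancel, pow_succ]; field_simp
  have hsum : ∑ l, fderiv ℝ m ((sc r x)⁻¹ • (x - y)) (bv l) *
        (-(sc r x ^ 2)⁻¹ * dsc j r x * (x l - y l) + (sc r x)⁻¹ * ((if l = j then 1 else 0) - 0)) =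
      (sc r x)⁻¹ * fderiv ℝ m ((sc r x)⁻¹ • (x - y)) (bv j) - (sc r x)⁻¹ * dsc j r x *
        ∑ l, ((sc r x)⁻¹ • (x - y)) l * fderiv ℝ m ((sc r x)⁻¹ • (x - y)) (bv l) := by
    have h4 : (sc r x)⁻¹ * fderiv ℝ m ((sc r x)⁻¹ • (x - y)) (bv j) = ∑ l, if l = j then
        (sc r x)⁻¹ * fderiv ℝ m ((sc r x)⁻¹ • (x - y)) (bv l) else 0 := by simp
    rw [h4, Finset.mul_sum, ← Finset.sum_sub_distrib]
    refine Finset.sum_congr rfl fun l _ => ?_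
    simp only [PiLp.smul_apply, PiLp.sub_apply, smul_eq_mul]
    split_ifs <;> field_simp <;> ring
  rw [hn _ hs, hsum]
  simp only [Mol.euler]
  field_simp
  ring

lemma hasP_sop (h : Mol m) (hK : MeasU ρ K) (hb : WB ρ p K) (hr : r ∈ II ρ) (hx : x ∈ UB n) :
    HasP (Sop m K r) (fun j => (sc r x)⁻¹ * (Sop (fun z => fderiv ℝ m z (bv j)) K r x
      - dsc j r x * Sop (Mol.euler m) K r x)) x := by
  obtain ⟨C, hC, hCb⟩ := hb
  obtain ⟨D₀, hD₀, hDb₀⟩ := h.exists_bound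
  obtain ⟨D₁, hD₁, hDb₁⟩ := h.euler_mol.exists_bound
  choose D hD hDb using fun i => (h.pderiv i).exists_bound
  have hD' : ∀ i z, |fderiv ℝ m z (bv i)| ≤ ∑ i, D i := fun i z =>
    (hDb i z).trans (Finset.single_le_sum (fun j _ => hD j) (Finset.mem_univ i))
  set M := ∑ i, D i
  have hM : 0 ≤ M := Finset.sum_nonneg fun j _ => hD j
  have hs := sc_pos hr hx
  set σ := 2 * (sc r x)⁻¹
  set T := C * 2 ^ p.natAbs * (2 ^ p.natAbs * sc r x ^ p)
  have hT : 0 ≤ T := by positivity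
  have hnear := sc_near hr hx
  have : IsFiniteMeasure (volume.restrict (UB n)) :=
    ⟨by simpa [UB] using measure_ball_lt_top⟩
  have hmeas : ∀ (c : Eu n → ℝ), Continuous c →
      AEStronglyMeasurable (fun y => c y * K r y) (volume.restrict (UB n)) := fun c hc => by
    refine hc.aestronglyMeasurable.mul ((hK r hr).aestronglyMeasurable.congr ?_)
    filter_upwards [ae_restrict_mem measurableSet_UB] with y hy
    rw [Set.indicator_of_mem hy]
  have hinv : ∀ y, y ∈ UB n ∧ sc r x / 2 ≤ sc r y ∧ sc r y ≤ 2 * sc r x →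
      0 < (sc r y)⁻¹ ∧ (sc r y)⁻¹ ≤ σ := fun y hy => by
    have := sc_pos hr hy.1
    refine ⟨by positivity, ?_⟩
    rw [inv_le_comm₀ this (by positivity)]
    simpa [σ, div_eq_mul_inv, mul_comm] using hy.2.1
  have hKb : ∀ w, w ∈ UB n ∧ sc r x / 2 ≤ sc r w ∧ sc r w ≤ 2 * sc r x → ∀ y ∈ UB n,
      ‖(sc r w)⁻¹ • (w - y)‖ ≤ 1 → |K r y| ≤ T := fun w hw y hy hwy => by
    have hsw := sc_pos hr hw.1
    have := shift_bound (z := (sc r w)⁻¹ • (w - y)) hC (hCb r hr) hr hw.1 hwy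
    rw [smul_smul, mul_inv_cancel₀ hsw.ne', one_smul, sub_sub_cancel] at this
    exact this.trans (mul_le_mul_of_nonneg_left (zpow_close hs hw.2.1 hw.2.2 p) (by positivity))
  set B := σ ^ n * D₀ * T + σ ^ n * σ * (M + D₁) * T
  have key : HasP (fun w => ∫ y in UB n, (sc r w)⁻¹ ^ n * m ((sc r w)⁻¹ • (w - y)) * K r y)
      (fun j => ∫ y in UB n, (sc r x)⁻¹ ^ n * (sc r x)⁻¹ *
        (fderiv ℝ m ((sc r x)⁻¹ • (x - y)) (bv j)
        - dsc j r x * Mol.euler m ((sc r x)⁻¹ • (x - y))) * K r y) x := by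
    refine hasP_integral (c := fun j x y => (sc r x)⁻¹ ^ n * (sc r x)⁻¹ *
        (fderiv ℝ m ((sc r x)⁻¹ • (x - y)) (bv j)
        - dsc j r x * Mol.euler m ((sc r x)⁻¹ • (x - y))) * K r y) (B := B) hnear ?_ ?_ ?_ ?_ ?_
    · intro w hw
      refine hmeas (fun y => (sc r w)⁻¹ ^ n * m ((sc r w)⁻¹ • (w - y))) ?_
      have := h.smooth.continuous
      fun_prop
    · filter_upwards [ae_restrict_mem measurableSet_UB] with y hy
      have hx' := hnear.self_of_nhds
      have hi := hinv x hx'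
      have h3 : 0 ≤ σ ^ n * σ * (M + D₁) * T := by positivity
      rcases le_or_gt ‖(sc r x)⁻¹ • (x - y)‖ 1 with hz | hz
      · have h1 := hKb x hx' y hy hz
        have h2 := hDb₀ ((sc r x)⁻¹ • (x - y))
        rw [abs_mul, abs_mul, abs_of_pos (pow_pos hi.1 n)]
        have : (sc r x)⁻¹ ^ n * |m ((sc r x)⁻¹ • (x - y))| * |K r y| ≤ σ ^ n * D₀ * T := by
          have := hi.1.le
          have := hi.2
          gcongr
        linarith
      · rw [h.supp _ hz]
        simp only [mul_zero, zero_mul, abs_zero]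
        positivity
    · intro j
      refine hmeas (fun y => (sc r x)⁻¹ ^ n * (sc r x)⁻¹ *
        (fderiv ℝ m ((sc r x)⁻¹ • (x - y)) (bv j)
        - dsc j r x * Mol.euler m ((sc r x)⁻¹ • (x - y)))) ?_
      have h1 := (h.pderiv j).smooth.continuous
      have h2 := h.euler_mol.smooth.continuous
      have h3 : Continuous fun y : Eu n => (sc r x)⁻¹ • (x - y) := by fun_prop
      exact continuous_const.mul ((h1.comp h3).sub (continuous_const.mul (h2.comp h3)))
    · filter_upwards [ae_restrict_mem measurableSet_UB] with y hy w hw j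
      have hi := hinv w hw
      have h3 : 0 ≤ σ ^ n * D₀ * T := by positivity
      rcases le_or_gt ‖(sc r w)⁻¹ • (w - y)‖ 1 with hz | hz
      · have h1 := hKb w hw y hy hz
        have h2 : |fderiv ℝ m ((sc r w)⁻¹ • (w - y)) (bv j)
            - dsc j r w * Mol.euler m ((sc r w)⁻¹ • (w - y))| ≤ M + D₁ := by
          refine (abs_sub _ _).trans (add_le_add (hD' j _) ?_)
          rw [abs_mul]
          have h4 := hDb₁ ((sc r w)⁻¹ • (w - y))
          have h5 := abs_dsc_le hr hw.1 j
          calc _ ≤ 1 * D₁ := by gcongr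
            _ = D₁ := one_mul _
        rw [abs_mul, abs_mul, abs_of_pos (mul_pos (pow_pos hi.1 n) hi.1)]
        have : (sc r w)⁻¹ ^ n * (sc r w)⁻¹ * |fderiv ℝ m ((sc r w)⁻¹ • (w - y)) (bv j)
            - dsc j r w * Mol.euler m ((sc r w)⁻¹ • (w - y))| * |K r y|
            ≤ σ ^ n * σ * (M + D₁) * T := by
          have := hi.1.le
          have := hi.2
          gcongr
        linarith
      · rw [(h.pderiv j).supp _ hz, h.euler_mol.supp _ hz]
        simp only [mul_zero, zero_mul, sub_zero, abs_zero]
        positivity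
    · filter_upwards [ae_restrict_mem measurableSet_UB] with y hy w hw
      refine ((hasP_rescaled h hr hw.1 y).mul (HasP.const (K r y))).congr_partials fun j => ?_
      ring
  refine (key.congr_fun ?_).congr_partials fun j => ?_
  · filter_upwards [UB_nhds hx] with w hw using sop_eq h hr hw
  · have hitg : ∀ {m' : Eu n → ℝ}, Mol m' → Integrable
        (fun y => (sc r x)⁻¹ ^ n * m' ((sc r x)⁻¹ • (x - y)) * K r y) (volume.restrict (UB n)) := by
      intro m' hm'
      obtain ⟨D', hD', hDb'⟩ := hm'.exists_bound
      have hx' := hnear.self_of_nhds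
      have hi := hinv x hx'
      refine Integrable.of_bound (hmeas (fun y => (sc r x)⁻¹ ^ n * m' ((sc r x)⁻¹ • (x - y))) ?_)
        ((sc r x)⁻¹ ^ n * D' * T) ?_
      · have := hm'.smooth.continuous
        fun_prop
      · filter_upwards [ae_restrict_mem measurableSet_UB] with y hy
        have h0 := hi.1.le
        rcases le_or_gt ‖(sc r x)⁻¹ • (x - y)‖ 1 with hz | hz
        · have h1 := hKb x hx' y hy hz
          have h2 := hDb' ((sc r x)⁻¹ • (x - y))
          rw [norm_mul, norm_mul, Real.norm_of_nonneg (pow_nonneg h0 n)]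
          simp only [Real.norm_eq_abs]
          gcongr
        · rw [hm'.supp _ hz]
          simp only [mul_zero, zero_mul, norm_zero]
          positivity
    rw [sop_eq (h.pderiv j) hr hx, sop_eq h.euler_mol hr hx, ← integral_const_mul (dsc j r x),
      ← integral_sub (hitg (h.pderiv j)) ((hitg h.euler_mol).const_mul _), ← integral_const_mul]
    refine integral_congr_ae (Eventually.of_forall fun y => ?_)
    beta_reduce
    ring

lemma Cls.sop_of_wb (h : Mol m) (hK : MeasU ρ K) (hb : WB ρ p K) :
    Cls ρ k (fun j => p - j) (Sop m K) := by
  have h0 : ∀ {m : Eu n → ℝ}, Mol m → WB ρ (p - (0 : ℕ)) (Sop m K) := fun h => by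
    simpa [Sop] using WB.wop h.ker hb
  induction k generalizing m with
  | zero => exact h0 h
  | succ k ih =>
    refine ⟨h0 h, _, fun r hr x hx => hasP_sop h hK hb hr hx, fun j => ?_⟩
    refine Cls.scaleInv.mul (e' := fun j => p - j) ((ih (h.pderiv j)).sub
      ((Cls.dscale j).zmul (ih h.euler_mol) ?_)) ?_
    · intro i j hij; omega
    · intro i j hij; push_cast; omega

lemma Cls.sop {q : ℕ} {e' : ℕ → ℤ} (h : Mol m) (hK : MeasU ρ K) (hc : Cls ρ q e K)
    (h1 : ∀ j ≤ q, e' j ≤ e j) (h2 : ∀ j, e' (q + j) ≤ e q - j) (h3 : ∀ i j, i ≤ j → e' j ≤ e' i) :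
    Cls ρ (q + k) e' (Sop m K) := by
  induction q generalizing m K e e' with
  | zero =>
    rw [zero_add]
    exact (Cls.sop_of_wb h hK hc).mono fun j _ => by simpa using h2 j
  | succ q ih =>
    have hw := (WB.wop h.ker hc.wb).mono (h1 0 (by omega))
    obtain ⟨c0, K', c1, c2⟩ := hc
    rw [show q + 1 + k = (q + k) + 1 by ring]
    have h3' : ∀ i j, i ≤ j → e' (j + 1) ≤ e' (i + 1) := fun i j hij => h3 _ _ (by omega)
    have key : ∀ {m : Eu n → ℝ} (_ : Mol m) (j : Fin n),
        Cls ρ (q + k) (fun j => e' (j + 1)) (Sop m (K' j)) := fun {m} h j =>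
      ih h (measU_of_hasP c1 j) (c2 j) (fun j hj => h1 _ (by omega))
        (fun j => by have := h2 j; rwa [show q + 1 + j = q + j + 1 by ring] at this) h3'
    refine ⟨hw, _, fun r hr x hx =>
      hasP_wop h.ker c1 c0 (fun i => (c2 i).wb) hr hx, fun j => Cls.sub ?_ (Cls.sum fun l _ => ?_)⟩
    · exact key h j
    · exact (Cls.dscale j).zmul (key (h.mul_coord l) l) h3'

end

/-- The standard mollifier. -/
def bump (n : ℕ) : ContDiffBump (0 : Eu n) := ⟨1 / 2, 1, by norm_num, by norm_num⟩

/-- The standard mollifier, with integral one. -/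
def eta (n : ℕ) : Eu n → ℝ := (bump n).normed volume

lemma eta_mol : Mol (eta n) where
  smooth := (bump n).contDiff_normed
  supp z hz := by
    have h := (bump n).support_normed_eq (μ := volume)
    by_contra h0
    have : z ∈ Function.support ((bump n).normed volume) := h0
    rw [h] at this
    have h1 : ‖z‖ < 1 := by simpa [bump] using this
    linarith

lemma integral_ballMeas {m : Eu n → ℝ} (h : Mol m) : ∫ z, m z ∂(ballMeas n) = ∫ z, m z := by
  unfold ballMeas
  refine setIntegral_eq_integral_of_forall_compl_eq_zero fun z hz => h.supp z ?_
  simpa using hz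

lemma integral_eta : ∫ z, eta n z ∂(ballMeas n) = 1 := by
  rw [integral_ballMeas eta_mol]
  exact (bump n).integral_normed

lemma eta_neg (z : Eu n) : eta n (-z) = eta n z := (bump n).normed_neg z

lemma integral_eta_mul (l : Fin n) : ∫ z, eta n z * z l ∂(ballMeas n) = 0 := by
  rw [integral_ballMeas (eta_mol.mul_coord l)]
  have h := integral_neg_eq_self (fun z : Eu n => eta n z * z l) volume
  simp only [eta_neg, PiLp.neg_apply, mul_neg, integral_neg] at h
  linarith

/-- Exponents of functions whose derivatives lose one power of the scale after a while. -/
def mx (c d : ℤ) : ℕ → ℤ := fun j => min c (d - j)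

lemma mx_anti (c d : ℤ) (i j : ℕ) (h : i ≤ j) : mx c d j ≤ mx c d i := by
  simp only [mx]; omega

section
variable {m : Eu n → ℝ} {ρ r : ℝ} {K : ℝ → Eu n → ℝ} {x : Eu n}

lemma convex_UB : Convex ℝ (UB n) := convex_ball _ _

lemma exists_common_bound {a : Fin n → ℝ → Eu n → ℝ} {p : ℤ} (h : ∀ i, WB ρ p (a i)) :
    ∃ C, 0 ≤ C ∧ ∀ i, ∀ r ∈ II ρ, ∀ x ∈ UB n, |a i r x| ≤ C * sc r x ^ p := by
  choose C hC h using h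
  refine ⟨∑ i, C i, Finset.sum_nonneg fun j _ => hC j, fun i r hr x hx => (h i r hr x hx).trans ?_⟩
  exact mul_le_mul_of_nonneg_right (Finset.single_le_sum (fun j _ => hC j) (Finset.mem_univ i))
    (zpow_pos (sc_pos hr hx) _).le

lemma lipschitz_of_hasP {a : Eu n → ℝ} {a' : Fin n → Eu n → ℝ} {C : ℝ} {s : Set (Eu n)}
    (hs : Convex ℝ s)
    (h : ∀ x ∈ s, HasP a (fun i => a' i x) x) (hb : ∀ i, ∀ x ∈ s, |a' i x| ≤ C)
    {x y : Eu n} (hx : x ∈ s) (hy : y ∈ s) : |a y - a x| ≤ n * C * ‖y - x‖ :=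
  hs.norm_image_sub_le_of_norm_hasFDerivWithin_le
    (fun z hz => HasFDerivAt.hasFDerivWithinAt (h z hz))
    (fun z hz => norm_gr_le_of_abs_le fun i => hb i z hz) hx hy

lemma Cls.lipschitz {e : ℕ → ℤ} (h : Cls ρ 1 e K) (he : 0 ≤ e 1) :
    ∃ L, 0 ≤ L ∧ ∀ r ∈ II ρ, ∀ x ∈ UB n, ∀ y ∈ UB n, |K r y - K r x| ≤ L * ‖y - x‖ := by
  obtain ⟨h0, K', h1, h2⟩ := h
  obtain ⟨C, hC, hb⟩ := exists_common_bound fun i => WB.mono (h2 i) he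
  exact ⟨n * C, by positivity, fun r hr x hx y hy =>
    lipschitz_of_hasP convex_UB (h1 r hr) (fun i z hz => by simpa using hb i r hr z hz) hx hy⟩

lemma Mol.integrable (h : Mol m) : Integrable m (ballMeas n) := by
  obtain ⟨D, hD, hb⟩ := h.exists_bound
  exact Integrable.of_bound h.smooth.continuous.aestronglyMeasurable D (Eventually.of_forall hb)

lemma WB.sop_sub (h : Mol m) (hK : Cls ρ 1 zeroExp K) :
    WB ρ 1 (fun r x => Sop m K r x - (∫ z, m z ∂(ballMeas n)) * K r x) := by
  obtain ⟨L, hL, hLip⟩ := hK.lipschitz le_rfl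
  obtain ⟨D, hD, hb⟩ := h.exists_bound
  refine ⟨D * L * (ballMeas n).real univ, by positivity, fun r hr x hx => ?_⟩
  have hi := h.ker.integrable hK.measU hK.wb hr hx
  beta_reduce
  rw [← integral_mul_const]
  unfold Sop Wop
  rw [← integral_sub hi (h.integrable.mul_const _)]
  have : ∀ᵐ z ∂(ballMeas n), ‖m z * K r (x - sc r x • z) - m z * K r x‖ ≤ D * (L * sc r x) := by
    filter_upwards [ae_ballMeas] with z hz
    rw [← mul_sub, norm_mul]
    refine mul_le_mul (hb z) ((hLip r hr x hx _ (shift_mem hr hx hz)).trans ?_) (norm_nonneg _) hD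
    refine mul_le_mul_of_nonneg_left ?_ hL
    have hs := sc_pos hr hx
    rw [sub_sub_cancel_left, norm_neg, norm_smul, Real.norm_of_nonneg hs.le]
    nlinarith
  refine (norm_integral_le_of_norm_le_const this).trans (le_of_eq ?_)
  rw [zpow_one]; ring

lemma Cls.sop_sub (hK : Cls ρ 2 zeroExp K) :
    Cls ρ 2 (mx 1 2) (fun r x => Sop (eta n) K r x - K r x) := by
  have hw : ∀ {K : ℝ → Eu n → ℝ}, Cls ρ 1 zeroExp K →
      WB ρ 1 (fun r x => Sop (eta n) K r x - K r x) := fun hK => by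
    simpa [integral_eta] using WB.sop_sub eta_mol hK
  have hw' : ∀ {K : ℝ → Eu n → ℝ} (l : Fin n), Cls ρ 1 zeroExp K →
      WB ρ 1 (Sop (fun z => eta n z * z l) K) := fun l hK => by
    simpa [integral_eta_mul] using WB.sop_sub (eta_mol.mul_coord l) hK
  have hK1 := hK.le (l := 1) (by norm_num)
  obtain ⟨c0, K', c1, c2⟩ := hK
  refine ⟨(hw hK1).mono (by simp [mx]), _, fun r hr x hx =>
    (hasP_wop eta_mol.ker c1 c0 (fun i => (c2 i).wb) hr hx).sub (c1 r hr x hx), fun j => ?_⟩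
  have h1 : Cls ρ 1 (mx 1 1) (fun r x => Sop (eta n) (K' j) r x - K' j r x) :=
    ((Cls.wop eta_mol.ker (c2 j) (fun _ _ _ => le_rfl)).sub (c2 j)).head (hw (c2 j))
      (by simp [mx]) (fun j h h' => by simp [mx]; omega)
  have h2 : ∀ l, Cls ρ 1 (mx 1 1) (fun r x => dsc j r x * Sop (fun z => eta n z * z l) (K' l) r x) :=
    fun l => (Cls.dscale j).zmul (((Cls.wop (eta_mol.mul_coord l).ker (c2 l)
      (fun _ _ _ => le_rfl))).head (hw' l (c2 l)) (by simp [mx])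
      (fun j h h' => by simp [mx]; omega)) (mx_anti _ _)
  have he : (fun j => mx 1 2 (j + 1)) = mx 1 1 := by ext j; simp [mx]; omega
  rw [he]
  refine (h1.sub (Cls.sum (t := Finset.univ) fun l _ => h2 l)).congr fun r _ x _ => ?_
  simp only [Sop]
  ring

end

lemma HasP.symm_of_eventually {a : Eu n → ℝ} {a' : Fin n → Eu n → ℝ} {a'' : Fin n → Fin n → ℝ}
    {x : Eu n} (h : ∀ᶠ y in 𝓝 x, HasP a (fun i => a' i y) y) (h' : ∀ i, HasP (a' i) (a'' i) x)
    (i j : Fin n) : a'' i j = a'' j i := by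
  have h2 : HasFDerivAt (fun y => gr (fun i => a' i y))
      (∑ i, (gr (a'' i)).smulRight (EuclideanSpace.proj i : Eu n →L[ℝ] ℝ)) x := by
    refine HasFDerivAt.fun_sum (A := fun i y => a' i y • (EuclideanSpace.proj i : Eu n →L[ℝ] ℝ))
      fun i _ => ?_
    exact HasFDerivAt.smul_const (h' i) (EuclideanSpace.proj i : Eu n →L[ℝ] ℝ)
  have := second_derivative_symmetric_of_eventually h h2 (bv j) (bv i)
  simpa [gr_bv, bv_apply] using this

lemma HasP.prod {ι : Type*} [DecidableEq ι] {t : Finset ι} {a : ι → Eu n → ℝ} {c : ι → Fin n → ℝ}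
    {x : Eu n} (h : ∀ i ∈ t, HasP (a i) (c i) x) :
    HasP (fun y => ∏ i ∈ t, a i y) (fun l => ∑ i ∈ t, (∏ j ∈ t.erase i, a j x) * c i l) x := by
  have := HasFDerivAt.finsetProd (u := t) (g := a) (g' := fun i => gr (c i)) (x := x) h
  exact (HasP.of_hasFDerivAt this).congr_partials fun i => by simp [gr_bv]

lemma HasP.det {A : Fin n → Fin n → Eu n → ℝ} {A' : Fin n → Fin n → Fin n → ℝ} {x : Eu n}
    (h : ∀ i j, HasP (A i j) (A' i j) x) :
    HasP (fun y => (Matrix.of fun i j => A i j y).det)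
      (fun l => ∑ i, ((Matrix.of fun i j => A i j x).updateRow i (fun j => A' i j l)).det) x := by
  have key : HasP (fun y => ∑ σ : Equiv.Perm (Fin n), (Equiv.Perm.sign σ : ℝ) * ∏ i, A i (σ i) y) _ x :=
    HasP.sum fun σ _ => (HasP.prod fun i _ => h i (σ i)).const_mul _
  refine (key.congr_fun (Eventually.of_forall fun y => ?_)).congr_partials fun l => ?_
  · rw [← Matrix.det_transpose, Matrix.det_apply']
    rfl
  · have h1 : ∀ i, ((Matrix.of fun i j => A i j x).updateRow i (fun j => A' i j l)).det =
        ∑ σ : Equiv.Perm (Fin n), (Equiv.Perm.sign σ : ℝ) *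
          ((∏ j ∈ Finset.univ.erase i, A j (σ j) x) * A' i (σ i) l) := fun i => by
      rw [← Matrix.det_transpose, Matrix.det_apply']
      refine Finset.sum_congr rfl fun σ _ => ?_
      congr 1
      rw [← Finset.mul_prod_erase _ _ (Finset.mem_univ i), mul_comm]
      congr 1
      · refine Finset.prod_congr rfl fun j hj => ?_
        simp [Matrix.transpose_apply, Matrix.updateRow_ne (Finset.ne_of_mem_erase hj)]
      · simp [Matrix.transpose_apply]
    simp_rw [h1, Finset.mul_sum]
    rw [Finset.sum_comm]

lemma det_updateRow_eq_sum (M : Matrix (Fin n) (Fin n) ℝ) (k : Fin n) (c : Fin n → ℝ) :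
    (M.updateRow k c).det = ∑ j, c j * (M.updateRow k (Pi.single j 1)).det := by
  simp_rw [← Matrix.cramer_transpose_apply]
  conv_lhs => rw [show c = ∑ j, c j • (Pi.single j 1 : Fin n → ℝ) by
    ext i; simp [Finset.sum_apply, Pi.single_apply]]
  simp [map_sum, map_smul, Finset.sum_apply]

lemma sum_det_updateRow_updateRow (M : Matrix (Fin n) (Fin n) ℝ) {i k : Fin n} (hik : i ≠ k)
    {S : Fin n → Fin n → ℝ} (hS : ∀ j l, S j l = S l j) :
    ∑ j, ((M.updateRow k (Pi.single j 1)).updateRow i (fun l => S l j)).det = 0 := by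
  set T : Fin n → Fin n → ℝ := fun j l =>
    ((M.updateRow k (Pi.single j 1)).updateRow i (Pi.single l 1)).det
  have hT : ∀ j l, T j l = - T l j := fun j l => by
    have h1 := Matrix.det_permute (Equiv.swap i k)
      ((M.updateRow k (Pi.single j 1)).updateRow i (Pi.single l 1))
    rw [Equiv.Perm.sign_swap hik] at h1
    simp only [T]
    have h2 : ((M.updateRow k (Pi.single j 1)).updateRow i (Pi.single l 1)).submatrix
        (Equiv.swap i k) id = (M.updateRow k (Pi.single l 1)).updateRow i (Pi.single j 1) := by
      ext a b
      rw [Matrix.submatrix_apply, id]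
      by_cases ha : a = i
      · rw [ha, Equiv.swap_apply_left, Matrix.updateRow_ne hik.symm, Matrix.updateRow_self,
          Matrix.updateRow_self]
      · by_cases hk : a = k
        · rw [hk, Equiv.swap_apply_right, Matrix.updateRow_self, Matrix.updateRow_ne hik.symm,
            Matrix.updateRow_self]
        · rw [Equiv.swap_apply_of_ne_of_ne ha hk, Matrix.updateRow_ne ha, Matrix.updateRow_ne hk,
            Matrix.updateRow_ne ha, Matrix.updateRow_ne hk]
    rw [h2, Units.val_neg, Units.val_one, Int.cast_neg, Int.cast_one] at h1
    linarith
  rw [Finset.sum_congr rfl fun j _ => det_updateRow_eq_sum (M.updateRow k (Pi.single j 1)) i _]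
  change ∑ j, ∑ l, S l j * T j l = 0
  have : ∑ j, ∑ l, S l j * T j l = - ∑ j, ∑ l, S l j * T j l := by
    conv_lhs => rw [Finset.sum_comm]
    rw [← Finset.sum_neg_distrib]
    refine Finset.sum_congr rfl fun j _ => ?_
    rw [← Finset.sum_neg_distrib]
    refine Finset.sum_congr rfl fun l _ => ?_
    rw [hS, hT]; ring
  linarith

/-- The matrix with rows from `P` before `k` and from `Q` afterwards. -/
def mixM (P Q : Fin n → Fin n → ℝ) (k : ℕ) : Matrix (Fin n) (Fin n) ℝ :=
  Matrix.of fun i j => if (i : ℕ) < k then P i j else Q i j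

lemma mixM_zero (P Q : Fin n → Fin n → ℝ) : mixM P Q 0 = Matrix.of Q := by
  ext i j; simp [mixM]

lemma mixM_last (P Q : Fin n → Fin n → ℝ) : mixM P Q n = Matrix.of P := by
  ext i j; simp [mixM]

/-- A vector field whose divergence is a difference of two Jacobians. -/
def nullField (d : Fin n → ℝ) (P Q : Fin n → Fin n → ℝ) (j : Fin n) : ℝ :=
  ∑ k, d k * ((mixM P Q k).updateRow k (Pi.single j 1)).det

lemma telescope_mixM (P Q : Fin n → Fin n → ℝ) :
    ∑ k : Fin n, ∑ j, (P k j - Q k j) * ((mixM P Q k).updateRow k (Pi.single j 1)).det =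
      (Matrix.of P).det - (Matrix.of Q).det := by
  have h1 : ∀ k : Fin n, ∑ j, (P k j - Q k j) * ((mixM P Q k).updateRow k (Pi.single j 1)).det =
      (mixM P Q (k + 1)).det - (mixM P Q k).det := fun k => by
    simp_rw [sub_mul]
    rw [Finset.sum_sub_distrib, ← det_updateRow_eq_sum, ← det_updateRow_eq_sum]
    congr 2
    · ext i j
      by_cases hi : i = k
      · subst hi; simp [mixM]
      · have : (i : ℕ) ≠ k := fun h => hi (Fin.ext h)
        rw [Matrix.updateRow_ne hi]
        simp only [mixM, Matrix.of_apply]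
        have h3 : ((i : ℕ) < k) ↔ ((i : ℕ) < k + 1) := by omega
        simp [h3]
    · ext i j
      by_cases hi : i = k
      · subst hi; simp [mixM]
      · rw [Matrix.updateRow_ne hi]
  simp_rw [h1]
  rw [Fin.sum_univ_eq_sum_range (fun k => (mixM P Q (k + 1)).det - (mixM P Q k).det) n,
    Finset.sum_range_sub (fun k => (mixM P Q k).det), mixM_zero, mixM_last]

lemma hasP_nullField {d : Fin n → Eu n → ℝ} {P Q : Fin n → Fin n → Eu n → ℝ}
    {PP QQ : Fin n → Fin n → Fin n → ℝ} {x : Eu n}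
    (hP : ∀ i j, HasP (P i j) (PP i j) x) (hQ : ∀ i j, HasP (Q i j) (QQ i j) x)
    (hPs : ∀ i j l, PP i j l = PP i l j) (hQs : ∀ i j l, QQ i j l = QQ i l j)
    (hd : ∀ k, HasP (d k) (fun j => P k j x - Q k j x) x) :
    ∃ c : Fin n → Fin n → ℝ,
      (∀ j, HasP (fun y => nullField (fun k => d k y) (fun i l => P i l y) (fun i l => Q i l y) j)
        (c j) x) ∧
      ∑ j, c j j = (Matrix.of fun i j => P i j x).det - (Matrix.of fun i j => Q i j x).det := by
  set A : Fin n → Fin n → Fin n → Fin n → Eu n → ℝ := fun k j a b y =>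
    (mixM (fun i l => P i l y) (fun i l => Q i l y) k).updateRow k (Pi.single j 1) a b
  set MM : Fin n → Fin n → Fin n → Fin n → ℝ := fun k a b l =>
    if a = k then 0 else if (a : ℕ) < k then PP a b l else QQ a b l
  have hA : ∀ k j a b, HasP (A k j a b) (MM k a b) x := fun k j a b => by
    by_cases ha : a = k
    · subst ha
      simp only [A, MM, Matrix.updateRow_self, if_true]
      exact HasP.const _
    · simp only [A, MM, Matrix.updateRow_ne ha, if_neg ha, mixM, Matrix.of_apply]
      split_ifs
      · exact hP a b
      · exact hQ a b
  have hdet : ∀ k j : Fin n, HasP (fun y => ((mixM (fun i l => P i l y) (fun i l => Q i l y) k).updateRow k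
      (Pi.single j 1)).det) _ x := fun k j => HasP.det (hA k j)
  refine ⟨_, fun j => HasP.sum fun k _ => (hd k).mul (hdet k j), ?_⟩
  rw [Finset.sum_comm]
  simp_rw [Finset.sum_add_distrib]
  rw [telescope_mixM]
  conv_rhs => rw [← add_zero (Matrix.det _ - _)]
  congr 1
  refine Finset.sum_eq_zero fun k _ => ?_
  rw [← Finset.mul_sum, Finset.sum_comm]
  refine mul_eq_zero_of_right _ (Finset.sum_eq_zero fun i _ => ?_)
  by_cases hik : i = k
  · subst hik
    refine Finset.sum_eq_zero fun j _ => Matrix.det_eq_zero_of_row_eq_zero i fun l => ?_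
    simp [MM]
  · refine Eq.trans (Finset.sum_congr rfl fun j _ => ?_) (sum_det_updateRow_updateRow
      (mixM (fun i l => P i l x) (fun i l => Q i l x) k) hik (S := fun b l => MM k i b l) ?_)
    · rfl
    · intro j l
      simp only [MM, if_neg hik]
      split_ifs
      · exact hPs _ _ _
      · exact hQs _ _ _

section
variable {ρ : ℝ} {k : ℕ} {e : ℕ → ℤ}

lemma Cls.prod {ι : Type*} {t : Finset ι} {a : ι → ℝ → Eu n → ℝ}
    (he : ∀ i j, e (i + j) ≤ e i + e j) (he0 : ∀ j, e j ≤ 0)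
    (h : ∀ l ∈ t, Cls ρ k e (a l)) : Cls ρ k e (fun r x => ∏ l ∈ t, a l r x) := by
  classical
  induction t using Finset.induction_on with
  | empty => simpa using Cls.const 1 fun j _ => he0 j
  | insert l t hl ih =>
    simp only [Finset.prod_insert hl]
    exact (h l (Finset.mem_insert_self _ _)).mul
      (ih fun m hm => h m (Finset.mem_insert_of_mem hm)) fun i j _ => he i j

lemma Cls.det {A : Fin n → Fin n → ℝ → Eu n → ℝ}
    (he : ∀ i j, e (i + j) ≤ e i + e j) (he0 : ∀ j, e j ≤ 0)
    (h : ∀ i j, Cls ρ k e (A i j)) :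
    Cls ρ k e (fun r x => (Matrix.of fun i j => A i j r x).det) := by
  simp_rw [Matrix.det_apply']
  exact Cls.sum fun σ _ => (Cls.prod he he0 fun i _ => h (σ i) i).const_mul _

lemma Cls.nullField {d : Fin n → ℝ → Eu n → ℝ} {P Q : Fin n → Fin n → ℝ → Eu n → ℝ}
    (hd : ∀ i, Cls ρ k e (d i)) (hP : ∀ i j, Cls ρ k zeroExp (P i j))
    (hQ : ∀ i j, Cls ρ k zeroExp (Q i j)) (he : ∀ i j, i ≤ j → e j ≤ e i) (j : Fin n) :
    Cls ρ k e (fun r x => nullField (fun i => d i r x) (fun i l => P i l r x)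
      (fun i l => Q i l r x) j) := by
  refine Cls.sum fun m _ => ((Cls.zmul (Cls.det (A := fun a b r x =>
    (mixM (fun i l => P i l r x) (fun i l => Q i l r x) m).updateRow m (Pi.single j 1) a b)
    (fun _ _ => by simp) (fun _ => le_rfl) fun a b => ?_) (hd m) he)).congr fun r _ x _ => ?_
  · by_cases ha : a = m
    · subst ha
      simp only [Matrix.updateRow_self]
      exact Cls.const _ fun _ _ => le_rfl
    · simp only [Matrix.updateRow_ne ha, mixM, Matrix.of_apply]
      split_ifs
      · exact hP a b
      · exact hQ a b
  · rw [mul_comm]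
    rfl

end

lemma measU_comp {Ω : Type*} [MeasurableSpace Ω] {ρ r : ℝ} {a : ℝ → Eu n → ℝ} {Φ : Ω → Eu n}
    {μ : Measure Ω}
    (ha : MeasU ρ a) (hr : r ∈ II ρ) (hΦ : Measurable Φ) (h : ∀ᵐ w ∂μ, Φ w ∈ UB n) :
    AEStronglyMeasurable (fun w => a r (Φ w)) μ := by
  refine ((ha r hr).comp hΦ).aestronglyMeasurable.congr ?_
  filter_upwards [h] with w hw
  rw [Function.comp, Set.indicator_of_mem hw]

/-- Weighted radial average. -/
def radAvg (p : ℕ) (a : ℝ → Eu n → ℝ) : ℝ → Eu n → ℝ :=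
  fun r x => ∫ t in Icc (0 : ℝ) 1, t ^ p * a r (t • x)

lemma smul_mem_UB {t : ℝ} (ht : t ∈ Icc (0 : ℝ) 1) {x : Eu n} (hx : x ∈ UB n) : t • x ∈ UB n := by
  rw [mem_UB] at *
  rw [norm_smul, Real.norm_of_nonneg ht.1]
  nlinarith [norm_nonneg x, ht.1, ht.2]

section
variable {ρ r : ℝ} {a : ℝ → Eu n → ℝ} {a' : Fin n → ℝ → Eu n → ℝ} {x : Eu n} {p : ℕ}

lemma ae_Icc : ∀ᵐ t ∂(volume.restrict (Icc (0 : ℝ) 1)), t ∈ Icc (0 : ℝ) 1 :=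
  ae_restrict_mem measurableSet_Icc

lemma measurable_smul_const (x : Eu n) : Measurable fun t : ℝ => t • x :=
  (continuous_id.smul continuous_const).measurable

lemma abs_pow_mul_le {C : ℝ} (hb : ∀ x ∈ UB n, |a r x| ≤ C) (hx : x ∈ UB n) {t : ℝ}
    (ht : t ∈ Icc (0 : ℝ) 1) : |t ^ p * a r (t • x)| ≤ C := by
  rw [abs_mul, abs_of_nonneg (pow_nonneg ht.1 p)]
  have h1 := pow_le_one₀ ht.1 ht.2 (n := p)
  have h2 := hb _ (smul_mem_UB ht hx)
  nlinarith [abs_nonneg (a r (t • x)), pow_nonneg ht.1 p]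

lemma radAvg_integrable (ha : MeasU ρ a) (hb : WB ρ 0 a) (hr : r ∈ II ρ) (hx : x ∈ UB n) :
    Integrable (fun t => t ^ p * a r (t • x)) (volume.restrict (Icc (0 : ℝ) 1)) := by
  obtain ⟨C, hC, hb⟩ := hb
  refine Integrable.of_bound ((continuous_pow p).aestronglyMeasurable.mul
    (measU_comp ha hr (measurable_smul_const x) ?_)) C ?_
  · filter_upwards [ae_Icc] with t ht using smul_mem_UB ht hx
  · filter_upwards [ae_Icc] with t ht
    exact abs_pow_mul_le (fun x hx => by simpa using hb r hr x hx) hx ht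

lemma WB.radAvg (hb : WB ρ 0 a) : WB ρ 0 (radAvg p a) := by
  obtain ⟨C, hC, hb⟩ := hb
  refine ⟨C, hC, fun r hr x hx => ?_⟩
  have : ∀ᵐ t ∂(volume.restrict (Icc (0 : ℝ) 1)), ‖t ^ p * a r (t • x)‖ ≤ C := by
    filter_upwards [ae_Icc] with t ht
    exact abs_pow_mul_le (fun x hx => by simpa using hb r hr x hx) hx ht
  simpa [Measure.real, Pasting.radAvg] using norm_integral_le_of_norm_le_const this

lemma hasP_radAvg (ha : ∀ r ∈ II ρ, ∀ x ∈ UB n, HasP (a r) (fun i => a' i r x) x)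
    (hb : WB ρ 0 a) (hb' : ∀ i, WB ρ 0 (a' i)) (hr : r ∈ II ρ) (hx : x ∈ UB n) :
    HasP (radAvg p a r) (fun i => radAvg (p + 1) (a' i) r x) x := by
  have hm : MeasU ρ a := fun r hr => measurable_indicator_of_continuousOn
    fun x hx => (ha r hr x hx).continuousAt.continuousWithinAt
  have hm' := measU_of_hasP ha
  obtain ⟨C, hC, hb⟩ := hb
  obtain ⟨C', hC', hb'⟩ := exists_common_bound hb'
  refine hasP_integral (c := fun i x t => t ^ (p + 1) * a' i r (t • x)) (B := C + C')
    (UB_nhds hx) (fun y hy => ?_) ?_ (fun i => ?_) ?_ ?_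
  · refine (continuous_pow p).aestronglyMeasurable.mul
      (measU_comp hm hr (measurable_smul_const y) ?_)
    filter_upwards [ae_Icc] with t ht using smul_mem_UB ht hy
  · filter_upwards [ae_Icc] with t ht
    exact (abs_pow_mul_le (fun x hx => by simpa using hb r hr x hx) hx ht).trans (by linarith)
  · refine (continuous_pow (p + 1)).aestronglyMeasurable.mul
      (measU_comp (hm' i) hr (measurable_smul_const x) ?_)
    filter_upwards [ae_Icc] with t ht using smul_mem_UB ht hx
  · filter_upwards [ae_Icc] with t ht y hy i
    exact (abs_pow_mul_le (fun x hx => by simpa using hb' i r hr x hx) hy ht).trans (by linarith)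
  · filter_upwards [ae_Icc] with t ht y hy
    refine ((HasP.comp (Φ := fun y => t • y) (fun l => ((HasP.coord l).const_mul t))
      (ha r hr _ (smul_mem_UB ht hy))).const_mul (t ^ p)).congr_partials fun i => ?_
    simp [pow_succ]; ring

lemma Cls.radAvg (h : Cls ρ 1 zeroExp a) : Cls ρ 1 zeroExp (radAvg p a) := by
  obtain ⟨h0, a', h1, h2⟩ := h
  exact ⟨h0.radAvg, _, fun r hr x hx => hasP_radAvg h1 h0 h2 hr hx, fun i => WB.radAvg (h2 i)⟩

lemma radAvg_euler (ha : ∀ r ∈ II ρ, ∀ x ∈ UB n, HasP (a r) (fun i => a' i r x) x)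
    (hb : WB ρ 0 a) (hb' : ∀ i, WB ρ 0 (a' i)) (hr : r ∈ II ρ) (hx : x ∈ UB n) :
    (p + 1) * radAvg p a r x + ∑ j, x j * radAvg (p + 1) (a' j) r x = a r x := by
  have hm : MeasU ρ a := fun r hr => measurable_indicator_of_continuousOn
    fun x hx => (ha r hr x hx).continuousAt.continuousWithinAt
  have hm' := measU_of_hasP ha
  have hi := radAvg_integrable (p := p) hm hb hr hx
  have hi' := fun j => radAvg_integrable (p := p + 1) (hm' j) (hb' j) hr hx
  unfold radAvg
  simp_rw [← integral_const_mul]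
  rw [← integral_finsetSum _ fun j _ => (hi' j).const_mul _,
    ← integral_add (hi.const_mul _) (integrable_finsetSum _ fun j _ => (hi' j).const_mul _)]
  have hI := (hi.const_mul ((p : ℝ) + 1)).add
    (integrable_finsetSum Finset.univ fun j _ => (hi' j).const_mul (x j))
  rw [integral_Icc_eq_integral_Ioc, ← intervalIntegral.integral_of_le zero_le_one]
  have hd : ∀ t ∈ uIcc (0 : ℝ) 1, HasDerivAt (fun t : ℝ => t ^ (p + 1) * a r (t • x))
      (((p : ℝ) + 1) * (t ^ p * a r (t • x)) + ∑ j, x j * (t ^ (p + 1) * a' j r (t • x))) t := by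
    intro t ht
    rw [uIcc_of_le zero_le_one] at ht
    have h1 : HasDerivAt (fun t : ℝ => t • x) x t := by
      simpa using (hasDerivAt_id t).smul_const x
    have h0 : HasFDerivAt (a r) (gr fun i => a' i r (t • x)) (t • x) :=
      ha r hr _ (smul_mem_UB ht hx)
    have h2 : HasDerivAt (fun t : ℝ => a r (t • x)) ((gr fun i => a' i r (t • x)) x) t :=
      h0.comp_hasDerivAt t h1
    refine ((hasDerivAt_pow (p + 1) t).mul h2).congr_deriv ?_
    rw [gr_apply, Finset.mul_sum]
    push_cast
    congr 1
    · ring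
    · exact Finset.sum_congr rfl fun j _ => by ring
  rw [intervalIntegral.integral_eq_sub_of_hasDerivAt hd]
  · simp
  · rw [intervalIntegrable_iff_integrableOn_Icc_of_le zero_le_one]
    exact hI.congr (Eventually.of_forall fun t => by simp)

end

/-- Tangential potential of a solenoidal vector field. -/
def tang (N : Fin n → ℝ → Eu n → ℝ) (j : Fin n) : ℝ → Eu n → ℝ := fun r x =>
  (∑ l, x l * x l) * radAvg (n - 2) (N j) r x - x j * ∑ l, x l * radAvg (n - 2) (N l) r x

section
variable {ρ r : ℝ} {N : Fin n → ℝ → Eu n → ℝ} {x : Eu n}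

lemma Cls.tang (h : ∀ j, Cls ρ 1 zeroExp (N j)) (j : Fin n) : Cls ρ 1 zeroExp (tang N j) :=
  ((Cls.sum fun l _ => (Cls.coord l).zmul (Cls.coord l) fun _ _ _ => le_rfl).zmul
    (Cls.radAvg (h j)) fun _ _ _ => le_rfl).sub
    ((Cls.coord j).zmul (Cls.sum fun l _ => (Cls.coord l).zmul (Cls.radAvg (h l))
      fun _ _ _ => le_rfl) fun _ _ _ => le_rfl)

lemma sum_coord_mul_tang (r : ℝ) (x : Eu n) : ∑ j, x j * tang N j r x = 0 := by
  simp only [tang, mul_sub, Finset.sum_sub_distrib]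
  rw [sub_eq_zero]
  simp_rw [← mul_assoc, ← Finset.sum_mul, mul_comm (x _) (∑ l, x l * x l)]
  simp_rw [mul_assoc, ← Finset.mul_sum]

lemma div_tang (hn : 2 ≤ n) {N' : Fin n → Fin n → ℝ → Eu n → ℝ}
    (h1 : ∀ j, ∀ r ∈ II ρ, ∀ x ∈ UB n, HasP (N j r) (fun i => N' j i r x) x)
    (h0 : ∀ j, WB ρ 0 (N j)) (h2 : ∀ j i, WB ρ 0 (N' j i)) (hr : r ∈ II ρ) (hx : x ∈ UB n)
    (hdiv : ∀ t ∈ Icc (0 : ℝ) 1, ∑ j, N' j j r (t • x) = 0) :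
    ∃ c : Fin n → Fin n → ℝ, (∀ j, HasP (tang N j r) (c j) x) ∧
      ∑ j, c j j = - ∑ l, x l * N l r x := by
  have hq : HasP (fun y : Eu n => ∑ l, y l * y l) _ x :=
    HasP.sum fun l _ => (HasP.coord l).mul (HasP.coord l)
  have hT := fun l => hasP_radAvg (p := n - 2) (h1 l) (h0 l) (h2 l) hr hx
  refine ⟨_, fun j => (hq.mul (hT j)).sub ((HasP.coord j).mul
    (HasP.sum (t := Finset.univ) fun l _ => (HasP.coord l).mul (hT l))), ?_⟩
  have hz : ∑ j, radAvg (n - 2 + 1) (N' j j) r x = 0 := by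
    unfold radAvg
    rw [← integral_finsetSum _ fun j _ =>
      radAvg_integrable (measU_of_hasP (h1 j) j) (h2 j j) hr hx]
    refine integral_eq_zero_of_ae ?_
    filter_upwards [ae_Icc] with t ht
    rw [← Finset.mul_sum, hdiv t ht, mul_zero, Pi.zero_apply]
  have hE := fun l => radAvg_euler (p := n - 2) (h1 l) (h0 l) (h2 l) hr hx
  have hcast : ((n - 2 : ℕ) : ℝ) = n - 2 := by push_cast [Nat.cast_sub hn]; ring
  have hE' : ∑ l, x l * N l r x = ∑ l, x l * ((((n - 2 : ℕ) : ℝ) + 1) * radAvg (n - 2) (N l) r x)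
      + ∑ l, x l * ∑ j, x j * radAvg (n - 2 + 1) (N' l j) r x := by
    rw [← Finset.sum_add_distrib]
    exact Finset.sum_congr rfl fun l _ => by rw [← mul_add, hE l]
  rw [hE', hcast]
  simp only [Finset.sum_sub_distrib, Finset.sum_add_distrib, mul_add, add_mul, Finset.sum_mul,
    Finset.mul_sum, ite_mul, mul_ite, one_mul, zero_mul, mul_one, mul_zero,  Finset.sum_ite_eq', Finset.mem_univ, if_true]
  have e1 : ∑ j, ∑ l, x l * x l * radAvg (n - 2 + 1) (N' j j) r x = 0 := by
    simp_rw [← Finset.sum_mul]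
    rw [← Finset.mul_sum, hz, mul_zero]
  have e2 : ∑ j : Fin n, ∑ l, x l * radAvg (n - 2) (N l) r x =
      n * ∑ l, x l * radAvg (n - 2) (N l) r x := by simp
  have e3 : ∑ j, ∑ l, x j * (x l * radAvg (n - 2 + 1) (N' l j) r x) =
      ∑ l, ∑ j, x l * (x j * radAvg (n - 2 + 1) (N' l j) r x) := by
    rw [Finset.sum_comm]
    exact Finset.sum_congr rfl fun l _ => Finset.sum_congr rfl fun j _ => by ring
  have e4 : ∑ l, x l * ((n - 2 : ℝ) * radAvg (n - 2) (N l) r x) =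
      (n - 2) * ∑ l, x l * radAvg (n - 2) (N l) r x := by
    rw [Finset.mul_sum]
    exact Finset.sum_congr rfl fun l _ => by ring
  rw [e1, e2, e3, e4]
  ring

end

lemma Cls.div_radius {ρ : ℝ} {k : ℕ} {e : ℕ → ℤ} {a : ℝ → Eu n → ℝ} (h : Cls ρ k e a)
    (he : ∀ j ≤ k, 1 ≤ e j) : Cls ρ k zeroExp (fun r x => r⁻¹ * a r x) := by
  have h0 : ∀ {a : ℝ → Eu n → ℝ}, WB ρ 1 a → WB ρ 0 (fun r x => r⁻¹ * a r x) := by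
    rintro a ⟨C, hC, h⟩
    refine ⟨C, hC, fun r hr x hx => ?_⟩
    have h1 := h r hr x hx
    have h2 := sc_le_r hr hx
    have h3 := hr.1
    beta_reduce
    rw [zpow_one] at h1
    rw [abs_mul, abs_of_pos (inv_pos.2 h3), inv_mul_le_iff₀ h3, zpow_zero]
    nlinarith
  induction k generalizing a e with
  | zero => exact h0 (WB.mono h (he 0 le_rfl))
  | succ k ih =>
    obtain ⟨g0, a', g1, g2⟩ := h
    exact ⟨h0 (g0.mono (he 0 (by omega))), fun i r x => r⁻¹ * a' i r x,
      fun r hr x hx => (g1 r hr x hx).const_mul _, fun i => ih (g2 i) fun j hj => he _ (by omega)⟩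

/-- A smooth step between two levels. -/
def step (p q t : ℝ) : ℝ := Real.smoothTransition ((t - p) / (q - p))

section
variable {p q t : ℝ}

lemma contDiff_step : ContDiff ℝ ∞ (step p q) :=
  Real.smoothTransition.contDiff.comp ((contDiff_id.sub contDiff_const).div_const _)

lemma contDiff_deriv_step : ContDiff ℝ ∞ (deriv (step p q)) :=
  (contDiff_infty_iff_deriv.1 contDiff_step).2

lemma step_of_le (h : p < q) (ht : t ≤ p) : step p q t = 0 :=
  Real.smoothTransition.zero_of_nonpos (div_nonpos_of_nonpos_of_nonneg (by linarith) (by linarith))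

lemma step_of_ge (h : p < q) (ht : q ≤ t) : step p q t = 1 :=
  Real.smoothTransition.one_of_one_le ((one_le_div (by linarith)).2 (by linarith))

lemma deriv_step_of_lt (h : p < q) (ht : t < p) : deriv (step p q) t = 0 := by
  have : step p q =ᶠ[𝓝 t] fun _ => 0 := by
    filter_upwards [Iio_mem_nhds ht] with s hs using step_of_le h (le_of_lt hs)
  rw [this.deriv_eq]; simp

lemma deriv_step_of_gt (h : p < q) (ht : q < t) : deriv (step p q) t = 0 := by
  have : step p q =ᶠ[𝓝 t] fun _ => 1 := by
    filter_upwards [Ioi_mem_nhds ht] with s hs using step_of_ge h (le_of_lt hs)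
  rw [this.deriv_eq]; simp

lemma hasP_step_df (x : Eu n) :
    HasP (fun y => step p q (df y)) (fun i => deriv (step p q) (df x) * (-2 * x i)) x :=
  HasP.real_comp (contDiff_step.differentiable (by simp) _).hasDerivAt (hasP_df x)

lemma hasP_deriv_step_df (x : Eu n) :
    HasP (fun y => deriv (step p q) (df y))
      (fun i => deriv (deriv (step p q)) (df x) * (-2 * x i)) x :=
  HasP.real_comp (contDiff_deriv_step.differentiable (by simp) _).hasDerivAt (hasP_df x)

end

/-- Kronecker symbol. -/
abbrev kd (i j : Fin n) : ℝ := if i = j then 1 else 0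

/-- The outcome of regularizing a volume preserving displacement near the boundary and removing it
near the center: the displacement is corrected by `d`, and the density error `h` is the divergence
of `N`. -/
structure Smoothed (ρ : ℝ) (u' : Fin n → Fin n → ℝ → Eu n → ℝ) (u d : Fin n → ℝ → Eu n → ℝ)
    (h : ℝ → Eu n → ℝ) (N : Fin n → ℝ → Eu n → ℝ) : Prop where
  d_cls : ∀ i, Cls ρ 2 (mx 1 2) (d i)
  d_inner : ∀ i, ∀ r ∈ II ρ, ∀ x, ‖x‖ < 3 / 4 → d i r x = - (r * u i r x)
  h_cls : Cls ρ 3 (mx 1 1) h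
  h_eq : ∀ d' : Fin n → Fin n → ℝ → Eu n → ℝ,
    (∀ i, ∀ r ∈ II ρ, ∀ x ∈ UB n, HasP (d i r) (fun j => d' i j r x) x) →
    ∀ r ∈ II ρ, ∀ x ∈ UB n,
      (Matrix.of fun i j => kd i j + r * u' i j r x + d' i j r x).det = 1 + h r x
  h_inner : ∀ r ∈ II ρ, ∀ x, ‖x‖ < 3 / 4 → h r x = 0
  N_cls : ∀ j, Cls ρ 1 (mx 1 2) (N j)
  N_inner : ∀ j, ∀ r ∈ II ρ, ∀ x, ‖x‖ < 3 / 5 → N j r x = 0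
  N_div : ∀ N' : Fin n → Fin n → ℝ → Eu n → ℝ,
    (∀ j, ∀ r ∈ II ρ, ∀ x ∈ UB n, HasP (N j r) (fun i => N' j i r x) x) →
    ∀ r ∈ II ρ, ∀ x ∈ UB n, ∑ j, N' j j r x = h r x

section
variable {ρ : ℝ}

/-- A vector field with divergence `h`, where `h` vanishes well inside the ball, can be modified
so as to vanish near the center. -/
lemma exists_field_vanishing (hn : 2 ≤ n) {N : Fin n → ℝ → Eu n → ℝ} {h : ℝ → Eu n → ℝ}
    {N' : Fin n → Fin n → ℝ → Eu n → ℝ} (hN : ∀ j, Cls ρ 1 (mx 1 2) (N j))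
    (hN' : ∀ j, ∀ r ∈ II ρ, ∀ x ∈ UB n, HasP (N j r) (fun i => N' j i r x) x)
    (hdiv : ∀ r ∈ II ρ, ∀ x ∈ UB n, ∑ j, N' j j r x = h r x)
    (hh : ∀ r ∈ II ρ, ∀ x, ‖x‖ < 3 / 4 → h r x = 0) :
    ∃ M : Fin n → ℝ → Eu n → ℝ, (∀ j, Cls ρ 1 (mx 1 2) (M j)) ∧
      (∀ j, ∀ r ∈ II ρ, ∀ x, ‖x‖ < 3 / 5 → M j r x = 0) ∧
      ∀ r ∈ II ρ, ∀ x ∈ UB n, ∃ c : Fin n → Fin n → ℝ, (∀ j, HasP (M j r) (c j) x) ∧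
        ∑ j, c j j = h r x := by
  set p : ℝ := 51 / 100
  set q : ℝ := 64 / 100
  have hpq : p < q := by norm_num [p, q]
  set R : Fin n → ℝ → Eu n → ℝ := fun j r x => r⁻¹ * N j r x
  have hR : ∀ j, Cls ρ 1 zeroExp (R j) := fun j => (hN j).div_radius fun i hi => by
    simp only [mx]; omega
  refine ⟨fun j r x => (1 - step p q (df x)) * N j r x +
    tang R j r x * (r * (2 * deriv (step p q) (df x))), fun j => Cls.add ?_ ?_, ?_, ?_⟩
  · exact (Cls.smooth (contDiff_const.sub (contDiff_step.comp contDiff_df)) fun _ _ => le_rfl).zmul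
      (hN j) (mx_anti 1 2)
  · refine (Cls.tang hR j).zmul (Cls.smooth_inner (g := fun x => 2 * deriv (step p q) (df x))
      (contDiff_const.mul (contDiff_deriv_step.comp contDiff_df)) (fun x hx => ?_) ?_) (mx_anti 1 2)
    · rw [deriv_step_of_lt hpq, mul_zero]
      rw [df_eq]; simp only [p]; nlinarith
    · intro j hj; simp only [mx]; omega
  · intro j r hr x hx
    have h1 : q < df x := by rw [df_eq]; simp only [q]; nlinarith [norm_nonneg x]
    beta_reduce
    rw [step_of_ge hpq h1.le, deriv_step_of_gt hpq h1]
    ring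
  · intro r hr x hx
    have hr0 := hr.1
    rcases lt_or_ge ‖x‖ (3 / 4) with hx1 | hx1
    · obtain ⟨c, hc1, hc2⟩ := div_tang (N := R) (N' := fun j i r x => r⁻¹ * N' j i r x) hn
        (fun j r hr x hx => (hN' j r hr x hx).const_mul _) (fun j => (hR j).wb)
        (fun j i => (hR j).partials (fun r hr x hx => (hN' j r hr x hx).const_mul _) i) hr hx
        (fun t ht => by
          rw [← Finset.mul_sum, hdiv r hr _ (smul_mem_UB ht hx), hh r hr, mul_zero]
          rw [norm_smul, Real.norm_of_nonneg ht.1]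
          nlinarith [norm_nonneg x, ht.1, ht.2])
      refine ⟨_, fun j => (((HasP.const 1).sub (hasP_step_df x)).mul (hN' j r hr x hx)).add
        ((hc1 j).mul (((hasP_deriv_step_df x).const_mul 2).const_mul r)), ?_⟩
      have hdx := (hdiv r hr x hx).trans (hh r hr x hx1)
      have e1 : ∑ j, x j * tang R j r x = 0 := sum_coord_mul_tang r x
      have e2 : ∑ l, x l * R l r x = r⁻¹ * ∑ l, x l * N l r x := by
        rw [Finset.mul_sum]; exact Finset.sum_congr rfl fun l _ => by simp only [R]; ring
      rw [e2] at hc2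
      rw [hh r hr x hx1]
      set D := deriv (step p q) (df x)
      set D' := deriv (deriv (step p q)) (df x)
      have e3 : ∀ j, (0 - D * (-2 * x j)) * N j r x + (1 - step p q (df x)) * N' j j r x +
          (c j j * (r * (2 * D)) + tang R j r x * (r * (2 * (D' * (-2 * x j))))) =
          2 * D * (x j * N j r x) + (1 - step p q (df x)) * N' j j r x + (r * (2 * D)) * c j j
          + (-4 * r * D') * (x j * tang R j r x) := fun j => by ring
      simp only [e3, Finset.sum_add_distrib, ← Finset.mul_sum]
      rw [hdx, hc2, e1]
      field_simp
      ring
    · have h1 : df x < p := by rw [df_eq]; simp only [p]; nlinarith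
      have h2 : ∀ᶠ y in 𝓝 x, df y < p := contDiff_df.continuous.continuousAt.eventually_lt_const h1
      refine ⟨fun j i => N' j i r x, fun j => (hN' j r hr x hx).congr_fun ?_, hdiv r hr x hx⟩
      filter_upwards [h2] with y hy
      rw [step_of_le hpq hy.le, deriv_step_of_lt hpq hy]
      ring

lemma exists_smoothed (hn : 2 ≤ n) {u : Fin n → ℝ → Eu n → ℝ}
    {u' : Fin n → Fin n → ℝ → Eu n → ℝ} (hu : ∀ i, Cls ρ 2 zeroExp (u i))
    (hu' : ∀ i, ∀ r ∈ II ρ, ∀ x ∈ UB n, HasP (u i r) (fun j => u' i j r x) x)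
    (hdet : ∀ r ∈ II ρ, ∀ x ∈ UB n, (Matrix.of fun i j => kd i j + r * u' i j r x).det = 1) :
    ∃ d h N, Smoothed ρ u' u d h N := by
  set χ : Eu n → ℝ := fun x => 1 - step (19 / 100) (36 / 100) (df x)
  have hχ : ContDiff ℝ ∞ χ := contDiff_const.sub (contDiff_step.comp contDiff_df)
  set K : Fin n → ℝ → Eu n → ℝ := fun i r x => χ x * (r * u i r x)
  have hK : ∀ i, Cls ρ 2 zeroExp (K i) := fun i =>
    (Cls.smooth hχ fun _ _ => le_rfl).zmul (Cls.radius.zmul (hu i) fun _ _ _ => le_rfl)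
      fun _ _ _ => le_rfl
  set U : Fin n → ℝ → Eu n → ℝ := fun i => Sop (eta n) (K i)
  have hU : ∀ i, Cls ρ 4 (mx 0 2) (U i) := fun i =>
    Cls.sop (q := 2) (k := 2) eta_mol (hK i).measU (hK i) (fun j _ => by simp [mx])
      (fun j => by simp [mx]) (mx_anti 0 2)
  have hU0 : ∀ i, ∀ r ∈ II ρ, ∀ x, ‖x‖ < 3 / 4 → U i r x = 0 := by
    intro i r hr x hx
    refine integral_eq_zero_of_ae ?_
    filter_upwards [ae_ballMeas] with z hz
    have hs : |sc r x| ≤ 1 / 100 := by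
      have := sc_le_r hr (x := x) (by rw [mem_UB]; linarith)
      rw [abs_of_pos (sc_pos hr (by rw [mem_UB]; linarith))]; linarith [hr.2.1]
    have h1 : ‖x - sc r x • z‖ ≤ 8 / 10 := by
      refine (norm_sub_le _ _).trans ?_
      rw [norm_smul, Real.norm_eq_abs]
      nlinarith [norm_nonneg z, abs_nonneg (sc r x)]
    have h2 : 36 / 100 ≤ df (x - sc r x • z) := by
      rw [df_eq]; nlinarith [norm_nonneg (x - sc r x • z)]
    simp only [K, χ, step_of_ge (by norm_num : (19 / 100 : ℝ) < 36 / 100) h2]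
    simp
  choose _ U' hU1 hU2 using hU
  have hU2c := hU2
  choose _ U'' hU3 hU4 using hU2
  have hu2 := fun i j => (hu i).partials (hu' i) j
  have hu2c := hu2
  choose _ u'' hu3 hu4 using hu2
  have hUs : ∀ i j l, ∀ r ∈ II ρ, ∀ x ∈ UB n, U'' i j l r x = U'' i l j r x :=
    fun i j l r hr x hx => HasP.symm_of_eventually (a := U i r) (a' := fun j => U' i j r)
      (a'' := fun j l => U'' i j l r x)
      (by filter_upwards [UB_nhds hx] with y hy using hU1 i r hr y hy)
      (fun j => hU3 i j r hr x hx) j l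
  have hus : ∀ i j l, ∀ r ∈ II ρ, ∀ x ∈ UB n, u'' i j l r x = u'' i l j r x :=
    fun i j l r hr x hx => HasP.symm_of_eventually (a := u i r) (a' := fun j => u' i j r)
      (a'' := fun j l => u'' i j l r x)
      (by filter_upwards [UB_nhds hx] with y hy using hu' i r hr y hy)
      (fun j => hu3 i j r hr x hx) j l
  set d : Fin n → ℝ → Eu n → ℝ := fun i r x => U i r x - r * u i r x
  have hd : ∀ i, Cls ρ 2 (mx 1 2) (d i) := fun i => by
    refine ((hK i).sop_sub.add ((hu i).zmul (Cls.smooth_inner (g := fun x => χ x - 1)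
      (hχ.sub contDiff_const) (fun x hx => ?_) ?_) (mx_anti 1 2))).congr fun r hr x hx => ?_
    · have : df x ≤ 19 / 100 := by rw [df_eq]; nlinarith
      simp [χ, step_of_le (by norm_num : (19 / 100 : ℝ) < 36 / 100) this]
    · intro j hj; simp only [mx]; omega
    · simp only [d, K, U]; ring
  have hd' : ∀ i, ∀ r ∈ II ρ, ∀ x ∈ UB n,
      HasP (d i r) (fun j => U' i j r x - r * u' i j r x) x := fun i r hr x hx =>
    (hU1 i r hr x hx).sub ((hu' i r hr x hx).const_mul r)
  set P : Fin n → Fin n → ℝ → Eu n → ℝ := fun i j r x => kd i j + U' i j r x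
  set Q : Fin n → Fin n → ℝ → Eu n → ℝ := fun i j r x => kd i j + r * u' i j r x
  have hP3 : ∀ i j, Cls ρ 3 (mx 0 1) (P i j) := fun i j =>
    (Cls.const _ fun j _ => by simp [mx]).add ((hU2c i j).mono fun j hj => by
      simp only [mx]; push_cast; omega)
  have hP1 : ∀ i j, Cls ρ 1 zeroExp (P i j) := fun i j =>
    ((hP3 i j).le (l := 1) (by norm_num)).mono fun j hj => by simp only [mx, zeroExp]; omega
  have hQ1 : ∀ i j, Cls ρ 1 zeroExp (Q i j) := fun i j =>
    (Cls.const _ fun j _ => le_rfl).add (Cls.radius.zmul (hu2c i j) fun _ _ _ => le_rfl)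
  set N : Fin n → ℝ → Eu n → ℝ := fun j r x =>
    nullField (fun i => d i r x) (fun i l => P i l r x) (fun i l => Q i l r x) j
  have hN : ∀ j, Cls ρ 1 (mx 1 2) (N j) := fun j =>
    Cls.nullField (fun i => (hd i).le (by norm_num)) hP1 hQ1 (mx_anti 1 2) j
  set h : ℝ → Eu n → ℝ := fun r x => (Matrix.of fun i j => P i j r x).det - 1
  have hNc := hN
  choose _ N' hN1 hN2 using hN
  have hdiv : ∀ r ∈ II ρ, ∀ x ∈ UB n, ∑ j, N' j j r x = h r x := by
    intro r hr x hx
    obtain ⟨c, hc1, hc2⟩ := hasP_nullField (d := fun i => d i r) (P := fun i j => P i j r)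
      (Q := fun i j => Q i j r) (PP := fun i j l => U'' i j l r x)
      (QQ := fun i j l => r * u'' i j l r x) (x := x)
      (fun i j => ((HasP.const _).add (hU3 i j r hr x hx)).congr_partials fun l => by simp)
      (fun i j => ((HasP.const _).add ((hu3 i j r hr x hx).const_mul r)).congr_partials
        fun l => by simp)
      (fun i j l => hUs i j l r hr x hx) (fun i j l => by rw [hus i j l r hr x hx])
      (fun k => (hd' k r hr x hx).congr_partials fun j => by simp [P, Q])
    rw [Finset.sum_congr rfl fun j _ => (hN1 j r hr x hx).unique (hc1 j) j, hc2]
    simp only [h, Q]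
    rw [hdet r hr x hx]
  have hh : Cls ρ 3 (mx 1 1) h := by
    have h1 : Cls ρ 3 (mx 0 1) h := (Cls.det (fun i j => by simp only [mx]; push_cast; omega)
      (fun j => by simp [mx]) hP3).sub (Cls.const 1 fun j _ => by simp [mx])
    have h2 : WB ρ 1 h := (Cls.wb (k := 0) (e := fun _ => 1) (Cls.sum (t := Finset.univ)
      (k := 0) (e := fun _ => 1) fun j _ => (hN2 j j).mono fun i hi => by
        obtain rfl : i = 0 := Nat.le_zero.1 hi
        simp [mx])).congr fun r hr x hx => (hdiv r hr x hx).symm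
    exact h1.head h2 (by simp [mx]) fun j _ hj => by simp only [mx]; omega
  have hU'0 : ∀ i j, ∀ r ∈ II ρ, ∀ x, ‖x‖ < 3 / 4 → U' i j r x = 0 := fun i j r hr x hx =>
    (hU1 i r hr x (by rw [mem_UB]; linarith)).unique ((HasP.const 0).congr_fun (by
      filter_upwards [(isOpen_lt continuous_norm continuous_const).mem_nhds hx] with y hy
        using hU0 i r hr y hy)) j
  have hh0 : ∀ r ∈ II ρ, ∀ x, ‖x‖ < 3 / 4 → h r x = 0 := by
    intro r hr x hx
    have : (Matrix.of fun i j => P i j r x) = 1 := by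
      ext i j; simp [P, hU'0 i j r hr x hx, Matrix.one_apply]
    simp [h, this]
  obtain ⟨M, hM, hM0, hM'⟩ := exists_field_vanishing hn hNc hN1 hdiv hh0
  refine ⟨d, h, M, ⟨hd, fun i r hr x hx => by simp [d, hU0 i r hr x hx], hh, ?_, hh0, hM, hM0, ?_⟩⟩
  · intro d' hd1 r hr x hx
    have : ∀ i j, d' i j r x = U' i j r x - r * u' i j r x := fun i j =>
      (hd1 i r hr x hx).unique (hd' i r hr x hx) j
    simp only [this, h, P, add_add_sub_cancel]
    ring
  · intro N' hN' r hr x hx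
    obtain ⟨c, hc1, hc2⟩ := hM' r hr x hx
    rw [← hc2]
    exact Finset.sum_congr rfl fun j _ => (hN' j r hr x hx).unique (hc1 j) j

end

/-- Second partial derivatives of the scale. -/
def ddsc (j i : Fin n) (r : ℝ) (x : Eu n) : ℝ := r * (-4 * (-2 * x i * x j + df x * kd j i))

lemma hasP_dsc (j : Fin n) (r : ℝ) (x : Eu n) : HasP (dsc j r) (fun i => ddsc j i r x) x := by
  have := ((((hasP_df x).const_mul (-4)).mul (HasP.coord j)).const_mul r)
  refine (this.congr_fun (Eventually.of_forall fun y => ?_)).congr_partials fun i => ?_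
  · simp only [dsc]
  · simp only [ddsc, kd]; ring

lemma ddsc_symm (j i : Fin n) (r : ℝ) (x : Eu n) : ddsc j i r x = ddsc i j r x := by
  simp only [ddsc, kd, eq_comm (a := j)]; ring

lemma sum_pull_identity {a H : Fin n → Fin n → ℝ} {D : Fin n → ℝ} {b : Fin n → Fin n → Fin n → ℝ}
    {g : Fin n → Fin n → Fin n → Fin n → ℝ} {N : Fin n → Fin n → ℝ} (hH : ∀ i j, H i j = H j i) :
    ∑ i, ((a i i - ∑ l, D i * b l i l)
      - ∑ j, (H j i * N j i + D j * (b j i i - ∑ l, D i * g j l i l))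
      + ∑ j, (H j i * N i j + D j * (b i j i - ∑ l, D i * g i l j l))) =
    ∑ i, a i i - ∑ j, D j * ∑ i, b j i i := by
  simp only [Finset.sum_add_distrib, Finset.sum_sub_distrib, mul_sub, Finset.mul_sum]
  have e1 : ∑ i, ∑ j, H j i * N i j = ∑ i, ∑ j, H j i * N j i := by
    rw [Finset.sum_comm]
    exact Finset.sum_congr rfl fun i _ => Finset.sum_congr rfl fun j _ => by rw [hH]
  have e2 : ∑ i, ∑ j, D j * b i j i = ∑ i, ∑ l, D i * b l i l := Finset.sum_comm
  have e3 : ∑ i, ∑ j, ∑ l, D j * (D i * g i l j l) = ∑ i, ∑ j, ∑ l, D j * (D i * g j l i l) := by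
    rw [Finset.sum_comm]
    exact Finset.sum_congr rfl fun i _ => Finset.sum_congr rfl fun j _ =>
      Finset.sum_congr rfl fun l _ => by ring
  have e4 : ∑ i, ∑ j, D j * b j i i = ∑ j, ∑ i, D j * b j i i := Finset.sum_comm
  rw [e1, e2, e3, e4]
  ring

/-- Averaged pullback of a vector field under the maps `x ↦ x - sc x • z`. -/
def pull (N : Fin n → ℝ → Eu n → ℝ) (i : Fin n) : ℝ → Eu n → ℝ := fun r x =>
  Sop (eta n) (N i) r x - ∑ j, dsc j r x * Sop (fun z => eta n z * z j) (N i) r x +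
    ∑ j, dsc j r x * Sop (fun z => eta n z * z i) (N j) r x

section
variable {ρ r : ℝ} {N : Fin n → ℝ → Eu n → ℝ} {h : ℝ → Eu n → ℝ} {x : Eu n}

lemma Cls.pull (hN : ∀ j, Cls ρ 1 (mx 1 2) (N j)) (i : Fin n) : Cls ρ 3 (mx 1 2) (pull N i) := by
  have key : ∀ {m : Eu n → ℝ} (j : Fin n), Mol m → Cls ρ 3 (mx 1 2) (Sop m (N j)) := fun j hm =>
    Cls.sop (q := 1) (k := 2) hm (hN j).measU (hN j) (fun _ _ => le_rfl)
      (fun j => by simp only [mx]; push_cast; omega) (mx_anti 1 2)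
  exact ((key i eta_mol).sub (Cls.sum fun j _ => (Cls.dscale j).zmul
    (key i (eta_mol.mul_coord j)) (mx_anti 1 2))).add (Cls.sum fun j _ => (Cls.dscale j).zmul
    (key j (eta_mol.mul_coord i)) (mx_anti 1 2))

lemma sop_sum {m : Eu n → ℝ} (hm : Mol m) {K : Fin n → ℝ → Eu n → ℝ} {p : ℤ}
    (hK : ∀ j, MeasU ρ (K j)) (hb : ∀ j, WB ρ p (K j)) (hr : r ∈ II ρ) (hx : x ∈ UB n)
    (hs : ∀ x ∈ UB n, ∑ j, K j r x = h r x) :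
    ∑ j, Sop m (K j) r x = Sop m h r x := by
  unfold Sop Wop
  rw [← integral_finsetSum _ fun j _ => hm.ker.integrable (hK j) (hb j) hr hx]
  refine integral_congr_ae ?_
  filter_upwards [ae_ballMeas] with z hz
  rw [← Finset.mul_sum, hs _ (shift_mem hr hx hz)]

lemma div_pull {N' : Fin n → Fin n → ℝ → Eu n → ℝ} (hN : ∀ j, Cls ρ 1 (mx 1 2) (N j))
    (hN' : ∀ j, ∀ r ∈ II ρ, ∀ x ∈ UB n, HasP (N j r) (fun i => N' j i r x) x)
    (hdiv : ∀ r ∈ II ρ, ∀ x ∈ UB n, ∑ j, N' j j r x = h r x) (hr : r ∈ II ρ) (hx : x ∈ UB n) :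
    ∃ c : Fin n → Fin n → ℝ, (∀ i, HasP (pull N i r) (c i) x) ∧
      ∑ i, c i i = Sop (eta n) h r x - ∑ j, dsc j r x * Sop (fun z => eta n z * z j) h r x := by
  have key : ∀ {m : Eu n → ℝ} (j : Fin n), Mol m → HasP (Sop m (N j) r) (fun i =>
      Sop m (N' j i) r x - ∑ l, dsc i r x * Sop (fun z => m z * z l) (N' j l) r x) x :=
    fun j hm => hasP_wop hm.ker (hN' j) (hN j).wb (fun i => (hN j).partials (hN' j) i) hr hx
  have hsum : ∀ {m : Eu n → ℝ}, Mol m → ∑ j, Sop m (N' j j) r x = Sop m h r x := fun hm =>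
    sop_sum (p := mx 1 2 1) hm (fun j => measU_of_hasP (hN' j) j)
      (fun j => (hN j).partials (hN' j) j) hr hx (hdiv r hr)
  refine ⟨_, fun i => ((key i eta_mol).sub (HasP.sum (t := Finset.univ) fun j _ =>
    (hasP_dsc j r x).mul (key i (eta_mol.mul_coord j)))).add (HasP.sum (t := Finset.univ)
    fun j _ => (hasP_dsc j r x).mul (key j (eta_mol.mul_coord i))), ?_⟩
  rw [← hsum eta_mol]
  simp_rw [← hsum (eta_mol.mul_coord _)]
  exact sum_pull_identity (a := fun i j => Sop (eta n) (N' i j) r x)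
    (H := fun j i => ddsc j i r x) (D := fun i => dsc i r x)
    (b := fun m i j => Sop (fun z => eta n z * z m) (N' i j) r x)
    (g := fun m l i j => Sop (fun z => eta n z * z m * z l) (N' i j) r x)
    (N := fun j i => Sop (fun z => eta n z * z j) (N i) r x)
    (fun i j => ddsc_symm i j r x)

/-- Product of the normalized ball and the unit interval. -/
def cylMeas (n : ℕ) : Measure (Eu n × ℝ) := (ballMeas n).prod (volume.restrict (Icc 0 1))

instance : IsFiniteMeasure (cylMeas n) := by unfold cylMeas; infer_instance

lemma ae_cylMeas : ∀ᵐ w ∂(cylMeas n), ‖w.1‖ ≤ 1 ∧ w.2 ∈ Icc (0 : ℝ) 1 := by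
  have h1 : ∀ᵐ w ∂(cylMeas n), ‖w.1‖ ≤ 1 := Measure.quasiMeasurePreserving_fst.ae ae_ballMeas
  have h2 : ∀ᵐ w ∂(cylMeas n), w.2 ∈ Icc (0 : ℝ) 1 :=
    Measure.quasiMeasurePreserving_snd.ae ae_Icc
  filter_upwards [h1, h2] with w a b using ⟨a, b⟩

lemma norm_cyl_le {z : Eu n} {t : ℝ} (hz : ‖z‖ ≤ 1) (ht : t ∈ Icc (0 : ℝ) 1) : ‖t • z‖ ≤ 1 := by
  rw [norm_smul, Real.norm_of_nonneg ht.1]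
  nlinarith [ht.1, ht.2, norm_nonneg z]

lemma ker_cyl {m : Eu n → ℝ} (hm : Mol m) :
    Ker (cylMeas n) (fun w => m w.1) (fun w => w.2 • w.1) where
  meas := hm.smooth.continuous.measurable.comp measurable_fst
  measb := measurable_snd.smul measurable_fst
  bdd := by
    obtain ⟨D, hD, hb⟩ := hm.exists_bound
    exact ⟨D, hD, Eventually.of_forall fun w => hb w.1⟩
  bddb := by filter_upwards [ae_cylMeas] with w hw using norm_cyl_le hw.1 hw.2

/-- Transport potential between a function and its averages. -/
def cylOp (h : ℝ → Eu n → ℝ) (i : Fin n) : ℝ → Eu n → ℝ :=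
  Wop (cylMeas n) (fun w => eta n w.1 * w.1 i) (fun w => w.2 • w.1) h

lemma integral_line {h' : Fin n → ℝ → Eu n → ℝ}
    (hh : ∀ r ∈ II ρ, ∀ x ∈ UB n, HasP (h r) (fun i => h' i r x) x)
    (hc : ∀ i, ContinuousOn (h' i r) (UB n))
    (hr : r ∈ II ρ) (hx : x ∈ UB n) {z : Eu n} (hz : ‖z‖ ≤ 1) {D : ℝ} :
    ∫ t in Icc (0 : ℝ) 1, (D * h r (x - sc r x • t • z) +
      (1 - t * D) * (sc r x * ∑ l, z l * h' l r (x - sc r x • t • z))) =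
      h r x - (1 - D) * h r (x - sc r x • z) := by
  have hd : ∀ t ∈ uIcc (0 : ℝ) 1, HasDerivAt
      (fun t : ℝ => - ((1 - t * D) * h r (x - sc r x • t • z)))
      (D * h r (x - sc r x • t • z) +
        (1 - t * D) * (sc r x * ∑ l, z l * h' l r (x - sc r x • t • z))) t := by
    intro t ht
    rw [uIcc_of_le zero_le_one] at ht
    have h1 : HasDerivAt (fun t : ℝ => x - sc r x • t • z) (- (sc r x • z)) t := by
      simpa using (((hasDerivAt_id t).smul_const z).const_smul (sc r x)).const_sub x
    have h0 : HasFDerivAt (h r) (gr fun i => h' i r (x - sc r x • t • z)) (x - sc r x • t • z) :=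
      hh r hr _ (shift_mem hr hx (norm_cyl_le hz ht))
    have h2 : HasDerivAt (fun t : ℝ => h r (x - sc r x • t • z))
        ((gr fun i => h' i r (x - sc r x • t • z)) (- (sc r x • z))) t := h0.comp_hasDerivAt t h1
    have h3 : HasDerivAt (fun t : ℝ => 1 - t * D) (- D) t := by
      simpa using ((hasDerivAt_id t).mul_const D).const_sub 1
    refine (h3.mul h2).neg.congr_deriv ?_
    rw [map_neg, map_smul, gr_apply, smul_eq_mul]
    simp_rw [mul_comm (z _)]
    ring
  rw [integral_Icc_eq_integral_Ioc, ← intervalIntegral.integral_of_le zero_le_one,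
    intervalIntegral.integral_eq_sub_of_hasDerivAt hd]
  · simp; ring
  · refine ContinuousOn.intervalIntegrable ?_
    have hl : Continuous fun t : ℝ => x - sc r x • t • z := by fun_prop
    have hm : MapsTo (fun t : ℝ => x - sc r x • t • z) (uIcc 0 1) (UB n) := fun t ht => by
      rw [uIcc_of_le zero_le_one] at ht
      exact shift_mem hr hx (norm_cyl_le hz ht)
    have hh0 : ContinuousOn (h r) (UB n) := fun y hy =>
      (hh r hr y hy).continuousAt.continuousWithinAt
    have h1 := hh0.comp hl.continuousOn hm
    have h2 := fun i => (hc i).comp hl.continuousOn hm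
    exact (continuousOn_const.mul h1).add ((by fun_prop : Continuous fun t : ℝ =>
      1 - t * D).continuousOn.mul (continuousOn_const.mul
        (continuousOn_finsetSum _ fun l _ => continuousOn_const.mul (h2 l))))

lemma div_cylOp {h' : Fin n → ℝ → Eu n → ℝ} (hh : Cls ρ 2 (mx 1 1) h)
    (hh' : ∀ r ∈ II ρ, ∀ x ∈ UB n, HasP (h r) (fun i => h' i r x) x)
    (hr : r ∈ II ρ) (hx : x ∈ UB n) :
    ∃ c : Fin n → Fin n → ℝ, (∀ i, HasP (fun y => sc r y * cylOp h i r y) (c i) x) ∧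
      ∑ i, c i i = h r x - Sop (eta n) h r x +
        ∑ j, dsc j r x * Sop (fun z => eta n z * z j) h r x := by
  have hb := hh.wb
  have hp := hh.partials hh'
  have hm := hh.measU
  have hm' := fun i => (hp i).measU
  refine ⟨_, fun i => (hasP_sc r x).mul (hasP_wop (ker_cyl (eta_mol.mul_coord i)) hh' hb
    (fun i => (hp i).wb) hr hx), ?_⟩
  have i1 : ∀ i, Integrable (fun w : Eu n × ℝ => eta n w.1 * w.1 i *
      h r (x - sc r x • w.2 • w.1)) (cylMeas n) := fun i =>
    (ker_cyl (eta_mol.mul_coord i)).integrable hm hb hr hx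
  have i2 : ∀ i, Integrable (fun w : Eu n × ℝ => eta n w.1 * w.1 i *
      h' i r (x - sc r x • w.2 • w.1)) (cylMeas n) := fun i =>
    (ker_cyl (eta_mol.mul_coord i)).integrable (hm' i) (hp i).wb hr hx
  have i3 : ∀ i l, Integrable (fun w : Eu n × ℝ => eta n w.1 * w.1 i * (w.2 • w.1) l *
      h' l r (x - sc r x • w.2 • w.1)) (cylMeas n) := fun i l =>
    ((ker_cyl (eta_mol.mul_coord i)).mul_coord l).integrable (hm' l) (hp l).wb hr hx
  have j3 : ∀ i, Integrable (fun w : Eu n × ℝ => ∑ l, dsc i r x *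
      (eta n w.1 * w.1 i * (w.2 • w.1) l * h' l r (x - sc r x • w.2 • w.1))) (cylMeas n) := fun i =>
    integrable_finsetSum _ fun l _ => (i3 i l).const_mul _
  have j2 : ∀ i, Integrable (fun w : Eu n × ℝ =>
      eta n w.1 * w.1 i * h' i r (x - sc r x • w.2 • w.1) - ∑ l, dsc i r x *
        (eta n w.1 * w.1 i * (w.2 • w.1) l * h' l r (x - sc r x • w.2 • w.1))) (cylMeas n) :=
    fun i => (i2 i).sub (j3 i)
  have j4 : ∀ i, Integrable (fun w : Eu n × ℝ =>
      dsc i r x * (eta n w.1 * w.1 i * h r (x - sc r x • w.2 • w.1)) +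
      sc r x * (eta n w.1 * w.1 i * h' i r (x - sc r x • w.2 • w.1) -
        ∑ l, dsc i r x *
          (eta n w.1 * w.1 i * (w.2 • w.1) l * h' l r (x - sc r x • w.2 • w.1)))) (cylMeas n) :=
    fun i => ((i1 i).const_mul _).add ((j2 i).const_mul _)
  have e1 : ∀ i, dsc i r x * cylOp h i r x + sc r x *
      (Wop (cylMeas n) (fun w => eta n w.1 * w.1 i) (fun w => w.2 • w.1) (h' i) r x -
        ∑ l, dsc i r x * Wop (cylMeas n) (fun w => eta n w.1 * w.1 i * (w.2 • w.1) l)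
          (fun w => w.2 • w.1) (h' l) r x) =
      ∫ w, (dsc i r x * (eta n w.1 * w.1 i * h r (x - sc r x • w.2 • w.1)) +
      sc r x * (eta n w.1 * w.1 i * h' i r (x - sc r x • w.2 • w.1) -
        ∑ l, dsc i r x *
          (eta n w.1 * w.1 i * (w.2 • w.1) l * h' l r (x - sc r x • w.2 • w.1)))) ∂(cylMeas n) := by
    intro i
    rw [integral_add ((i1 i).const_mul _) ((j2 i).const_mul _), integral_const_mul,
      integral_const_mul, integral_sub (i2 i) (j3 i),
      integral_finsetSum _ fun l _ => (i3 i l).const_mul _]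
    simp_rw [integral_const_mul]
    rfl
  beta_reduce
  refine (Finset.sum_congr rfl fun i _ => e1 i).trans ?_
  rw [← integral_finsetSum _ fun i _ => j4 i]
  have e2 : ∀ w : Eu n × ℝ, ∑ i, (dsc i r x * (eta n w.1 * w.1 i * h r (x - sc r x • w.2 • w.1)) +
      sc r x * (eta n w.1 * w.1 i * h' i r (x - sc r x • w.2 • w.1) -
        ∑ l, dsc i r x *
          (eta n w.1 * w.1 i * (w.2 • w.1) l * h' l r (x - sc r x • w.2 • w.1)))) =
      eta n w.1 * ((∑ j, dsc j r x * w.1 j) * h r (x - sc r x • w.2 • w.1) +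
        (1 - w.2 * ∑ j, dsc j r x * w.1 j) *
          (sc r x * ∑ l, w.1 l * h' l r (x - sc r x • w.2 • w.1))) := by
    intro w
    have f1 : ∀ i, ∑ l, dsc i r x *
          (eta n w.1 * w.1 i * (w.2 • w.1) l * h' l r (x - sc r x • w.2 • w.1)) =
        (dsc i r x * w.1 i) * (eta n w.1 * w.2 *
          ∑ l, w.1 l * h' l r (x - sc r x • w.2 • w.1)) := fun i => by
      rw [Finset.mul_sum, Finset.mul_sum]
      exact Finset.sum_congr rfl fun l _ => by simp; ring
    simp only [f1]
    have f2 : ∀ i, dsc i r x * (eta n w.1 * w.1 i * h r (x - sc r x • w.2 • w.1)) +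
        sc r x * (eta n w.1 * w.1 i * h' i r (x - sc r x • w.2 • w.1) -
          (dsc i r x * w.1 i) * (eta n w.1 * w.2 *
            ∑ l, w.1 l * h' l r (x - sc r x • w.2 • w.1))) =
        (eta n w.1 * h r (x - sc r x • w.2 • w.1)) * (dsc i r x * w.1 i) +
        (sc r x * eta n w.1) * (w.1 i * h' i r (x - sc r x • w.2 • w.1)) -
        (sc r x * eta n w.1 * w.2 * ∑ l, w.1 l * h' l r (x - sc r x • w.2 • w.1)) *
          (dsc i r x * w.1 i) := fun i => by ring
    simp only [f2, Finset.sum_add_distrib, Finset.sum_sub_distrib, ← Finset.mul_sum]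
    ring
  rw [integral_congr_ae (Eventually.of_forall e2)]
  have hitg : Integrable (fun w : Eu n × ℝ =>
      eta n w.1 * ((∑ j, dsc j r x * w.1 j) * h r (x - sc r x • w.2 • w.1) +
        (1 - w.2 * ∑ j, dsc j r x * w.1 j) *
          (sc r x * ∑ l, w.1 l * h' l r (x - sc r x • w.2 • w.1)))) (cylMeas n) :=
    (integrable_finsetSum Finset.univ fun i _ => j4 i).congr (Eventually.of_forall e2)
  unfold cylMeas at hitg ⊢
  rw [integral_prod _ hitg]
  simp only [integral_const_mul]
  have e3 : ∀ᵐ z ∂(ballMeas n), eta n z * (∫ t in Icc (0 : ℝ) 1,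
      ((∑ j, dsc j r x * z j) * h r (x - sc r x • t • z) + (1 - t * ∑ j, dsc j r x * z j) *
          (sc r x * ∑ l, z l * h' l r (x - sc r x • t • z)))) =
      eta n z * h r x - eta n z * h r (x - sc r x • z) +
        ∑ j, dsc j r x * (eta n z * z j * h r (x - sc r x • z)) := by
    filter_upwards [ae_ballMeas] with z hz
    rw [integral_line hh' (fun i => (hp i).continuousOn hr) hr hx hz]
    have : ∑ j, dsc j r x * (eta n z * z j * h r (x - sc r x • z)) =
        (∑ j, dsc j r x * z j) * (eta n z * h r (x - sc r x • z)) := by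
      rw [Finset.sum_mul]
      exact Finset.sum_congr rfl fun l _ => by ring
    rw [this]; ring
  rw [integral_congr_ae e3]
  have k1 := eta_mol.ker.integrable hm hb hr hx
  have k2 := fun j => (eta_mol.mul_coord j).ker.integrable hm hb hr hx
  have k3 : Integrable (fun z => eta n z * h r x - eta n z * h r (x - sc r x • z)) (ballMeas n) :=
    (eta_mol.integrable.mul_const _).sub k1
  rw [integral_add k3
    (integrable_finsetSum _ fun j _ => (k2 j).const_mul _),
    integral_sub (eta_mol.integrable.mul_const _) k1, integral_mul_const, integral_eta, one_mul,
    integral_finsetSum _ fun j _ => (k2 j).const_mul _]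
  simp_rw [integral_const_mul]
  rfl

lemma exists_potential {u' : Fin n → Fin n → ℝ → Eu n → ℝ} {u d : Fin n → ℝ → Eu n → ℝ}
    (S : Smoothed ρ u' u d h N) :
    ∃ v : Fin n → ℝ → Eu n → ℝ, (∀ i, Cls ρ 3 (mx 1 2) (v i)) ∧
      (∀ i, ∀ r ∈ II ρ, ∀ x, ‖x‖ < 11 / 20 → v i r x = 0) ∧
      ∀ v' : Fin n → Fin n → ℝ → Eu n → ℝ,
        (∀ i, ∀ r ∈ II ρ, ∀ x ∈ UB n, HasP (v i r) (fun j => v' i j r x) x) →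
        ∀ r ∈ II ρ, ∀ x ∈ UB n, ∑ i, v' i i r x = h r x := by
  have hN := S.N_cls
  choose _ N' hN' _ using hN
  obtain ⟨_, h', hh', _⟩ := S.h_cls
  have hshift : ∀ r ∈ II ρ, ∀ x : Eu n, ‖x‖ < 11 / 20 → ∀ z : Eu n, ‖z‖ ≤ 1 →
      ‖x - sc r x • z‖ < 3 / 5 := by
    intro r hr x hx z hz
    have hxU : x ∈ UB n := by rw [mem_UB]; linarith
    have hs : |sc r x| ≤ 1 / 100 := by
      have := sc_le_r hr hxU
      rw [abs_of_pos (sc_pos hr hxU)]; linarith [hr.2.1]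
    refine (norm_sub_le _ _).trans_lt ?_
    rw [norm_smul, Real.norm_eq_abs]
    nlinarith [norm_nonneg z, abs_nonneg (sc r x)]
  refine ⟨fun i r x => pull N i r x + sc r x * cylOp h i r x, fun i => ?_, ?_, ?_⟩
  · exact (Cls.pull S.N_cls i).add (Cls.scale.mul (Cls.wop (ker_cyl (eta_mol.mul_coord i)) S.h_cls
      (mx_anti 1 1)) fun i j _ => by simp only [mx]; push_cast; omega)
  · intro i r hr x hx
    have e1 : ∀ (m : Eu n → ℝ) (j : Fin n), Sop m (N j) r x = 0 := fun m j => by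
      refine integral_eq_zero_of_ae ?_
      filter_upwards [ae_ballMeas] with z hz
      simp [S.N_inner j r hr _ (hshift r hr x hx z hz)]
    have e2 : cylOp h i r x = 0 := by
      refine integral_eq_zero_of_ae ?_
      filter_upwards [ae_cylMeas] with w hw
      have := hshift r hr x hx _ (norm_cyl_le hw.1 hw.2)
      simp [S.h_inner r hr _ (this.trans (by norm_num))]
    simp [pull, e1, e2]
  · intro v' hv' r hr x hx
    obtain ⟨c, hc1, hc2⟩ := div_pull S.N_cls hN' (S.N_div N' hN') hr hx
    obtain ⟨b, hb1, hb2⟩ := div_cylOp (S.h_cls.le (by norm_num)) hh' hr hx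
    have : ∀ i, v' i i r x = c i i + b i i := fun i =>
      (hv' i r hr x hx).unique ((hc1 i).add (hb1 i)) i
    simp only [this, Finset.sum_add_distrib, hc2, hb2]
    ring

end

lemma hasP_of_implicit {N w : Eu n → ℝ} {c : Fin n → ℝ} {b L : ℝ} {x : Eu n} (hb : b ≠ 0)
    (hN : HasP N c x) (hN0 : N x = 0) (h1 : ∀ᶠ y in 𝓝 x, |w y - w x| ≤ 2 * |N y|)
    (h2 : ∀ᶠ y in 𝓝 x, |N y - b * (w y - w x)| ≤
      |w y - w x| * (L * (‖y - x‖ + |w y - w x|))) :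
    HasP w (fun i => b⁻¹ * c i) x := by
  have hN' : HasFDerivAt N (gr c) x := hN
  have hO : (fun y => N y) =O[𝓝 x] fun y => y - x := by
    simpa [hN0] using hN'.isBigO_sub
  have hw : (fun y => w y - w x) =O[𝓝 x] fun y => y - x :=
    (Asymptotics.IsBigO.of_bound 2 (by simpa using h1)).trans hO
  have hsq : (fun y => N y - b * (w y - w x)) =o[𝓝 x] fun y => y - x := by
    have e1 : (fun y => N y - b * (w y - w x)) =O[𝓝 x]
        fun y => |w y - w x| * (L * (‖y - x‖ + |w y - w x|)) :=
      Asymptotics.IsBigO.of_bound 1 (by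
        filter_upwards [h2] with y hy
        rw [one_mul]
        exact hy.trans (le_abs_self _))
    have e2 : (fun y => L * (‖y - x‖ + |w y - w x|)) =O[𝓝 x] fun y => ‖y - x‖ :=
      (((Asymptotics.isBigO_refl _ _).add hw.norm_norm)).const_mul_left L
    have e3 : (fun y => ‖y - x‖) =o[𝓝 x] fun _ => (1 : ℝ) := by
      rw [Asymptotics.isLittleO_one_iff]
      have : Tendsto (fun y => ‖y - x‖) (𝓝 x) (𝓝 ‖x - x‖) :=
        (by fun_prop : Continuous fun y => ‖y - x‖).tendsto x
      simpa using this
    have e4 := hw.norm_norm.mul_isLittleO (e2.trans_isLittleO e3)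
    refine e1.trans_isLittleO ?_
    have e5 : (fun y => |w y - w x| * (L * (‖y - x‖ + |w y - w x|))) =o[𝓝 x]
        fun y => ‖y - x‖ := by simpa using e4
    exact e5.norm_right |>.trans_isBigO (Asymptotics.isBigO_refl _ _).norm_left
      |>.trans_isBigO (Asymptotics.isBigO_refl _ _).norm_left
  have hbw : HasP (fun y => b * w y) c x := by
    show HasFDerivAt _ _ _
    rw [hasFDerivAt_iff_isLittleO]
    rw [hasFDerivAt_iff_isLittleO] at hN'
    refine (hN'.sub hsq).congr_left fun y => ?_
    rw [hN0]; ring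
  refine (hbw.const_mul b⁻¹).congr_fun (Eventually.of_forall fun y => ?_)
  field_simp

section
variable {ρ r : ℝ} {x : Eu n} {k : Fin n} {m : ℕ} {a : ℝ → Eu n → ℝ} {p q : ℤ}

lemma norm_seg (x : Eu n) (k : Fin n) (s : ℝ) : ‖x + s • bv k - x‖ = |s| := by
  rw [add_sub_cancel_left, norm_smul, norm_bv, mul_one, Real.norm_eq_abs]

lemma seg_close {s : ℝ} (k : Fin n) (hs : |s| ≤ df x ^ 2 / 100) :
    ‖x + s • bv k - x‖ ≤ df x ^ 2 / 100 := by rwa [norm_seg]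

lemma seg_mem {s : ℝ} (k : Fin n) (hx : x ∈ UB n) (hs : |s| ≤ df x ^ 2 / 100) :
    x + s • bv k ∈ UB n := mem_UB_of_close hx (seg_close k hs)

lemma seg_bound {s C : ℝ} {c : Eu n → ℝ} (hC : 0 ≤ C) (h : ∀ x ∈ UB n, |c x| ≤ C * sc r x ^ p)
    (hr : r ∈ II ρ) (hx : x ∈ UB n) (k : Fin n) (hs : |s| ≤ df x ^ 2 / 100) :
    |c (x + s • bv k)| ≤ C * 2 ^ p.natAbs * sc r x ^ p := by
  have h1 := sc_close hr.1 hx (seg_close k hs)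
  refine (h _ (seg_mem k hx hs)).trans ?_
  rw [mul_assoc]
  exact mul_le_mul_of_nonneg_left (zpow_close (sc_pos hr hx) h1.1 h1.2 p) hC

lemma abs_mul_le_of_Icc {σ t T : ℝ} (hσ : σ ∈ Icc (0 : ℝ) 1) (ht : |t| ≤ T) : |σ * t| ≤ T := by
  rw [abs_mul, abs_of_nonneg hσ.1]
  nlinarith [hσ.1, hσ.2, abs_nonneg t]

/-- Weighted average over a segment parallel to a coordinate axis. -/
def lineAvg (k : Fin n) (m : ℕ) (a : Eu n → ℝ) (τ : ℝ) (x : Eu n) : ℝ :=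
  ∫ σ in Icc (0 : ℝ) 1, σ ^ m * a (x + (σ * τ) • bv k)

lemma measurable_seg (x : Eu n) (k : Fin n) (τ : ℝ) :
    Measurable fun σ : ℝ => x + (σ * τ) • bv k :=
  (by fun_prop : Continuous fun σ : ℝ => x + (σ * τ) • bv k).measurable

lemma WB.lineAvg {w : ℝ → Eu n → ℝ} (hb : WB ρ p a)
    (hw : ∀ r ∈ II ρ, ∀ x ∈ UB n, |w r x| ≤ df x ^ 2 / 100) :
    WB ρ p (fun r x => lineAvg k m (a r) (w r x) x) := by
  obtain ⟨C, hC, h⟩ := hb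
  refine ⟨C * 2 ^ p.natAbs, by positivity, fun r hr x hx => ?_⟩
  have : ∀ᵐ σ ∂(volume.restrict (Icc (0 : ℝ) 1)),
      ‖σ ^ m * a r (x + (σ * w r x) • bv k)‖ ≤ C * 2 ^ p.natAbs * sc r x ^ p := by
    filter_upwards [ae_Icc] with σ hσ
    rw [norm_mul, Real.norm_of_nonneg (pow_nonneg hσ.1 m), Real.norm_eq_abs]
    have h1 := seg_bound hC (h r hr) hr hx k (abs_mul_le_of_Icc hσ (hw r hr x hx))
    have h2 := pow_le_one₀ hσ.1 hσ.2 (n := m)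
    nlinarith [abs_nonneg (a r (x + (σ * w r x) • bv k)), pow_nonneg hσ.1 m]
  simpa [Measure.real, Pasting.lineAvg] using norm_integral_le_of_norm_le_const this

lemma hasP_lineAvg {a' : Fin n → ℝ → Eu n → ℝ} {τ : Eu n → ℝ} {τ' : Fin n → Eu n → ℝ} {B : ℝ}
    (ha : ∀ r ∈ II ρ, ∀ x ∈ UB n, HasP (a r) (fun i => a' i r x) x)
    (hb : WB ρ p a) (hb' : ∀ i, WB ρ q (a' i)) (hr : r ∈ II ρ) (hx : x ∈ UB n)
    (hτ : ∀ᶠ y in 𝓝 x, |τ y| ≤ df y ^ 2 / 100 ∧ HasP τ (fun i => τ' i y) y ∧ ∀ i, |τ' i y| ≤ B) :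
    HasP (fun y => lineAvg k m (a r) (τ y) y)
      (fun i => lineAvg k m (a' i r) (τ x) x + τ' i x * lineAvg k (m + 1) (a' k r) (τ x) x) x := by
  have hm : MeasU ρ a := fun r hr => measurable_indicator_of_continuousOn
    fun x hx => (ha r hr x hx).continuousAt.continuousWithinAt
  have hm' := measU_of_hasP ha
  obtain ⟨C, hC, hb⟩ := hb
  obtain ⟨C', hC', hb'⟩ := exists_common_bound hb'
  have hB : 0 ≤ B := by
    obtain ⟨_, _, h3⟩ := hτ.self_of_nhds
    exact (abs_nonneg _).trans (h3 k)
  have hsx := sc_pos hr hx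
  set A := C * 2 ^ p.natAbs * (2 ^ p.natAbs * sc r x ^ p)
  set A' := C' * 2 ^ q.natAbs * (2 ^ q.natAbs * sc r x ^ q)
  have hA : 0 ≤ A := by positivity
  have hA' : 0 ≤ A' := by positivity
  have hs : {y | y ∈ UB n ∧ (sc r x / 2 ≤ sc r y ∧ sc r y ≤ 2 * sc r x) ∧
      (|τ y| ≤ df y ^ 2 / 100 ∧ HasP τ (fun i => τ' i y) y ∧ ∀ i, |τ' i y| ≤ B)} ∈ 𝓝 x := by
    filter_upwards [sc_near hr hx, hτ] with y h1 h2 using ⟨h1.1, h1.2, h2⟩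
  have ba : ∀ y, y ∈ UB n → sc r x / 2 ≤ sc r y → sc r y ≤ 2 * sc r x → |τ y| ≤ df y ^ 2 / 100 →
      ∀ σ ∈ Icc (0 : ℝ) 1, |a r (y + (σ * τ y) • bv k)| ≤ A := fun y h0 h1 h2 h3 σ hσ =>
    (seg_bound hC (hb r hr) hr h0 k (abs_mul_le_of_Icc hσ h3)).trans
      (mul_le_mul_of_nonneg_left (zpow_close hsx h1 h2 p) (by positivity))
  have ba' : ∀ y, y ∈ UB n → sc r x / 2 ≤ sc r y → sc r y ≤ 2 * sc r x → |τ y| ≤ df y ^ 2 / 100 →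
      ∀ σ ∈ Icc (0 : ℝ) 1, ∀ i, |a' i r (y + (σ * τ y) • bv k)| ≤ A' := fun y h0 h1 h2 h3 σ hσ i =>
    (seg_bound hC' (hb' i r hr) hr h0 k (abs_mul_le_of_Icc hσ h3)).trans
      (mul_le_mul_of_nonneg_left (zpow_close hsx h1 h2 q) (by positivity))
  have hxs := mem_of_mem_nhds hs
  have ameas : ∀ {K : ℝ → Eu n → ℝ} (m : ℕ), MeasU ρ K → ∀ y, y ∈ UB n → |τ y| ≤ df y ^ 2 / 100 →
      AEStronglyMeasurable (fun σ : ℝ => σ ^ m * K r (y + (σ * τ y) • bv k))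
        (volume.restrict (Icc (0 : ℝ) 1)) := fun m hK y hy h => by
    refine (continuous_pow m).aestronglyMeasurable.mul (measU_comp hK hr (measurable_seg y k _) ?_)
    filter_upwards [ae_Icc] with σ hσ
    exact seg_mem k hy (abs_mul_le_of_Icc hσ h)
  have key : HasP (fun y => lineAvg k m (a r) (τ y) y)
      (fun i => ∫ σ in Icc (0 : ℝ) 1, (σ ^ m * a' i r (x + (σ * τ x) • bv k) +
        τ' i x * (σ ^ (m + 1) * a' k r (x + (σ * τ x) • bv k)))) x := by
    refine hasP_integral (c := fun i y σ => σ ^ m * a' i r (y + (σ * τ y) • bv k) +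
        τ' i y * (σ ^ (m + 1) * a' k r (y + (σ * τ y) • bv k))) (B := A + (A' + B * A')) hs
        (fun y hy => ameas m hm y hy.1 hy.2.2.1) ?_
        (fun i => (ameas m (hm' i) x hx hxs.2.2.1).add
          ((ameas (m + 1) (hm' k) x hx hxs.2.2.1).const_mul _)) ?_ ?_
    · filter_upwards [ae_Icc] with σ hσ
      have := ba x hx hxs.2.1.1 hxs.2.1.2 hxs.2.2.1 σ hσ
      rw [abs_mul, abs_of_nonneg (pow_nonneg hσ.1 m)]
      have h2 := pow_le_one₀ hσ.1 hσ.2 (n := m)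
      have h3 : 0 ≤ A' + B * A' := by positivity
      nlinarith [abs_nonneg (a r (x + (σ * τ x) • bv k)), pow_nonneg hσ.1 m]
    · filter_upwards [ae_Icc] with σ hσ y hy i
      have h1 := ba' y hy.1 hy.2.1.1 hy.2.1.2 hy.2.2.1 σ hσ
      have h2 : ∀ m : ℕ, |σ ^ m| ≤ 1 := fun m => by
        rw [abs_of_nonneg (pow_nonneg hσ.1 m)]; exact pow_le_one₀ hσ.1 hσ.2
      have h3 : ∀ (m : ℕ) i, |σ ^ m * a' i r (y + (σ * τ y) • bv k)| ≤ A' := fun m i => by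
        rw [abs_mul]
        exact (mul_le_mul (h2 m) (h1 i) (abs_nonneg _) zero_le_one).trans (by rw [one_mul])
      refine (abs_add_le _ _).trans ?_
      have h4 : |τ' i y * (σ ^ (m + 1) * a' k r (y + (σ * τ y) • bv k))| ≤ B * A' := by
        rw [abs_mul]
        exact mul_le_mul (hy.2.2.2.2 i) (h3 _ k) (abs_nonneg _) hB
      linarith [h3 m i]
    · filter_upwards [ae_Icc] with σ hσ y hy
      have h1 := ha r hr _ (seg_mem k hy.1 (abs_mul_le_of_Icc hσ hy.2.2.1))
      have h2 : ∀ l, HasP (fun y : Eu n => (y + (σ * τ y) • bv k) l)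
          (fun i => (if l = i then 1 else 0) + (σ * τ' i y) * (if l = k then 1 else 0)) y := fun l =>
        (((HasP.coord l).add ((hy.2.2.2.1.const_mul σ).mul
          (HasP.const (if l = k then (1 : ℝ) else 0)))).congr_fun
          (Eventually.of_forall fun z => by simp [bv_apply])).congr_partials fun i => by simp
      refine ((HasP.comp (Φ := fun y => y + (σ * τ y) • bv k) h2 h1).const_mul
        (σ ^ m)).congr_partials fun i => ?_
      simp [mul_add, Finset.sum_add_distrib]
      ring
  have ii : ∀ (m : ℕ) i, Integrable (fun σ : ℝ => σ ^ m * a' i r (x + (σ * τ x) • bv k))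
      (volume.restrict (Icc (0 : ℝ) 1)) := fun m i => by
    refine Integrable.of_bound (ameas m (hm' i) x hx hxs.2.2.1) A' ?_
    filter_upwards [ae_Icc] with σ hσ
    have h1 := ba' x hx hxs.2.1.1 hxs.2.1.2 hxs.2.2.1 σ hσ i
    rw [norm_mul, Real.norm_of_nonneg (pow_nonneg hσ.1 m), Real.norm_eq_abs]
    have h2 := pow_le_one₀ hσ.1 hσ.2 (n := m)
    nlinarith [abs_nonneg (a' i r (x + (σ * τ x) • bv k)), pow_nonneg hσ.1 m]
  refine key.congr_partials fun i => ?_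
  rw [integral_add (ii m i) ((ii (m + 1) k).const_mul _), integral_const_mul]
  rfl

lemma mul_lineAvg (f : Eu n → ℝ) (τ : ℝ) :
    τ * lineAvg k 0 f τ x = ∫ s in (0 : ℝ)..τ, f (x + s • bv k) := by
  have := intervalIntegral.mul_integral_comp_mul_right (a := 0) (b := 1)
    (f := fun s => f (x + s • bv k)) τ
  rw [zero_mul, one_mul] at this
  rw [← this, lineAvg, integral_Icc_eq_integral_Ioc,
    ← intervalIntegral.integral_of_le zero_le_one]
  simp

end

lemma exists_shift {φ : ℝ → ℝ} {c : ℝ} (hφ : ContinuousOn φ (Icc (-(2 * |c|)) (2 * |c|)))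
    (hb : ∀ s ∈ Icc (-(2 * |c|)) (2 * |c|), |φ s| ≤ 1 / 2) :
    ∃ t, |t| ≤ 2 * |c| ∧ t + ∫ s in (0 : ℝ)..t, φ s = c := by
  set T := 2 * |c| with hT
  have hT0 : 0 ≤ T := by positivity
  have h0 : -T ≤ T := by linarith
  have hcont : ContinuousOn (fun t => t + ∫ s in (0 : ℝ)..t, φ s) (Icc (-T) T) := by
    refine continuousOn_id.add ?_
    have := intervalIntegral.continuousOn_primitive_interval' (a := 0) (b₁ := -T) (b₂ := T)
      (μ := volume) (f := φ)
      (ContinuousOn.intervalIntegrable (by rwa [uIcc_of_le h0]))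
      (by rw [uIcc_of_le h0]; exact ⟨by linarith, hT0⟩)
    rwa [uIcc_of_le h0] at this
  have hbd : ∀ t ∈ Icc (-T) T, |∫ s in (0 : ℝ)..t, φ s| ≤ 1 / 2 * |t| := fun t ht => by
    have := intervalIntegral.norm_integral_le_of_norm_le_const (a := 0) (b := t) (C := 1 / 2)
      (f := φ) fun s hs => hb s ?_
    · simpa using this
    · have h1 := uIoc_subset_uIcc hs
      rw [mem_uIcc] at h1
      rcases h1 with h1 | h1 <;> constructor <;> linarith [ht.1, ht.2]
  have hc := abs_le.1 (hbd T ⟨h0, le_rfl⟩)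
  have hc' := abs_le.1 (hbd (-T) ⟨le_rfl, h0⟩)
  rw [abs_neg] at hc'
  rw [abs_of_nonneg hT0] at hc hc'
  have hcc := abs_le.1 (le_refl |c|)
  obtain ⟨t, ht, h⟩ := intermediate_value_Icc h0 hcont
    (show c ∈ Icc _ _ from ⟨by linarith [hc'.2], by linarith [hc.1]⟩)
  exact ⟨t, abs_le.2 ht, h⟩

section
variable {ρ r : ℝ} {x : Eu n} {k : Fin n} {q v w : ℝ → Eu n → ℝ} {v' q' : Fin n → ℝ → Eu n → ℝ}

/-- `w` is the displacement along the `k`-th axis with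
`w + ∫ s in 0..w, q (x + s e_k) = v`. -/
structure Displacement (ρ : ℝ) (k : Fin n) (q v w : ℝ → Eu n → ℝ) : Prop where
  q_le : ∀ r ∈ II ρ, ∀ x ∈ UB n, |q r x| ≤ 1 / 2
  le : ∀ r ∈ II ρ, ∀ x ∈ UB n, |w r x| ≤ 2 * |v r x|
  small : ∀ r ∈ II ρ, ∀ x ∈ UB n, |w r x| ≤ df x ^ 2 / 200
  eq : ∀ r ∈ II ρ, ∀ x ∈ UB n, w r x + ∫ s in (0 : ℝ)..(w r x), q r (x + s • bv k) = v r x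

lemma df_sq_nonneg (x : Eu n) : 0 ≤ df x ^ 2 / 200 := by positivity

lemma continuousOn_seg {f : Eu n → ℝ} (hf : ContinuousOn f (UB n)) (hx : x ∈ UB n) (k : Fin n) :
    ContinuousOn (fun s : ℝ => f (x + s • bv k)) {s | |s| ≤ df x ^ 2 / 100} :=
  hf.comp (by fun_prop) fun _ hs => seg_mem k hx hs

lemma mem_of_uIcc {a b s T : ℝ} (hs : s ∈ uIcc a b) (ha : |a| ≤ T) (hb : |b| ≤ T) : |s| ≤ T := by
  rw [abs_le] at *
  rw [mem_uIcc] at hs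
  rcases hs with h | h <;> constructor <;> linarith [ha.1, ha.2, hb.1, hb.2]

lemma exists_displacement (hq : Cls ρ 1 (mx 1 1) q) (hv : WB ρ 1 v) (hρ : 0 < ρ) (k : Fin n) :
    ∃ ρ1, 0 < ρ1 ∧ ρ1 ≤ ρ ∧ ∃ w, Displacement ρ1 k q v w := by
  obtain ⟨C, hC, hCb⟩ := hq.wb
  obtain ⟨D, hD, hDb⟩ := hv
  set ρ1 := min ρ (1 / (400 * (C + D + 1)))
  have hle : ρ1 ≤ ρ := min_le_left _ _
  have hle' : ∀ r ∈ II ρ1, r * (400 * (C + D + 1)) ≤ 1 := fun r hr => by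
    have := hr.2.2.trans (min_le_right _ _)
    rwa [le_div_iff₀ (by positivity)] at this
  have hqb : ∀ r ∈ II ρ1, ∀ x ∈ UB n, |q r x| ≤ 1 / 2 := fun r hr x hx => by
    refine (hCb r (II_mono hle hr) x hx).trans ?_
    have h1 := sc_le_r hr hx
    have h2 := hle' r hr
    have h3 := hr.1
    have h4 : mx 1 1 0 = 1 := by simp [mx]
    rw [h4, zpow_one]
    nlinarith [mul_nonneg hC h3.le, mul_nonneg hD h3.le]
  have hvb : ∀ r ∈ II ρ1, ∀ x ∈ UB n, 2 * |v r x| ≤ df x ^ 2 / 200 := fun r hr x hx => by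
    have h0 := hDb r (II_mono hle hr) x hx
    have h2 := hle' r hr
    have h3 := hr.1
    rw [zpow_one] at h0
    have h5 : sc r x = r * df x ^ 2 := rfl
    rw [h5] at h0
    have h6 : D * r ≤ 1 / 400 := by nlinarith [mul_nonneg hC h3.le, mul_nonneg hD h3.le]
    nlinarith [sq_nonneg (df x)]
  have ex : ∀ r x, ∃ t, r ∈ II ρ1 → x ∈ UB n →
      |t| ≤ 2 * |v r x| ∧ t + ∫ s in (0 : ℝ)..t, q r (x + s • bv k) = v r x := fun r x => by
    by_cases h : r ∈ II ρ1 ∧ x ∈ UB n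
    · have hs : ∀ s ∈ Icc (-(2 * |v r x|)) (2 * |v r x|), |s| ≤ df x ^ 2 / 100 := fun s hs =>
        (abs_le.2 hs).trans ((hvb r h.1 x h.2).trans (by linarith [df_sq_nonneg x]))
      obtain ⟨t, ht⟩ := exists_shift (c := v r x) (φ := fun s => q r (x + s • bv k))
        ((continuousOn_seg (hq.continuousOn (II_mono hle h.1)) h.2 k).mono hs)
        (fun s h' => hqb r h.1 _ (seg_mem k h.2 (hs s h')))
      exact ⟨t, fun _ _ => ht⟩
    · exact ⟨0, fun h1 h2 => absurd ⟨h1, h2⟩ h⟩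
  choose w hw using ex
  exact ⟨ρ1, lt_min hρ (by positivity), hle, w, hqb, fun r hr x hx => (hw r x hr hx).1,
    fun r hr x hx => (hw r x hr hx).1.trans (hvb r hr x hx), fun r hr x hx => (hw r x hr hx).2⟩

lemma Displacement.small' (W : Displacement ρ k q v w) (hr : r ∈ II ρ) (hx : x ∈ UB n) :
    |w r x| ≤ df x ^ 2 / 100 := (W.small r hr x hx).trans (by linarith [df_sq_nonneg x])

lemma Displacement.eventually_small (W : Displacement ρ k q v w) (hr : r ∈ II ρ) (hx : x ∈ UB n) :
    ∀ᶠ y in 𝓝 x, |w r x| ≤ df y ^ 2 / 100 := by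
  have h1 : ContinuousAt (fun y => df y ^ 2 / 100) x :=
    ((hasP_df x).continuousAt.pow 2).div_const 100
  have h2 : |w r x| < df x ^ 2 / 100 :=
    (W.small r hr x hx).trans_lt (by have := df_pos hx; nlinarith [pow_pos this 2])
  exact (h1.eventually (lt_mem_nhds h2)).mono fun y hy => hy.le

lemma Displacement.hasP (W : Displacement ρ k q v w) (hq : Cls ρ 1 (mx 1 1) q)
    (hq' : ∀ r ∈ II ρ, ∀ x ∈ UB n, HasP (q r) (fun i => q' i r x) x)
    (hv' : ∀ r ∈ II ρ, ∀ x ∈ UB n, HasP (v r) (fun i => v' i r x) x)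
    (hr : r ∈ II ρ) (hx : x ∈ UB n) :
    HasP (w r) (fun i => (1 + q r (x + w r x • bv k))⁻¹ *
      (v' i r x - w r x * lineAvg k 0 (q' i r) (w r x) x)) x := by
  obtain ⟨L, hL, hLip⟩ := hq.lipschitz (by simp [mx])
  set t := w r x with ht
  have hmem : x + t • bv k ∈ UB n := seg_mem k hx (W.small' hr hx)
  have hb := abs_le.1 (W.q_le r hr _ hmem)
  have hev := W.eventually_small hr hx
  have hA : HasP (fun y => lineAvg k 0 (q r) t y)
      (fun i => lineAvg k 0 (q' i r) t x + 0 * lineAvg k (0 + 1) (q' k r) t x) x :=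
    hasP_lineAvg (τ := fun _ => t) (τ' := fun _ _ => 0) (B := 0) hq' hq.wb
      (fun i => (hq.partials hq' i)) hr hx
      (hev.mono fun y hy => ⟨hy, HasP.const t, fun i => by simp⟩)
  have hN : HasP (fun y => v r y - t - t * lineAvg k 0 (q r) t y)
      (fun i => v' i r x - t * lineAvg k 0 (q' i r) t x) x :=
    (((hv' r hr x hx).sub (HasP.const t)).sub (hA.const_mul t)).congr_partials fun i => by ring
  have hsegs : ∀ᶠ y in 𝓝 x, y ∈ UB n ∧ |t| ≤ df y ^ 2 / 100 := 
    Filter.Eventually.and (UB_nhds hx) hev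
  have hNy : ∀ y, y ∈ UB n → |t| ≤ df y ^ 2 / 100 →
      v r y - t - t * lineAvg k 0 (q r) t y = (w r y - t) + ∫ s in t..(w r y), q r (y + s • bv k) ∧
      ∀ s ∈ uIcc t (w r y), y + s • bv k ∈ UB n := fun y hy hty => by
    have hwy := W.small' hr hy
    have h0y : |(0 : ℝ)| ≤ df y ^ 2 / 100 := by rw [abs_zero]; positivity
    have hc := continuousOn_seg (hq.continuousOn hr) hy k
    have hitg : ∀ {a b : ℝ}, |a| ≤ df y ^ 2 / 100 → |b| ≤ df y ^ 2 / 100 →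
        IntervalIntegrable (fun s => q r (y + s • bv k)) volume a b := fun ha hb =>
      (hc.mono fun s hs => mem_of_uIcc hs ha hb).intervalIntegrable
    refine ⟨?_, fun s hs => seg_mem k hy (mem_of_uIcc hs hty hwy)⟩
    rw [mul_lineAvg, ← W.eq r hr y hy, ← intervalIntegral.integral_add_adjacent_intervals
      (hitg h0y hty) (hitg hty hwy)]
    ring
  refine hasP_of_implicit (L := L) (by linarith [hb.1]) hN ?_ ?_ ?_
  · have := (hNy x hx (W.small' hr hx)).1
    rw [this, ← ht]; simp
  · filter_upwards [hsegs] with y hy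
    obtain ⟨h1, h2⟩ := hNy y hy.1 hy.2
    have h3 := intervalIntegral.norm_integral_le_of_norm_le_const (C := 1 / 2)
      (f := fun s => q r (y + s • bv k)) fun s hs => W.q_le r hr _ (h2 s (uIoc_subset_uIcc hs))
    rw [Real.norm_eq_abs] at h3
    rw [h1]
    have h4 := abs_sub_abs_le_abs_sub (w r y - t) (-∫ s in t..(w r y), q r (y + s • bv k))
    rw [abs_neg, sub_neg_eq_add] at h4
    linarith
  · filter_upwards [hsegs] with y hy
    obtain ⟨h1, h2⟩ := hNy y hy.1 hy.2
    have hitg : IntervalIntegrable (fun s => q r (y + s • bv k)) volume t (w r y) :=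
      ((continuousOn_seg (hq.continuousOn hr) hy.1 k).mono
        fun s hs => mem_of_uIcc hs hy.2 (W.small' hr hy.1)).intervalIntegrable
    have h3 : v r y - t - t * lineAvg k 0 (q r) t y - (1 + q r (x + t • bv k)) * (w r y - t) =
        ∫ s in t..(w r y), (q r (y + s • bv k) - q r (x + t • bv k)) := by
      rw [intervalIntegral.integral_sub hitg intervalIntegrable_const, h1]
      simp; ring
    rw [h3]
    have h4 := intervalIntegral.norm_integral_le_of_norm_le_const (a := t) (b := w r y)
      (C := L * (‖y - x‖ + |w r y - t|))
      (f := fun s => q r (y + s • bv k) - q r (x + t • bv k)) fun s hs => by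
        refine (hLip r hr _ hmem _ (h2 s (uIoc_subset_uIcc hs))).trans
          (mul_le_mul_of_nonneg_left ?_ hL)
        have h5 : y + s • bv k - (x + t • bv k) = (y - x) + (s - t) • bv k := by
          rw [sub_smul]; abel
        rw [h5]
        refine (norm_add_le _ _).trans ?_
        rw [norm_smul, norm_bv, mul_one, Real.norm_eq_abs]
        have := abs_sub_left_of_mem_uIcc (uIoc_subset_uIcc hs)
        gcongr
    rw [Real.norm_eq_abs] at h4
    linarith [mul_comm (L * (‖y - x‖ + |w r y - t|)) |w r y - t|]

lemma Displacement.ftc (W : Displacement ρ k q v w) (hq : Cls ρ 2 (mx 1 1) q)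
    (hq' : ∀ r ∈ II ρ, ∀ x ∈ UB n, HasP (q r) (fun i => q' i r x) x)
    (hr : r ∈ II ρ) (hx : x ∈ UB n) :
    w r x * lineAvg k 0 (q' k r) (w r x) x = q r (x + w r x • bv k) - q r x := by
  have h0 : |(0 : ℝ)| ≤ df x ^ 2 / 100 := by rw [abs_zero]; positivity
  have hw := W.small' hr hx
  rw [mul_lineAvg]
  have := intervalIntegral.integral_eq_sub_of_hasDerivAt (a := 0) (b := w r x)
    (f := fun s => q r (x + s • bv k)) (f' := fun s => q' k r (x + s • bv k)) (fun s hs => ?_) ?_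
  · simpa using this
  · have h1 : HasFDerivAt (q r) (gr fun i => q' i r (x + s • bv k)) (x + s • bv k) :=
      hq' r hr _ (seg_mem k hx (mem_of_uIcc hs h0 hw))
    have h2 : HasDerivAt (fun s : ℝ => x + s • bv k) (bv k) s := by
      simpa using ((hasDerivAt_id s).smul_const (bv k)).const_add x
    have h3 := h1.comp_hasDerivAt s h2
    rw [gr_bv] at h3
    exact h3
  · exact ((continuousOn_seg ((hq.partials hq' k).continuousOn hr) hx k).mono
      fun s hs => mem_of_uIcc hs h0 hw).intervalIntegrable

lemma Cls.lineAvg {a : ℝ → Eu n → ℝ} {e : ℕ → ℤ} {m : ℕ} (ha : Cls ρ 1 e a)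
    (hw : Cls ρ 1 (fun _ => 0) w) (hs : ∀ r ∈ II ρ, ∀ x ∈ UB n, |w r x| ≤ df x ^ 2 / 100) :
    Cls ρ 1 e (fun r x => lineAvg k m (a r) (w r x) x) := by
  obtain ⟨a0, a', ha', a1⟩ := ha
  obtain ⟨w0, w', hw', w1⟩ := hw
  obtain ⟨B, hB, hBb⟩ := exists_common_bound w1
  refine ⟨a0.lineAvg hs, fun i r x => Pasting.lineAvg k m (a' i r) (w r x) x +
    w' i r x * Pasting.lineAvg k (m + 1) (a' k r) (w r x) x, fun r hr x hx => ?_, fun i => ?_⟩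
  · refine hasP_lineAvg (B := B) (τ' := fun i => w' i r) ha' a0 a1 hr hx ?_
    filter_upwards [UB_nhds hx] with y hy
    exact ⟨hs r hr y hy, hw' r hr y hy, fun i => by simpa using hBb i r hr y hy⟩
  · exact WB.add (WB.lineAvg (a1 i) hs)
      ((WB.mul (w1 i) (WB.lineAvg (a1 k) hs)).mono (by simp))

lemma Cls.inv_one_add {a : ℝ → Eu n → ℝ} (ha : Cls ρ 1 (fun _ => 0) a)
    (hs : ∀ r ∈ II ρ, ∀ x ∈ UB n, |a r x| ≤ 1 / 2) :
    Cls ρ 1 (fun _ => 0) (fun r x => (1 + a r x)⁻¹) := by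
  have hpos : ∀ r ∈ II ρ, ∀ x ∈ UB n, 1 / 2 ≤ 1 + a r x := fun r hr x hx => by
    linarith [(abs_le.1 (hs r hr x hx)).1]
  have hinv : WB ρ 0 (fun r x => (1 + a r x)⁻¹) := ⟨2, by norm_num, fun r hr x hx => by
    have := hpos r hr x hx
    rw [abs_of_pos (by positivity), zpow_zero]
    exact (inv_anti₀ (by norm_num) this).trans (by norm_num)⟩
  obtain ⟨a0, a', ha', a1⟩ := ha
  refine ⟨hinv, fun i r x => -(((1 + a r x)⁻¹ * (1 + a r x)⁻¹) * a' i r x), fun r hr x hx => ?_,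
    fun i => ?_⟩
  · have h1 : (1 + a r x) ≠ 0 := by linarith [hpos r hr x hx]
    refine (((HasP.const 1).add (ha' r hr x hx)).real_comp (hasDerivAt_inv h1)).congr_partials
      fun i => ?_
    field_simp
    ring
  · have := WB.const_mul (-1) ((hinv.mul hinv).mul (a1 i))
    show WB ρ 0 _
    simpa using this

lemma exists_transport (k : Fin n) (hq : Cls ρ 2 (mx 1 1) q) (hv : Cls ρ 2 (mx 1 2) v)
    (hv' : ∀ r ∈ II ρ, ∀ x ∈ UB n, HasP (v r) (fun i => v' i r x) x) (hρ : 0 < ρ) :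
    ∃ ρ1, 0 < ρ1 ∧ ρ1 ≤ ρ ∧ ∃ (w : ℝ → Eu n → ℝ) (w' : Fin n → ℝ → Eu n → ℝ),
      Cls ρ1 2 (mx 1 2) w ∧
      (∀ r ∈ II ρ1, ∀ x ∈ UB n, HasP (w r) (fun i => w' i r x) x) ∧
      (∀ r ∈ II ρ1, ∀ x ∈ UB n, x + w r x • bv k ∈ UB n) ∧
      (∀ r ∈ II ρ1, ∀ x ∈ UB n,
        (1 + q r (x + w r x • bv k)) * (1 + w' k r x) = 1 + q r x + v' k r x) ∧
      ∀ r ∈ II ρ1, ∀ x ∈ UB n, v r x = 0 → w r x = 0 := by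
  obtain ⟨ρ1, hρ1, hle, w, W⟩ := exists_displacement (hq.le one_le_two)
    (hv.wb.mono (q := 1) (by simp [mx])) hρ k
  replace hq := hq.rmono hle
  replace hv := hv.rmono hle
  replace hv' := fun r hr => hv' r (II_mono hle hr)
  obtain ⟨q', hq'⟩ := hq.2
  have hq1 := hq'.1
  have hwP := fun r (hr : r ∈ II ρ1) x (hx : x ∈ UB n) =>
    W.hasP (hq.le one_le_two) hq1 hv' hr hx
  set w' : Fin n → ℝ → Eu n → ℝ := fun i r x => (1 + q r (x + w r x • bv k))⁻¹ *
      (v' i r x - w r x * lineAvg k 0 (q' i r) (w r x) x) with hw'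
  have hmem : ∀ r ∈ II ρ1, ∀ x ∈ UB n, x + w r x • bv k ∈ UB n := fun r hr x hx =>
    seg_mem k hx (W.small' hr hx)
  have hqw : ∀ r ∈ II ρ1, ∀ x ∈ UB n, |q r (x + w r x • bv k)| ≤ 1 / 2 := fun r hr x hx =>
    W.q_le r hr _ (hmem r hr x hx)
  have hsm : ∀ r ∈ II ρ1, ∀ x ∈ UB n, |w r x| ≤ df x ^ 2 / 100 := fun r hr x hx => W.small' hr hx
  have w0 : WB ρ1 1 w := by
    obtain ⟨C, hC, h⟩ := hv.wb.mono (q := 1) (by simp [mx])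
    exact ⟨2 * C, by positivity, fun r hr x hx => by linarith [W.le r hr x hx, h r hr x hx]⟩
  have q1 : ∀ i, Cls ρ1 1 (fun j => - (j : ℤ)) (q' i) := fun i =>
    (hq'.2 i).mono fun j hj => by simp only [mx]; push_cast; omega
  have v1 : ∀ i, Cls ρ1 1 (fun j => 1 - (j : ℤ)) (v' i) := fun i =>
    (hv.partials hv' i).mono fun j hj => by simp only [mx]; push_cast; omega
  have i0 : WB ρ1 0 (fun r x => (1 + q r (x + w r x • bv k))⁻¹) :=
    ⟨2, by norm_num, fun r hr x hx => by
      have h1 := (abs_le.1 (hqw r hr x hx)).1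
      have h2 : 1 / 2 ≤ 1 + q r (x + w r x • bv k) := by linarith
      rw [abs_of_pos (by positivity), zpow_zero]
      exact (inv_anti₀ (by norm_num) h2).trans (by norm_num)⟩
  have w1 : ∀ i, WB ρ1 1 (w' i) := fun i => by
    have h1 : WB ρ1 1 (fun r x => w r x * lineAvg k 0 (q' i r) (w r x) x) :=
      (w0.mul (WB.lineAvg (q1 i).wb hsm)).mono (by simp)
    have h2 := i0.mul (WB.add (v1 i).wb (WB.const_mul (-1) h1))
    refine (h2.mono (by simp)).congr fun r _ x _ => ?_
    simp only [hw']; ring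
  have wc : Cls ρ1 1 (fun _ => 1) w := ⟨w0, w', hwP, w1⟩
  have wz : Cls ρ1 1 (fun _ => 0) w := wc.mono (by simp)
  have avg : ∀ i, Cls ρ1 1 (fun j => - (j : ℤ))
      (fun r x => lineAvg k 0 (q' i r) (w r x) x) := fun i => (q1 i).lineAvg wz hsm
  have wavg : ∀ i, Cls ρ1 1 (fun j => 1 - (j : ℤ))
      (fun r x => w r x * lineAvg k 0 (q' i r) (w r x) x) := fun i =>
    wc.mul (avg i) fun i j _ => by push_cast; omega
  have qz : Cls ρ1 1 (fun _ => 0) (fun r x => q r (x + w r x • bv k)) :=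
    (((hq.le one_le_two).mono (e' := fun j => 1 - (j : ℤ))
      (by simp only [mx]; omega)).add (wavg k)).congr (b := fun r x => q r (x + w r x • bv k))
      (fun r hr x hx => by rw [W.ftc hq hq1 hr hx]; ring) |>.mono fun j hj => by omega
  have wcls : ∀ i, Cls ρ1 1 (fun j => 1 - (j : ℤ)) (w' i) := fun i =>
    (qz.inv_one_add hqw).mul ((v1 i).sub (wavg i)) fun i j _ => by push_cast; omega
  refine ⟨ρ1, hρ1, hle, w, w', ⟨w0.mono (by simp [mx]), w', hwP, fun i => (wcls i).mono
    fun j hj => by simp only [mx]; push_cast; omega⟩, hwP, hmem, fun r hr x hx => ?_,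
    fun r hr x hx h0 => ?_⟩
  · have h1 := (abs_le.1 (hqw r hr x hx)).1
    have h2 : 1 + q r (x + w r x • bv k) ≠ 0 := by linarith
    have h3 := W.ftc hq hq1 hr hx
    simp only [hw']
    rw [h3]
    field_simp
    ring
  · have := W.le r hr x hx
    rw [h0, abs_zero, mul_zero] at this
    exact abs_eq_zero.1 (le_antisymm this (abs_nonneg _))

end

section
variable {E F G : Type*} [NormedAddCommGroup E] [NormedSpace ℝ E]
  [NormedAddCommGroup F] [NormedSpace ℝ F] [NormedAddCommGroup G] [NormedSpace ℝ G]

/-- Differentiable maps with bounded Lipschitz derivative. -/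
structure C11 (f : E → F) : Prop where
  diff : Differentiable ℝ f
  bdd : ∃ M, 0 ≤ M ∧ ∀ x, ‖fderiv ℝ f x‖ ≤ M
  lip : ∃ L, 0 ≤ L ∧ ∀ x y, ‖fderiv ℝ f x - fderiv ℝ f y‖ ≤ L * ‖x - y‖

lemma C11.of_hasFDerivAt {f : E → F} {D : E → E →L[ℝ] F} {M L : ℝ}
    (hD : ∀ x, HasFDerivAt f (D x) x) (hM : ∀ x, ‖D x‖ ≤ M)
    (hL : ∀ x y, ‖D x - D y‖ ≤ L * ‖x - y‖) : C11 f where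
  diff x := (hD x).differentiableAt
  bdd := ⟨|M|, abs_nonneg _, fun x => by
    rw [(hD x).fderiv]; exact (hM x).trans (le_abs_self _)⟩
  lip := ⟨|L|, abs_nonneg _, fun x y => by
    rw [(hD x).fderiv, (hD y).fderiv]
    exact (hL x y).trans (mul_le_mul_of_nonneg_right (le_abs_self _) (norm_nonneg _))⟩

variable {f f' : E → F} {g : F → G}

lemma norm_sub_le_of_fderiv {M : ℝ} (hf : Differentiable ℝ f) (hM : ∀ x, ‖fderiv ℝ f x‖ ≤ M)
    (x y : E) : ‖f x - f y‖ ≤ M * ‖x - y‖ :=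
  convex_univ.norm_image_sub_le_of_norm_fderiv_le (fun z _ => hf z) (fun z _ => hM z)
    (mem_univ y) (mem_univ x)

lemma C11.contDiff (h : C11 f) : ContDiff ℝ 1 f := by
  rw [contDiff_one_iff_fderiv]
  obtain ⟨L, hL, hl⟩ := h.lip
  refine ⟨h.diff, LipschitzWith.continuous (K := ⟨L, hL⟩) (LipschitzWith.of_dist_le_mul
    fun x y => ?_)⟩
  rw [dist_eq_norm, dist_eq_norm]
  exact hl x y

lemma C11.add (h : C11 f) (h' : C11 f') : C11 (fun x => f x + f' x) := by
  obtain ⟨M, hM, hm⟩ := h.bdd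
  obtain ⟨M', hM', hm'⟩ := h'.bdd
  obtain ⟨L, hL, hl⟩ := h.lip
  obtain ⟨L', hL', hl'⟩ := h'.lip
  refine C11.of_hasFDerivAt (M := M + M') (L := L + L')
    (fun x => (h.diff x).hasFDerivAt.add (h'.diff x).hasFDerivAt)
    (fun x => (norm_add_le _ _).trans (add_le_add (hm x) (hm' x))) fun x y => ?_
  rw [add_sub_add_comm, add_mul]
  exact (norm_add_le _ _).trans (add_le_add (hl x y) (hl' x y))

lemma C11.comp (hg : C11 g) (h : C11 f) : C11 (fun x => g (f x)) := by
  obtain ⟨M, hM, hm⟩ := h.bdd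
  obtain ⟨M', hM', hm'⟩ := hg.bdd
  obtain ⟨L, hL, hl⟩ := h.lip
  obtain ⟨L', hL', hl'⟩ := hg.lip
  refine C11.of_hasFDerivAt (M := M' * M) (L := M' * L + L' * M * M)
    (fun x => (hg.diff (f x)).hasFDerivAt.comp x (h.diff x).hasFDerivAt)
    (fun x => (ContinuousLinearMap.opNorm_comp_le _ _).trans
      (mul_le_mul (hm' _) (hm x) (norm_nonneg _) hM')) fun x y => ?_
  have e : (fderiv ℝ g (f x)).comp (fderiv ℝ f x) - (fderiv ℝ g (f y)).comp (fderiv ℝ f y) =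
      (fderiv ℝ g (f x)).comp (fderiv ℝ f x - fderiv ℝ f y) +
      (fderiv ℝ g (f x) - fderiv ℝ g (f y)).comp (fderiv ℝ f y) := by
    ext v; simp
  rw [e]
  refine (norm_add_le _ _).trans ?_
  have h1 := (ContinuousLinearMap.opNorm_comp_le (fderiv ℝ g (f x))
    (fderiv ℝ f x - fderiv ℝ f y)).trans
    (mul_le_mul (hm' _) (hl x y) (norm_nonneg _) hM')
  have h2 : ‖fderiv ℝ g (f x) - fderiv ℝ g (f y)‖ ≤ L' * (M * ‖x - y‖) :=
    (hl' _ _).trans (mul_le_mul_of_nonneg_left (norm_sub_le_of_fderiv h.diff hm x y) hL')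
  have h3 := (ContinuousLinearMap.opNorm_comp_le (fderiv ℝ g (f x) - fderiv ℝ g (f y))
    (fderiv ℝ f y)).trans (mul_le_mul h2 (hm y) (norm_nonneg _) (by positivity))
  linarith

lemma C11.affine (A : E →L[ℝ] F) (b : F) : C11 (fun x => A x + b) :=
  C11.of_hasFDerivAt (D := fun _ => A) (M := ‖A‖) (L := 0) (fun x => A.hasFDerivAt.add_const b)
    (fun _ => le_rfl) (by simp)

lemma C11.id : C11 (fun x : E => x) := by
  simpa using C11.affine (ContinuousLinearMap.id ℝ E) 0

lemma C11.zero : C11 (fun _ : E => (0 : F)) := by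
  simpa using C11.affine (0 : E →L[ℝ] F) 0

lemma C11.sum {ι : Type*} {t : Finset ι} {a : ι → E → F} (h : ∀ l ∈ t, C11 (a l)) :
    C11 (fun x => ∑ l ∈ t, a l x) := by
  classical
  induction t using Finset.induction_on with
  | empty => simpa using C11.zero
  | insert l t hl ih =>
    simp only [Finset.sum_insert hl]
    exact (h l (Finset.mem_insert_self l t)).add
      (ih fun j hj => h j (Finset.mem_insert_of_mem hj))

lemma C11.smul_const {a : E → ℝ} (h : C11 a) (v : F) : C11 (fun x => a x • v) := by
  simpa using (C11.affine (ContinuousLinearMap.toSpanSingleton ℝ v) 0).comp h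

/-- A bijective `C11` map whose derivatives have uniformly bounded inverses has a `C11` inverse. -/
lemma C11.inverse [CompleteSpace E] {f h : E → E} {m : ℝ} (hf : C11 f) (hl : ∀ x, h (f x) = x)
    (hr : ∀ y, f (h y) = y)
    (hm : ∀ x, ∃ B : E ≃L[ℝ] E, (B : E →L[ℝ] E) = fderiv ℝ f x ∧ ‖(B.symm : E →L[ℝ] E)‖ ≤ m) :
    C11 h ∧ (∀ y, ‖fderiv ℝ h y‖ ≤ m) ∧
      ∀ x, (fderiv ℝ f x).comp (fderiv ℝ h (f x)) = ContinuousLinearMap.id ℝ E := by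
  choose B hB hBm using hm
  have hd : ∀ y, HasFDerivAt h ((B (h y)).symm : E →L[ℝ] E) y := fun y => by
    have h1 : HasStrictFDerivAt f ((B (h y) : E →L[ℝ] E)) (h y) := by
      rw [hB]
      exact hf.contDiff.contDiffAt.hasStrictFDerivAt (by norm_num)
    have h2 := (h1.to_local_left_inverse (g := h) (Eventually.of_forall hl)).hasFDerivAt
    rwa [hr] at h2
  have hM : ∀ y, ‖fderiv ℝ h y‖ ≤ m := fun y => by rw [(hd y).fderiv]; exact hBm _
  have hm0 : 0 ≤ m := (norm_nonneg _).trans (hBm 0)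
  obtain ⟨L, hL, hlip⟩ := hf.lip
  refine ⟨C11.of_hasFDerivAt (M := m) (L := m * (L * m * m)) hd (fun y => hBm _) fun x y => ?_, hM,
    fun x => ?_⟩
  · have e : ((B (h x)).symm : E →L[ℝ] E) - ((B (h y)).symm : E →L[ℝ] E) =
        ((B (h x)).symm : E →L[ℝ] E).comp
          ((fderiv ℝ f (h y) - fderiv ℝ f (h x)).comp ((B (h y)).symm : E →L[ℝ] E)) := by
      rw [← hB, ← hB]; ext v; simp
    rw [e]
    have h1 := norm_sub_le_of_fderiv (fun y => (hd y).differentiableAt) hM y x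
    have h2 : ‖fderiv ℝ f (h y) - fderiv ℝ f (h x)‖ ≤ L * (m * ‖y - x‖) :=
      (hlip _ _).trans (mul_le_mul_of_nonneg_left h1 hL)
    refine (ContinuousLinearMap.opNorm_comp_le _ _).trans ?_
    have h3 := (ContinuousLinearMap.opNorm_comp_le (fderiv ℝ f (h y) - fderiv ℝ f (h x))
      ((B (h y)).symm : E →L[ℝ] E)).trans (mul_le_mul h2 (hBm _) (norm_nonneg _) (by positivity))
    have h4 := mul_le_mul (hBm (h x)) h3 (norm_nonneg _) hm0
    rw [norm_sub_rev y x] at h4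
    refine h4.trans (le_of_eq (by ring))
  · rw [(hd (f x)).fderiv, hl, ← hB]
    ext v; simp

lemma bijective_add_of_small [CompleteSpace E] {e : E → E} (he : Differentiable ℝ e)
    (hs : ∀ x, ‖fderiv ℝ e x‖ ≤ 1 / 2) : Function.Bijective (fun x => x + e x) := by
  have h : ApproximatesLinearOn (fun x => x + e x)
      ((ContinuousLinearEquiv.refl ℝ E : E ≃L[ℝ] E) : E →L[ℝ] E) univ (1 / 2) := by
    intro x _ y _
    have := norm_sub_le_of_fderiv he hs x y
    have e1 : x + e x - (y + e y) - ((ContinuousLinearEquiv.refl ℝ E : E ≃L[ℝ] E) : E →L[ℝ] E)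
      (x - y) = e x - e y := by simp; abel
    rw [e1]; simpa using this
  have hc : Subsingleton E ∨ (1 / 2 : NNReal) <
      ‖((ContinuousLinearEquiv.refl ℝ E : E ≃L[ℝ] E).symm : E →L[ℝ] E)‖₊⁻¹ := by
    rcases subsingleton_or_nontrivial E with h | h
    · exact Or.inl h
    · refine Or.inr ?_
      have : ‖((ContinuousLinearEquiv.refl ℝ E : E ≃L[ℝ] E).symm : E →L[ℝ] E)‖₊ = 1 := by
        ext; exact ContinuousLinearMap.norm_id
      rw [this, inv_one]
      exact NNReal.half_lt_self one_ne_zero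
  exact ⟨injOn_univ.1 (h.injOn hc), h.surjective hc⟩

lemma exists_equiv_of_small [CompleteSpace E] {A : E →L[ℝ] E}
    (hA : ‖A - ContinuousLinearMap.id ℝ E‖ ≤ 1 / 2) :
    ∃ B : E ≃L[ℝ] E, (B : E →L[ℝ] E) = A ∧ ‖(B.symm : E →L[ℝ] E)‖ ≤ 2 := by
  have hlow : ∀ x, ‖x‖ ≤ 2 * ‖A x‖ := fun x => by
    have h1 := (A - ContinuousLinearMap.id ℝ E).le_of_opNorm_le hA x
    have h2 := norm_sub_norm_le x (x - A x)
    rw [sub_sub_cancel] at h2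
    simp only [_root_.sub_apply, ContinuousLinearMap.id_apply] at h1
    rw [norm_sub_rev] at h1
    linarith
  have hbij : Function.Bijective A := by
    have := bijective_add_of_small (e := fun x => (A - ContinuousLinearMap.id ℝ E) x)
      (A - ContinuousLinearMap.id ℝ E).differentiable fun x => by
        rw [ContinuousLinearMap.fderiv]; exact hA
    simpa using this
  refine ⟨ContinuousLinearEquiv.ofBijective A (LinearMap.ker_eq_bot.2 hbij.1)
    (LinearMap.range_eq_top.2 hbij.2), by ext; simp, ?_⟩
  refine ContinuousLinearMap.opNorm_le_bound _ (by norm_num) fun y => ?_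
  obtain ⟨x, rfl⟩ := hbij.2 y
  have h1 : (ContinuousLinearEquiv.ofBijective A (LinearMap.ker_eq_bot.2 hbij.1)
    (LinearMap.range_eq_top.2 hbij.2)).symm (A x) = x :=
    (ContinuousLinearEquiv.symm_apply_eq _).2 (by simp)
  simpa [h1] using hlow x

/-- Uniformly bounded operators of determinant one have uniformly bounded inverses. -/
lemma exists_inv_bound [FiniteDimensional ℝ E] (M : ℝ) :
    ∃ m, ∀ A : E →L[ℝ] E, ‖A‖ ≤ M → LinearMap.det A.toLinearMap = 1 →
      ∃ B : E ≃L[ℝ] E, (B : E →L[ℝ] E) = A ∧ ‖(B.symm : E →L[ℝ] E)‖ ≤ m := by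
  have : CompleteSpace E := FiniteDimensional.complete ℝ E
  let K : Set (E →L[ℝ] E) := {A | ‖A‖ ≤ M ∧ A.det = 1}
  have hK : IsCompact K := by
    refine Metric.isCompact_of_isClosed_isBounded ?_ ?_
    · exact (isClosed_le continuous_norm continuous_const).inter
        (isClosed_eq ContinuousLinearMap.continuous_det continuous_const)
    · exact (Metric.isBounded_closedBall (x := (0 : E →L[ℝ] E)) (r := M)).subset
        fun A hA => by simpa using hA.1
  have heq : ∀ A ∈ K, ∃ B : E ≃L[ℝ] E, (B : E →L[ℝ] E) = A := fun A hA =>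
    ⟨A.toContinuousLinearEquivOfDetNeZero (by rw [hA.2]; exact one_ne_zero), by ext; simp⟩
  obtain ⟨m, hm⟩ := hK.exists_bound_of_continuousOn (f := Ring.inverse) fun A hA => by
    obtain ⟨B, rfl⟩ := heq A hA
    exact (NormedRing.inverse_continuousAt
      (ContinuousLinearEquiv.toUnit B)).continuousWithinAt
  refine ⟨m, fun A h1 h2 => ?_⟩
  obtain ⟨B, hB⟩ := heq A ⟨h1, h2⟩
  refine ⟨B, hB, ?_⟩
  have := hm A ⟨h1, h2⟩
  rwa [← hB, ContinuousLinearMap.ringInverse_equiv, ContinuousLinearMap.inverse_equiv] at this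

end

/-- Extension by zero from the unit ball. -/
def ext0 (a : Eu n → ℝ) (x : Eu n) : ℝ := (UB n).indicator a x

section
variable {ρ r : ℝ} {x y : Eu n} {a : ℝ → Eu n → ℝ} {f : Eu n → ℝ} {c : Fin n → ℝ}

lemma ext0_of_mem (hx : x ∈ UB n) : ext0 f x = f x := indicator_of_mem hx f

lemma ext0_of_notMem (hx : x ∉ UB n) : ext0 f x = 0 := indicator_of_notMem hx f

lemma HasP.ext0 (h : HasP f c x) (hx : x ∈ UB n) : HasP (ext0 f) c x :=
  h.congr_fun (by filter_upwards [UB_nhds hx] with y hy using ext0_of_mem hy)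

lemma df_le_of_notMem (hx : x ∉ UB n) (hy : y ∈ UB n) : df y ≤ 2 * ‖y - x‖ := by
  rw [mem_UB, not_lt] at hx
  rw [mem_UB] at hy
  rw [df_eq]
  have h1 := norm_sub_norm_le x y
  rw [norm_sub_rev] at h1
  nlinarith [norm_nonneg y]

lemma hasFDerivAt_zero_of_quadratic {C : ℝ} (h : ∀ y, |f y| ≤ C * ‖y - x‖ ^ 2) :
    HasFDerivAt f (0 : Eu n →L[ℝ] ℝ) x := by
  have h0 : f x = 0 := by
    have := h x
    simpa using this
  rw [hasFDerivAt_iff_isLittleO]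
  have e1 : (fun y => f y - f x - (0 : Eu n →L[ℝ] ℝ) (y - x)) =O[𝓝 x] fun y => ‖y - x‖ ^ 2 :=
    Asymptotics.IsBigO.of_bound C (Eventually.of_forall fun y => by simpa [h0] using h y)
  refine e1.trans_isLittleO ?_
  have := (Asymptotics.isLittleO_pow_sub_sub x (m := 2) one_lt_two)
  simpa using this.norm_left

/-- Zero extensions of functions which decay fast enough at the boundary. -/
lemma Cls.ext0 (h : Cls ρ 2 (mx 1 2) a) :
    ∃ C, 0 ≤ C ∧ ∀ r ∈ II ρ, C11 (ext0 (a r)) ∧ (∀ x, ‖fderiv ℝ (ext0 (a r)) x‖ ≤ C * r) ∧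
      ∀ x ∉ UB n, fderiv ℝ (ext0 (a r)) x = 0 := by
  obtain ⟨h0, a', ha', h1⟩ := h
  obtain ⟨C, hC, hCb⟩ := h0.mono (q := 1) (by simp [mx])
  obtain ⟨D, hD, hDb⟩ := exists_common_bound fun i => (h1 i).wb.mono (q := 1) (by simp [mx])
  choose L hL hLb using fun i => (h1 i).lipschitz (by simp [mx])
  refine ⟨n * D, by positivity, fun r hr => ?_⟩
  have hr0 := hr.1
  classical
  set A : Eu n → Eu n →L[ℝ] ℝ := fun x => if x ∈ UB n then gr (fun i => a' i r x) else 0 with hA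
  have Ain : ∀ {x}, x ∈ UB n → A x = gr (fun i => a' i r x) := fun hx => if_pos hx
  have Aout : ∀ {x}, x ∉ UB n → A x = 0 := fun hx => if_neg hx
  have hder : ∀ x, HasFDerivAt (Pasting.ext0 (a r)) (A x) x := fun x => by
    by_cases hx : x ∈ UB n
    · rw [Ain hx]
      exact HasP.ext0 (ha' r hr x hx) hx
    · rw [Aout hx]
      refine hasFDerivAt_zero_of_quadratic (C := 4 * C * r) fun y => ?_
      by_cases hy : y ∈ UB n
      · rw [ext0_of_mem hy]
        have h2 := hCb r hr y hy
        have h3 := df_le_of_notMem hx hy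
        rw [zpow_one, sc] at h2
        have h4 : df y ^ 2 ≤ (2 * ‖y - x‖) ^ 2 := pow_le_pow_left₀ (df_pos hy).le h3 2
        have h5 := mul_le_mul_of_nonneg_left h4 (mul_nonneg hC hr0.le)
        nlinarith
      · rw [ext0_of_notMem hy, abs_zero]
        positivity
  have hbd : ∀ x, ‖A x‖ ≤ n * D * r := fun x => by
    by_cases hx : x ∈ UB n
    · rw [Ain hx, mul_assoc]
      refine norm_gr_le_of_abs_le fun i => (hDb i r hr x hx).trans ?_
      rw [zpow_one]
      exact mul_le_mul_of_nonneg_left (sc_le_r hr hx) hD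
    · rw [Aout hx, norm_zero]; positivity
  have hmix : ∀ {x y}, x ∈ UB n → y ∉ UB n → ‖A x - A y‖ ≤ (2 * n * D) * ‖x - y‖ :=
    fun {x y} hx hy => by
      rw [Aout hy, sub_zero, Ain hx]
      have : ∀ i, |a' i r x| ≤ D * (2 * ‖x - y‖) := fun i => by
        refine (hDb i r hr x hx).trans (mul_le_mul_of_nonneg_left ?_ hD)
        rw [zpow_one]
        have h2 := sc_le_df (x := x) hr
        have h3 := df_le_of_notMem hy hx
        have h4 := df_pos hx
        have h5 := df_le_one x
        nlinarith
      exact (norm_gr_le_of_abs_le this).trans (le_of_eq (by ring))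
  have hlip : ∀ x y, ‖A x - A y‖ ≤ (2 * n * D + ∑ i, L i) * ‖x - y‖ := fun x y => by
    have hS : 0 ≤ ∑ i, L i := Finset.sum_nonneg fun i _ => hL i
    have hnD : 0 ≤ 2 * n * D := by positivity
    by_cases hx : x ∈ UB n
    · by_cases hy : y ∈ UB n
      · rw [Ain hx, Ain hy]
        have e : gr (fun i => a' i r x) - gr (fun i => a' i r y) =
            gr (fun i => a' i r x - a' i r y) := by
          ext v; simp [gr_apply, sub_mul]
        rw [e]
        refine (norm_gr_le _).trans ((Finset.sum_le_sum fun i _ => hLb i r hr y hy x hx).trans ?_)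
        rw [← Finset.sum_mul]
        exact mul_le_mul_of_nonneg_right (by linarith) (norm_nonneg _)
      · exact (hmix hx hy).trans (mul_le_mul_of_nonneg_right (by linarith) (norm_nonneg _))
    · by_cases hy : y ∈ UB n
      · rw [norm_sub_rev, norm_sub_rev x y]
        exact (hmix hy hx).trans (mul_le_mul_of_nonneg_right (by linarith) (norm_nonneg _))
      · rw [Aout hx, Aout hy, sub_self, norm_zero]; positivity
  exact ⟨C11.of_hasFDerivAt hder hbd hlip, fun x => by rw [(hder x).fderiv]; exact hbd x,
    fun x hx => by rw [(hder x).fderiv]; exact Aout hx⟩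

end

/-- `G` is a diffeomorphism with Jacobian determinant `δ` on the unit ball, `η`-close to the
identity there, equal to the identity near the center and equal to `F` outside the ball. -/
structure Pasted (F : Eu n → Eu n) (δ : Eu n → ℝ) (η : ℝ) (G : Eu n → Eu n) : Prop where
  bij : Function.Bijective G
  c11 : C11 G
  off : ∀ x ∉ UB n, G x = F x
  fderiv_off : ∀ x ∉ UB n, fderiv ℝ G x = fderiv ℝ F x
  inner : ∀ x, ‖x‖ < 1 / 2 → G x = x
  det : ∀ x ∈ UB n, LinearMap.det (fderiv ℝ G x).toLinearMap = δ x
  close : ∀ x ∈ UB n, ‖fderiv ℝ G x - ContinuousLinearMap.id ℝ (Eu n)‖ ≤ η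

section
variable {F G : Eu n → Eu n} {δ δ' : Eu n → ℝ} {η κ : ℝ} {W : Eu n → ℝ} {k : Fin n}

lemma det_shear (f : Eu n →L[ℝ] ℝ) (v : Eu n) :
    LinearMap.det (ContinuousLinearMap.id ℝ (Eu n) + f.smulRight v).toLinearMap = 1 + f v := by
  rw [← ContinuousLinearMap.coe_coe f, ← LinearMap.transvection.det f.toLinearMap v]
  congr 1

lemma det_clm_comp (A B : Eu n →L[ℝ] Eu n) : LinearMap.det (A.comp B).toLinearMap =
    LinearMap.det A.toLinearMap * LinearMap.det B.toLinearMap := LinearMap.det_comp _ _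

lemma Pasted.shear (P : Pasted F δ η G) (hη : 0 ≤ η) (hW : C11 W)
    (hκ : ∀ x, ‖fderiv ℝ W x‖ ≤ κ) (hκ2 : κ ≤ 1 / 2)
    (hoff : ∀ x ∉ UB n, W x = 0) (hoff' : ∀ x ∉ UB n, fderiv ℝ W x = 0)
    (hmem : ∀ x ∈ UB n, x + W x • bv k ∈ UB n) (hin : ∀ x, ‖x‖ < 1 / 2 → W x = 0)
    (hδ : ∀ x ∈ UB n, δ' (x + W x • bv k) * (1 + fderiv ℝ W x (bv k)) = δ x) :
    ∃ G', Pasted F δ' (2 * η + 2 * κ) G' := by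
  set θ : Eu n → Eu n := fun x => x + W x • bv k with hθ
  have hC : C11 θ := C11.id.add (hW.smul_const (bv k))
  have hdW : ∀ x, HasFDerivAt (fun x => W x • bv k) ((fderiv ℝ W x).smulRight (bv k)) x :=
    fun x => (hW.diff x).hasFDerivAt.smul_const (bv k)
  have hdn : ∀ x, ‖(fderiv ℝ W x).smulRight (bv k)‖ ≤ κ := fun x => by
    rw [ContinuousLinearMap.norm_smulRight_apply, norm_bv, mul_one]; exact hκ x
  have hdθ : ∀ x, fderiv ℝ θ x =
      ContinuousLinearMap.id ℝ (Eu n) + (fderiv ℝ W x).smulRight (bv k) := fun x =>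
    ((hasFDerivAt_id x).add (hdW x)).fderiv
  have hbij : Function.Bijective θ :=
    bijective_add_of_small (fun x => (hdW x).differentiableAt) fun x => by
      rw [(hdW x).fderiv]; exact (hdn x).trans hκ2
  set h := (Equiv.ofBijective θ hbij).symm with hh
  have hl : ∀ x, h (θ x) = x := (Equiv.ofBijective θ hbij).symm_apply_apply
  have hr : ∀ y, θ (h y) = y := (Equiv.ofBijective θ hbij).apply_symm_apply
  have hsm : ∀ x, ‖fderiv ℝ θ x - ContinuousLinearMap.id ℝ (Eu n)‖ ≤ κ := fun x => by
    rw [hdθ, add_sub_cancel_left]; exact hdn x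
  obtain ⟨hc, hb, hcomp⟩ := hC.inverse hl hr fun x => exists_equiv_of_small ((hsm x).trans hκ2)
  have hθoff : ∀ x ∉ UB n, θ x = x := fun x hx => by simp [hθ, hoff x hx]
  have hUB : ∀ y, h y ∈ UB n ↔ y ∈ UB n := fun y => by
    refine ⟨fun hy => ?_, fun hy => ?_⟩
    · have := hmem _ hy
      rwa [← hr y]
    · by_contra h'
      have := hθoff _ h'
      rw [hr] at this
      exact h' (this ▸ hy)
  have hyoff : ∀ y ∉ UB n, h y = y := fun y hy => by
    have := hθoff (h y) (mt (hUB y).1 hy)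
    rw [hr] at this
    exact this.symm
  have hcomp' : ∀ y, (fderiv ℝ θ (h y)).comp (fderiv ℝ h y) = ContinuousLinearMap.id ℝ (Eu n) :=
    fun y => by have := hcomp (h y); rwa [hr] at this
  have hd : ∀ y, fderiv ℝ (fun y => G (h y)) y = (fderiv ℝ G (h y)).comp (fderiv ℝ h y) := fun y =>
    ((P.c11.diff (h y)).hasFDerivAt.comp y (hc.diff y).hasFDerivAt).fderiv
  refine ⟨fun y => G (h y), P.bij.comp (Equiv.bijective _), P.c11.comp hc, fun y hy => ?_,
    fun y hy => ?_, fun y hy => ?_, fun y hy => ?_, fun y hy => ?_⟩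
  · simp only [hyoff y hy]; exact P.off y hy
  · have h1 := hcomp' y
    rw [hyoff y hy, hdθ, hoff' y hy] at h1
    have h2 : fderiv ℝ h y = ContinuousLinearMap.id ℝ (Eu n) := by
      rw [← h1]; ext v; simp
    rw [hd, h2, hyoff y hy, ContinuousLinearMap.comp_id]
    exact P.fderiv_off y hy
  · have h1 : θ y = y := by simp [hθ, hin y hy]
    have h2 : h y = y := by rw [← h1, hl, h1]
    simp only [h2]; exact P.inner y hy
  · have hx := (hUB y).2 hy
    have h1 := congrArg (fun A : Eu n →L[ℝ] Eu n => LinearMap.det A.toLinearMap) (hcomp' y)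
    simp only [det_clm_comp, ContinuousLinearMap.coe_id, LinearMap.det_id] at h1
    have h2 := hδ _ hx
    change δ' (θ (h y)) * _ = _ at h2
    rw [hr, ← det_shear, ← hdθ] at h2
    rw [hd, det_clm_comp, P.det _ hx, ← h2, mul_assoc, h1,
      mul_one]
  · have hx := (hUB y).2 hy
    have e : fderiv ℝ (fun y => G (h y)) y - ContinuousLinearMap.id ℝ (Eu n) =
        (fderiv ℝ G (h y) - ContinuousLinearMap.id ℝ (Eu n)).comp (fderiv ℝ h y) -
        (fderiv ℝ θ (h y) - ContinuousLinearMap.id ℝ (Eu n)).comp (fderiv ℝ h y) := by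
      rw [hd, ContinuousLinearMap.sub_comp, ContinuousLinearMap.sub_comp, hcomp']
      abel
    rw [e]
    refine (norm_sub_le _ _).trans ?_
    have h1 := (ContinuousLinearMap.opNorm_comp_le (fderiv ℝ G (h y) - ContinuousLinearMap.id ℝ _)
      (fderiv ℝ h y)).trans (mul_le_mul (P.close _ hx) (hb y) (norm_nonneg _) hη)
    have h2 := (ContinuousLinearMap.opNorm_comp_le (fderiv ℝ θ (h y) - ContinuousLinearMap.id ℝ _)
      (fderiv ℝ h y)).trans (mul_le_mul (hsm _) (hb y) (norm_nonneg _)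
        ((norm_nonneg _).trans (hsm 0)))
    linarith

/-- A `C11` diffeomorphism stays one after adding a perturbation with small derivative. -/
lemma bijective_add {m : ℝ} {e : Eu n → Eu n} (hF : C11 F) (hbij : Function.Bijective F)
    (hm : ∀ x, ∃ B : Eu n ≃L[ℝ] Eu n, (B : Eu n →L[ℝ] Eu n) = fderiv ℝ F x ∧
      ‖(B.symm : Eu n →L[ℝ] Eu n)‖ ≤ m) (he : C11 e) (hκ : ∀ x, ‖fderiv ℝ e x‖ ≤ κ)
    (hκm : κ * m ≤ 1 / 2) : Function.Bijective (fun x => F x + e x) := by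
  set h := (Equiv.ofBijective F hbij).symm with hh
  have hl : ∀ x, h (F x) = x := (Equiv.ofBijective F hbij).symm_apply_apply
  have hr : ∀ y, F (h y) = y := (Equiv.ofBijective F hbij).apply_symm_apply
  obtain ⟨hc, hb, -⟩ := hF.inverse hl hr hm
  have hd : ∀ y, HasFDerivAt (fun y => e (h y)) ((fderiv ℝ e (h y)).comp (fderiv ℝ h y)) y :=
    fun y => (he.diff (h y)).hasFDerivAt.comp y (hc.diff y).hasFDerivAt
  have key := bijective_add_of_small (e := fun y => e (h y))
    (fun y => (hd y).differentiableAt) fun y => by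
      rw [(hd y).fderiv]
      exact ((ContinuousLinearMap.opNorm_comp_le _ _).trans (mul_le_mul (hκ _) (hb y)
        (norm_nonneg _) ((norm_nonneg _).trans (hκ 0)))).trans hκm
  have := key.comp hbij
  have e1 : (fun x => F x + e x) = (fun y => y + e (h y)) ∘ F := funext fun x => by simp [hl]
  rwa [e1]

lemma det_eq_det_partials (A : Eu n →L[ℝ] Eu n) :
    LinearMap.det A.toLinearMap = (Matrix.of fun i j => A (bv j) i).det := by
  rw [← LinearMap.det_toMatrix (EuclideanSpace.basisFun (Fin n) ℝ).toBasis]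
  congr 1

lemma hasP_component {x : Eu n} (h : DifferentiableAt ℝ G x) (i : Fin n) :
    HasP (fun y => G y i) (fun j => fderiv ℝ G x (bv j) i) x := by
  have := ((EuclideanSpace.proj i : Eu n →L[ℝ] ℝ).hasFDerivAt.comp x h.hasFDerivAt)
  exact HasP.of_hasFDerivAt this

/-- The zero extension of a vector field. -/
def extVec (d : Fin n → Eu n → ℝ) (x : Eu n) : Eu n := ∑ i, ext0 (d i) x • bv i

lemma extVec_apply (d : Fin n → Eu n → ℝ) (x : Eu n) (i : Fin n) :
    extVec d x i = ext0 (d i) x := by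
  simp [extVec, bv_apply]

lemma exists_extVec {ρ : ℝ} {d : Fin n → ℝ → Eu n → ℝ} (hd : ∀ i, Cls ρ 2 (mx 1 2) (d i)) :
    ∃ C, 0 ≤ C ∧ ∀ r ∈ II ρ, C11 (extVec fun i => d i r) ∧
      (∀ x, ‖fderiv ℝ (extVec fun i => d i r) x‖ ≤ C * r) ∧
      (∀ x ∉ UB n, extVec (fun i => d i r) x = 0) ∧
      ∀ x ∉ UB n, fderiv ℝ (extVec fun i => d i r) x = 0 := by
  choose C hC h using fun i => (hd i).ext0
  refine ⟨∑ i, C i, Finset.sum_nonneg fun i _ => hC i, fun r hr => ?_⟩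
  have hder : ∀ x, HasFDerivAt (extVec fun i => d i r)
      (∑ i, (fderiv ℝ (ext0 (d i r)) x).smulRight (bv i)) x := fun x =>
    HasFDerivAt.fun_sum fun i _ => ((h i r hr).1.diff x).hasFDerivAt.smul_const (bv i)
  refine ⟨C11.sum fun i _ => (h i r hr).1.smul_const (bv i), fun x => ?_, fun x hx => ?_,
    fun x hx => ?_⟩
  · rw [(hder x).fderiv, Finset.sum_mul]
    refine (norm_sum_le _ _).trans (Finset.sum_le_sum fun i _ => ?_)
    rw [ContinuousLinearMap.norm_smulRight_apply, norm_bv, mul_one]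
    exact (h i r hr).2.1 x
  · simp [extVec, ext0_of_notMem hx]
  · rw [(hder x).fderiv]
    refine Finset.sum_eq_zero fun i _ => ?_
    rw [(h i r hr).2.2 x hx]
    ext; simp

end

section
variable {ρ : ℝ} {u : Fin n → ℝ → Eu n → ℝ} {u' : Fin n → Fin n → ℝ → Eu n → ℝ}
  {F : ℝ → Eu n → Eu n}

/-- A family of `C11` diffeomorphisms, of the form `x + r u(x)` on the unit ball and with
uniformly invertible derivatives. -/
structure NearId (ρ : ℝ) (u : Fin n → ℝ → Eu n → ℝ) (F : ℝ → Eu n → Eu n) : Prop where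
  bij : ∀ r ∈ II ρ, Function.Bijective (F r)
  c11 : ∀ r ∈ II ρ, C11 (F r)
  inv : ∃ m, ∀ r ∈ II ρ, ∀ x, ∃ B : Eu n ≃L[ℝ] Eu n, (B : Eu n →L[ℝ] Eu n) = fderiv ℝ (F r) x ∧
      ‖(B.symm : Eu n →L[ℝ] Eu n)‖ ≤ m
  eq : ∀ r ∈ II ρ, ∀ x ∈ UB n, ∀ i, F r x i = x i + r * u i r x
  close : ∃ C, 0 ≤ C ∧ ∀ r ∈ II ρ, ∀ x ∈ UB n,
    ‖fderiv ℝ (F r) x - ContinuousLinearMap.id ℝ (Eu n)‖ ≤ C * r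

lemma exists_small {ρ C η : ℝ} (hρ : 0 < ρ) (hC : 0 ≤ C) (hη : 0 < η) :
    ∃ r1, 0 < r1 ∧ r1 ≤ ρ ∧ ∀ r ∈ II r1, C * r ≤ η := by
  refine ⟨min ρ (η / (C + 1)), lt_min hρ (by positivity), min_le_left _ _, fun r hr => ?_⟩
  have h1 := hr.2.2.trans (min_le_right _ _)
  rw [le_div_iff₀ (by positivity)] at h1
  nlinarith [hr.1]

lemma exists_pasted_smoothed {d N : Fin n → ℝ → Eu n → ℝ} {h : ℝ → Eu n → ℝ} (hρ : 0 < ρ)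
    (hF : NearId ρ u F)
    (hu' : ∀ i, ∀ r ∈ II ρ, ∀ x ∈ UB n, HasP (u i r) (fun j => u' i j r x) x)
    (S : Smoothed ρ u' u d h N) {η : ℝ} (hη : 0 < η) :
    ∃ r1, 0 < r1 ∧ r1 ≤ ρ ∧ ∀ r ∈ II r1, ∃ G, Pasted (F r) (fun x => 1 + h r x) η G := by
  obtain ⟨C, hC, hE⟩ := exists_extVec S.d_cls
  obtain ⟨D, hD, hclose⟩ := hF.close
  obtain ⟨m, hm⟩ := hF.inv
  have hd := S.d_cls
  choose _ d' hd' _ using hd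
  obtain ⟨r1, h1, h1ρ, hs1⟩ := exists_small hρ (add_nonneg hC hD) hη
  obtain ⟨r2, h2, h21, hs2⟩ := exists_small (C := C * |m|) h1 (by positivity) one_half_pos
  refine ⟨r2, h2, h21.trans h1ρ, fun r hr => ?_⟩
  have hrρ := II_mono (h21.trans h1ρ) hr
  have hr1 := hs1 r (II_mono h21 hr)
  have hr2 := hs2 r hr
  have hr0 := hr.1
  obtain ⟨e1, e2, e3, e4⟩ := hE r hrρ
  set e := extVec fun i => d i r
  have hc := (hF.c11 r hrρ).add e1
  have hfd : ∀ x, fderiv ℝ (fun x => F r x + e x) x = fderiv ℝ (F r) x + fderiv ℝ e x := fun x =>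
    fderiv_fun_add ((hF.c11 r hrρ).diff x) (e1.diff x)
  refine ⟨fun x => F r x + e x, bijective_add (hF.c11 r hrρ) (hF.bij r hrρ) (hm r hrρ) e1 e2 ?_, hc,
    fun x hx => ?_, fun x hx => ?_, fun x hx => ?_, fun x hx => ?_, fun x hx => ?_⟩
  · have := mul_le_mul_of_nonneg_left (le_abs_self m) (mul_nonneg hC hr0.le)
    linarith
  · simp only [e3 x hx, add_zero]
  · rw [hfd, e4 x hx, add_zero]
  · have hx1 : x ∈ UB n := mem_UB.2 (by linarith)
    ext i
    rw [PiLp.add_apply, hF.eq r hrρ x hx1, extVec_apply, ext0_of_mem hx1,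
      S.d_inner i r hrρ x (by linarith)]
    ring
  · rw [det_eq_det_partials, ← S.h_eq d' hd' r hrρ x hx]
    congr 1
    ext i j
    have a1 : HasP (fun y => F r y i + e y i) _ x := hasP_component (hc.diff x) i
    have a2 := (((HasP.coord i).add ((hu' i r hrρ x hx).const_mul r)).add (hd' i r hrρ x hx))
    have a3 := a2.congr_fun (b := fun y => F r y i + e y i) (by
      filter_upwards [UB_nhds hx] with y hy
      rw [hF.eq r hrρ y hy, extVec_apply, ext0_of_mem hy])
    exact a1.unique a3 j
  · rw [hfd, add_sub_right_comm]
    refine (norm_add_le _ _).trans ((add_le_add (hclose r hrρ x hx) (e2 x)).trans ?_)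
    linarith

lemma exists_pasted (hn : 2 ≤ n) (hρ : 0 < ρ) (hu : ∀ i, Cls ρ 2 zeroExp (u i))
    (hu' : ∀ i, ∀ r ∈ II ρ, ∀ x ∈ UB n, HasP (u i r) (fun j => u' i j r x) x)
    (hdet : ∀ r ∈ II ρ, ∀ x ∈ UB n, (Matrix.of fun i j => kd i j + r * u' i j r x).det = 1)
    (hF : NearId ρ u F) {η : ℝ} (hη : 0 < η) :
    ∃ r1, 0 < r1 ∧ r1 ≤ ρ ∧ ∀ r ∈ II r1, ∃ G, Pasted (F r) (fun _ => 1) η G := by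
  obtain ⟨d, h, N, S⟩ := exists_smoothed hn hu hu' hdet
  obtain ⟨v, hv, hvin, hvdiv⟩ := exists_potential S
  have hv0 := hv
  choose _ v' hv' _ using hv0
  have hv2 : ∀ i, Cls ρ 2 (mx 1 1) (v' i i) := fun i =>
    ((hv i).partials (hv' i) i).mono fun j _ => by simp only [mx]; push_cast; omega
  set q : ℕ → ℝ → Eu n → ℝ := fun k r x => ∑ i with i.val < k, v' i i r x with hq
  have key : ∀ η : ℝ, 0 < η → ∃ r1, 0 < r1 ∧ r1 ≤ ρ ∧
      ∀ r ∈ II r1, ∃ G, Pasted (F r) (fun x => 1 + q 0 r x) η G := by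
    refine Nat.decreasingInduction (n := n) (motive := fun k _ => ∀ η : ℝ, 0 < η → ∃ r1, 0 < r1 ∧
      r1 ≤ ρ ∧ ∀ r ∈ II r1, ∃ G, Pasted (F r) (fun x => 1 + q k r x) η G) ?_ ?_ (Nat.zero_le n)
    · intro k hk ih η hη
      obtain ⟨r1, h1, h1ρ, ih⟩ := ih (η / 4) (by positivity)
      obtain ⟨ρ1, hρ1, hρ1ρ, w, w', wc, wP, wmem, weq, wz⟩ := exists_transport ⟨k, hk⟩
        (q := q k) (v := v ⟨k, hk⟩) (v' := v' ⟨k, hk⟩) (Cls.sum fun i _ => hv2 i)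
        (((hv _).le (by norm_num))) (hv' _) hρ
      obtain ⟨C, hC, hE⟩ := wc.ext0
      obtain ⟨r2, h2, h21, hs2⟩ := exists_small (lt_min h1 hρ1) hC
        (lt_min one_half_pos (show 0 < η / 4 by positivity))
      refine ⟨r2, h2, (h21.trans (min_le_left _ _)).trans h1ρ, fun r hr => ?_⟩
      obtain ⟨G, P⟩ := ih r (II_mono (h21.trans (min_le_left _ _)) hr)
      have hr1 := II_mono (h21.trans (min_le_right _ _)) hr
      have hrρ := II_mono hρ1ρ hr1
      obtain ⟨e1, e2, e3⟩ := hE r hr1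
      have hs := hs2 r hr
      obtain ⟨G', P'⟩ := P.shear (δ' := fun x => 1 + q k r x) (k := ⟨k, hk⟩) (by positivity) e1 e2
        (hs.trans (min_le_left _ _)) (fun x hx => ext0_of_notMem hx) e3
        (fun x hx => by rw [ext0_of_mem hx]; exact wmem r hr1 x hx)
        (fun x hx => by
          have hx1 : x ∈ UB n := mem_UB.2 (by linarith)
          rw [ext0_of_mem hx1]
          exact wz r hr1 x hx1 (hvin _ r hrρ x (by linarith)))
        (fun x hx => by
          have a1 : HasFDerivAt (ext0 (w r)) (gr fun i => w' i r x) x :=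
            HasP.ext0 (wP r hr1 x hx) hx
          rw [a1.fderiv, gr_bv, ext0_of_mem hx, weq r hr1 x hx, add_assoc]
          congr 1
          have hfil : (Finset.univ.filter fun i : Fin n => i.val < k + 1) =
              insert ⟨k, hk⟩ (Finset.univ.filter fun i : Fin n => i.val < k) := by
            ext i
            simp only [Finset.mem_filter, Finset.mem_univ, true_and, Finset.mem_insert, Fin.ext_iff]
            omega
          simp only [hq]
          rw [hfil, Finset.sum_insert (by simp), add_comm])
      refine ⟨G', { P' with close := fun x hx => (P'.close x hx).trans ?_ }⟩
      linarith [hs.trans (min_le_right _ _)]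
    · intro η hη
      obtain ⟨r1, h1, h1ρ, hG⟩ := exists_pasted_smoothed hρ hF hu' S hη
      refine ⟨r1, h1, h1ρ, fun r hr => ?_⟩
      obtain ⟨G, P⟩ := hG r hr
      refine ⟨G, { P with det := fun x hx => (P.det x hx).trans ?_ }⟩
      simp only [hq, Fin.is_lt, Finset.filter_true]
      rw [hvdiv v' hv' r (II_mono h1ρ hr) x hx]
  simpa [hq] using key η hη

end

lemma C11.c1Holder {g : Eu n → Eu n} (h : C11 g) {α : ℝ} (hα : α ∈ Ioo (0 : ℝ) 1) :
    C1Holder α g := by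
  refine ⟨h.contDiff, ?_⟩
  obtain ⟨M, hM, hm⟩ := h.bdd
  obtain ⟨L, hL, hl⟩ := h.lip
  refine ⟨L + 2 * M, by positivity, fun x y => ?_⟩
  have h0 : 0 ≤ ‖x - y‖ ^ α := by positivity
  rcases le_total ‖x - y‖ 1 with h1 | h1
  · have h2 : ‖x - y‖ ≤ ‖x - y‖ ^ α := by
      rcases (norm_nonneg (x - y)).eq_or_lt with h3 | h3
      · rwa [← h3] at h0 ⊢
      · simpa using Real.rpow_le_rpow_of_exponent_ge h3 h1 hα.2.le
    have := mul_le_mul_of_nonneg_left h2 hL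
    have := mul_nonneg hM h0
    linarith [hl x y]
  · have h2 : 1 ≤ ‖x - y‖ ^ α := Real.one_le_rpow h1 hα.1.le
    have h3 := norm_sub_le (fderiv ℝ g x) (fderiv ℝ g y)
    have := mul_nonneg hL h0
    nlinarith [hm x, hm y]

lemma C11.inverse_of_det_eq_one {g : Eu n → Eu n} (h : C11 g) (hbij : Function.Bijective g)
    (hdet : ∀ y, LinearMap.det (fderiv ℝ g y).toLinearMap = 1) : C11 (Function.invFun g) := by
  obtain ⟨M, hM, hm⟩ := h.bdd
  obtain ⟨m, hB⟩ := exists_inv_bound (E := Eu n) M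
  exact (h.inverse (Function.leftInverse_invFun hbij.1) (Function.rightInverse_invFun hbij.2)
    fun x => hB _ (hm x) (hdet x)).1

lemma C11.of_contDiff_two {f : Eu n → Eu n} (hf : ContDiff ℝ 2 f)
    (hDf : ∃ M : ℝ, ∀ y, ‖fderiv ℝ f y‖ ≤ M) {M2 : ℝ}
    (hD2f : ∀ y, ‖fderiv ℝ (fderiv ℝ f) y‖ ≤ M2) : C11 f := by
  obtain ⟨M, hM⟩ := hDf
  exact C11.of_hasFDerivAt (fun y => (hf.differentiable (by norm_num) y).hasFDerivAt) hM
    fun x y => norm_sub_le_of_fderiv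
      ((hf.fderiv_right (m := 1) (by norm_num)).differentiable (by norm_num)) hD2f x y

section
variable {f : Eu n → Eu n} {x : Eu n} {L : Eu n ≃L[ℝ] Eu n} {M M2 r : ℝ}

/-- The map `f`, rescaled around `x` and normalized by the linear part `L`. -/
def rescaled (f : Eu n → Eu n) (x : Eu n) (L : Eu n ≃L[ℝ] Eu n) (r : ℝ) (y : Eu n) : Eu n :=
  L.symm (r⁻¹ • (f (x + r • y) - f x))

lemma apply_rescaled (hr : r ≠ 0) (y : Eu n) :
    f (x + r • y) = f x + L (r • rescaled f x L r y) := by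
  simp [rescaled, smul_smul, hr]

lemma hasFDerivAt_rescaled (hf : Differentiable ℝ f) (hr : r ≠ 0) (y : Eu n) :
    HasFDerivAt (rescaled f x L r)
      ((L.symm : Eu n →L[ℝ] Eu n).comp (fderiv ℝ f (x + r • y))) y := by
  have h1 : HasFDerivAt (fun y : Eu n => x + r • y) (r • ContinuousLinearMap.id ℝ (Eu n)) y :=
    ((hasFDerivAt_id y).const_smul r).const_add x
  have h2 : HasFDerivAt (fun y => r⁻¹ • (f (x + r • y) - f x))
      (r⁻¹ • (fderiv ℝ f (x + r • y)).comp (r • ContinuousLinearMap.id ℝ (Eu n))) y :=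
    (((hf (x + r • y)).hasFDerivAt.comp y h1).sub_const (f x)).const_smul r⁻¹
  refine ((L.symm : Eu n →L[ℝ] Eu n).hasFDerivAt.comp y h2).congr_fderiv ?_
  ext v
  simp [smul_smul, hr]

lemma C11.rescaled (hf : C11 f) : C11 (rescaled f x L r) := by
  have h1 := hf.comp (C11.affine (r • ContinuousLinearMap.id ℝ (Eu n)) x)
  have h2 := (C11.affine (r⁻¹ • (L.symm : Eu n →L[ℝ] Eu n)) (-(r⁻¹ • L.symm (f x)))).comp h1
  refine (funext fun y => ?_ : _ = Pasting.rescaled f x L r) ▸ h2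
  simp [Pasting.rescaled, add_comm x, sub_eq_add_neg]

lemma bijective_rescaled (hf : Function.Bijective f) (hr : r ≠ 0) :
    Function.Bijective (rescaled f x L r) := by
  have h1 : Function.Bijective fun y : Eu n => x + r • y :=
    (Equiv.addLeft x).bijective.comp (LinearEquiv.smulOfNeZero ℝ (Eu n) r hr).bijective
  have h2 : Function.Bijective fun y : Eu n => L.symm (r⁻¹ • (y - f x)) :=
    L.symm.bijective.comp
      ((LinearEquiv.smulOfNeZero ℝ (Eu n) r⁻¹ (inv_ne_zero hr)).bijective.comp
        (Equiv.subRight (f x)).bijective)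
  exact h2.comp (hf.comp h1)

/-- The components of the normalized remainder `r⁻¹ (F y - y)` of the rescaled map. -/
def remainder (f : Eu n → Eu n) (x : Eu n) (L : Eu n ≃L[ℝ] Eu n) (i : Fin n) (r : ℝ)
    (y : Eu n) : ℝ := r⁻¹ * (rescaled f x L r y i - y i)

/-- The partial derivatives of `remainder`. -/
def remainder' (f : Eu n → Eu n) (x : Eu n) (L : Eu n ≃L[ℝ] Eu n) (i j : Fin n) (r : ℝ)
    (y : Eu n) : ℝ := r⁻¹ * (L.symm (fderiv ℝ f (x + r • y) (bv j)) i - kd i j)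

lemma hasP_remainder (hf : Differentiable ℝ f) (hr : r ≠ 0) (i : Fin n) (y : Eu n) :
    HasP (remainder f x L i r) (fun j => remainder' f x L i j r y) y := by
  have h := hasFDerivAt_rescaled (x := x) (L := L) hf hr y
  have h1 := hasP_component h.differentiableAt i
  rw [h.fderiv] at h1
  exact (h1.sub (HasP.coord i)).const_mul r⁻¹

lemma hasP_remainder' (hf : ContDiff ℝ 2 f) (hr : r ≠ 0) (i j : Fin n) (y : Eu n) :
    HasP (remainder' f x L i j r)
      (fun k => L.symm (fderiv ℝ (fderiv ℝ f) (x + r • y) (bv k) (bv j)) i) y := by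
  have h0 : Differentiable ℝ (fderiv ℝ f) :=
    (hf.fderiv_right (m := 1) (by norm_num)).differentiable (by norm_num)
  have h1 : HasFDerivAt (fun y : Eu n => x + r • y) (r • ContinuousLinearMap.id ℝ (Eu n)) y :=
    ((hasFDerivAt_id y).const_smul r).const_add x
  have h2 : HasFDerivAt (fun y => fderiv ℝ f (x + r • y)) _ y :=
    (h0 (x + r • y)).hasFDerivAt.comp y h1
  set T : (Eu n →L[ℝ] Eu n) →L[ℝ] ℝ := (EuclideanSpace.proj i : Eu n →L[ℝ] ℝ).comp
    ((L.symm : Eu n →L[ℝ] Eu n).comp (ContinuousLinearMap.apply ℝ (Eu n) (bv j))) with hT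
  have h3 : HasFDerivAt (fun y => T (fderiv ℝ f (x + r • y))) _ y := T.hasFDerivAt.comp y h2
  have h4 := ((HasP.of_hasFDerivAt h3).sub (HasP.const (kd i j))).const_mul r⁻¹
  refine (h4.congr_fun (Eventually.of_forall fun z => ?_)).congr_partials fun k => ?_
  · simp [remainder', hT]
  · simp [hT, hr]

lemma norm_symm_comp_sub_id (hL : (L : Eu n →L[ℝ] Eu n) = fderiv ℝ f x)
    (hl : ∀ y z, ‖fderiv ℝ f y - fderiv ℝ f z‖ ≤ M2 * ‖y - z‖) (hr : 0 < r) {y : Eu n}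
    (hy : y ∈ UB n) (hM2 : 0 ≤ M2) :
    ‖(L.symm : Eu n →L[ℝ] Eu n).comp (fderiv ℝ f (x + r • y)) - ContinuousLinearMap.id ℝ (Eu n)‖ ≤
      ‖(L.symm : Eu n →L[ℝ] Eu n)‖ * M2 * r := by
  have e : (L.symm : Eu n →L[ℝ] Eu n).comp (fderiv ℝ f (x + r • y)) -
      ContinuousLinearMap.id ℝ (Eu n) =
      (L.symm : Eu n →L[ℝ] Eu n).comp (fderiv ℝ f (x + r • y) - fderiv ℝ f x) := by
    rw [← hL]; ext v; simp
  rw [e, mul_assoc]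
  refine (ContinuousLinearMap.opNorm_comp_le _ _).trans
    (mul_le_mul_of_nonneg_left ((hl _ _).trans (mul_le_mul_of_nonneg_left ?_ hM2)) (norm_nonneg _))
  rw [add_sub_cancel_left, norm_smul, Real.norm_of_nonneg hr.le]
  have := (mem_UB.1 hy).le
  nlinarith

lemma Cls.remainder (hf : ContDiff ℝ 2 f) (hL : (L : Eu n →L[ℝ] Eu n) = fderiv ℝ f x)
    (hD2f : ∀ y, ‖fderiv ℝ (fderiv ℝ f) y‖ ≤ M2) (i : Fin n) :
    Cls 1 2 zeroExp (remainder f x L i) := by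
  have hM2 : 0 ≤ M2 := le_trans (norm_nonneg (fderiv ℝ (fderiv ℝ f) 0)) (hD2f 0)
  have hd : Differentiable ℝ f := hf.differentiable (by norm_num)
  have hl := norm_sub_le_of_fderiv
    ((hf.fderiv_right (m := 1) (by norm_num)).differentiable (by norm_num)) hD2f
  set C := ‖(L.symm : Eu n →L[ℝ] Eu n)‖ * M2 with hC
  have hC0 : 0 ≤ C := by positivity
  have b1 : ∀ j, ∀ r ∈ II 1, ∀ y ∈ UB n, |remainder' f x L i j r y| ≤ C := fun j r hr y hy => by
    have h1 := norm_symm_comp_sub_id hL hl hr.1 hy hM2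
    have h2 := ((L.symm : Eu n →L[ℝ] Eu n).comp (fderiv ℝ f (x + r • y)) -
      ContinuousLinearMap.id ℝ (Eu n)).le_of_opNorm_le h1 (bv j)
    have h3 := (abs_apply_le_norm _ i).trans h2
    rw [norm_bv, mul_one] at h3
    rw [remainder', abs_mul, abs_inv, abs_of_pos hr.1, inv_mul_le_iff₀ hr.1, mul_comm r]
    simpa [bv_apply] using h3
  have b0 : ∀ r ∈ II 1, ∀ y ∈ UB n, |Pasting.remainder f x L i r y| ≤ n * C := fun r hr y hy => by
    have h0 : (0 : Eu n) ∈ UB n := mem_UB.2 (by simp)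
    have h1 := lipschitz_of_hasP (a' := fun j => remainder' f x L i j r) convex_UB
      (fun y _ => hasP_remainder hd hr.1.ne' i y) (fun j y hy => b1 j r hr y hy) h0 hy
    have h2 : Pasting.remainder f x L i r 0 = 0 := by simp [Pasting.remainder, rescaled]
    rw [h2, sub_zero, sub_zero] at h1
    have h3 := mul_le_mul_of_nonneg_left (mem_UB.1 hy).le (show 0 ≤ n * C by positivity)
    linarith
  refine ⟨⟨n * C, by positivity, fun r hr y hy => by simpa [zeroExp] using b0 r hr y hy⟩,
    remainder' f x L i, fun r hr y hy => hasP_remainder hd hr.1.ne' i y, fun j =>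
    ⟨⟨C, hC0, fun r hr y hy => by simpa [zeroExp] using b1 j r hr y hy⟩, fun k r y =>
      L.symm (fderiv ℝ (fderiv ℝ f) (x + r • y) (bv k) (bv j)) i,
      fun r hr y hy => hasP_remainder' hf hr.1.ne' i j y, fun k =>
      ⟨C, hC0, fun r hr y hy => ?_⟩⟩⟩
  have h1 := (fderiv ℝ (fderiv ℝ f) (x + r • y)).le_of_opNorm_le (hD2f _) (bv k)
  rw [norm_bv, mul_one] at h1
  have h2 := (fderiv ℝ (fderiv ℝ f) (x + r • y) (bv k)).le_of_opNorm_le h1 (bv j)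
  rw [norm_bv, mul_one] at h2
  have h3 := (L.symm : Eu n →L[ℝ] Eu n).le_opNorm_of_le h2
  have h4 := (abs_apply_le_norm _ i).trans h3
  simpa [zeroExp] using h4

lemma det_symm_comp (hL : (L : Eu n →L[ℝ] Eu n) = fderiv ℝ f x)
    (hdet : ∀ y, LinearMap.det (fderiv ℝ f y).toLinearMap = 1) (y : Eu n) :
    LinearMap.det ((L.symm : Eu n →L[ℝ] Eu n).comp (fderiv ℝ f y)).toLinearMap = 1 := by
  have h1 : (L.symm : Eu n →L[ℝ] Eu n).comp (fderiv ℝ f x) = ContinuousLinearMap.id ℝ (Eu n) := by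
    rw [← hL]; ext v; simp
  have h2 := congrArg (fun A : Eu n →L[ℝ] Eu n => LinearMap.det A.toLinearMap) h1
  simp only [det_clm_comp, ContinuousLinearMap.coe_id, LinearMap.det_id, hdet, mul_one] at h2
  rw [det_clm_comp, h2, hdet, one_mul]

lemma nearId_rescaled (hf : ContDiff ℝ 2 f) (hfbij : Function.Bijective f)
    (hL : (L : Eu n →L[ℝ] Eu n) = fderiv ℝ f x)
    (hdet : ∀ y, LinearMap.det (fderiv ℝ f y).toLinearMap = 1)
    (hDf : ∀ y, ‖fderiv ℝ f y‖ ≤ M) (hD2f : ∀ y, ‖fderiv ℝ (fderiv ℝ f) y‖ ≤ M2) :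
    NearId 1 (remainder f x L) (rescaled f x L) := by
  have hM2 : 0 ≤ M2 := le_trans (norm_nonneg (fderiv ℝ (fderiv ℝ f) 0)) (hD2f 0)
  have hd : Differentiable ℝ f := hf.differentiable (by norm_num)
  have hl := norm_sub_le_of_fderiv
    ((hf.fderiv_right (m := 1) (by norm_num)).differentiable (by norm_num)) hD2f
  refine ⟨fun r hr => bijective_rescaled hfbij hr.1.ne',
    fun r hr => (C11.of_contDiff_two hf ⟨M, hDf⟩ hD2f).rescaled, ?_, fun r hr y hy i => ?_,
    ‖(L.symm : Eu n →L[ℝ] Eu n)‖ * M2, by positivity, fun r hr y hy => ?_⟩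
  · obtain ⟨m, hm⟩ := exists_inv_bound (E := Eu n) (‖(L.symm : Eu n →L[ℝ] Eu n)‖ * M)
    refine ⟨m, fun r hr y => ?_⟩
    rw [(hasFDerivAt_rescaled hd hr.1.ne' y).fderiv]
    exact hm _ ((ContinuousLinearMap.opNorm_comp_le _ _).trans
      (mul_le_mul_of_nonneg_left (hDf _) (norm_nonneg _))) (det_symm_comp hL hdet _)
  · have := hr.1.ne'
    rw [remainder]
    field_simp
    ring
  · rw [(hasFDerivAt_rescaled hd hr.1.ne' y).fderiv]
    exact norm_symm_comp_sub_id hL hl hr.1 hy hM2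

lemma det_remainder' (hL : (L : Eu n →L[ℝ] Eu n) = fderiv ℝ f x)
    (hdet : ∀ y, LinearMap.det (fderiv ℝ f y).toLinearMap = 1) (hr : r ≠ 0) (y : Eu n) :
    (Matrix.of fun i j => kd i j + r * remainder' f x L i j r y).det = 1 := by
  rw [← det_symm_comp hL hdet (x + r • y), det_eq_det_partials]
  congr 1
  ext i j
  simp [remainder', hr]

lemma exists_pasted_rescaled (hn : 2 ≤ n) (hf : ContDiff ℝ 2 f) (hfbij : Function.Bijective f)
    (hL : (L : Eu n →L[ℝ] Eu n) = fderiv ℝ f x)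
    (hdet : ∀ y, LinearMap.det (fderiv ℝ f y).toLinearMap = 1)
    (hDf : ∀ y, ‖fderiv ℝ f y‖ ≤ M) (hD2f : ∀ y, ‖fderiv ℝ (fderiv ℝ f) y‖ ≤ M2) {η : ℝ}
    (hη : 0 < η) :
    ∃ r ∈ II 1, (∀ y ∈ UB n, ‖fderiv ℝ (rescaled f x L r) y - ContinuousLinearMap.id ℝ _‖ ≤ η) ∧
      ∃ G, Pasted (rescaled f x L r) (fun _ => 1) η G := by
  have hN := nearId_rescaled hf hfbij hL hdet hDf hD2f
  obtain ⟨r1, h1, h1ρ, hG⟩ := exists_pasted hn one_pos (fun i => Cls.remainder hf hL hD2f i)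
    (fun i r hr y hy => hasP_remainder (hf.differentiable (by norm_num)) hr.1.ne' i y)
    (fun r hr y hy => det_remainder' hL hdet hr.1.ne' y) hN hη
  obtain ⟨C, hC, hclose⟩ := hN.close
  obtain ⟨r2, h2, h21, hs⟩ := exists_small h1 hC hη
  have hr : min r2 (1 / 100) ∈ II r2 :=
    ⟨lt_min h2 (by norm_num), min_le_right _ _, min_le_left _ _⟩
  have hr1 := II_mono h21 hr
  exact ⟨_, II_mono h1ρ hr1, fun y hy => (hclose _ (II_mono h1ρ hr1) y hy).trans (hs _ hr),
    hG _ hr1⟩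

end

section
variable {F G : Eu n → Eu n} {δ : Eu n → ℝ} {η : ℝ}

lemma Pasted.norm_fderiv_sub_le (P : Pasted F δ η G) (hη : 0 ≤ η)
    (hF : ∀ y ∈ UB n, ‖fderiv ℝ F y - ContinuousLinearMap.id ℝ _‖ ≤ η) (y : Eu n) :
    ‖fderiv ℝ G y - fderiv ℝ F y‖ ≤ 2 * η := by
  by_cases hy : y ∈ UB n
  · have := norm_sub_le (fderiv ℝ G y - ContinuousLinearMap.id ℝ _)
      (fderiv ℝ F y - ContinuousLinearMap.id ℝ _)
    rw [sub_sub_sub_cancel_right] at this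
    linarith [P.close y hy, hF y hy]
  · rw [P.fderiv_off y hy, sub_self, norm_zero]; positivity

lemma Pasted.norm_sub_le (P : Pasted F δ η G) (hn : 2 ≤ n) (hη : 0 ≤ η) (hFd : C11 F)
    (hF : ∀ y ∈ UB n, ‖fderiv ℝ F y - ContinuousLinearMap.id ℝ _‖ ≤ η) (y : Eu n) :
    ‖G y - F y‖ ≤ 4 * η := by
  by_cases hy : y ∈ UB n
  · have hp : (bv ⟨0, by omega⟩ : Eu n) ∉ UB n := by rw [mem_UB, norm_bv]; exact lt_irrefl _
    have hd : ∀ z, fderiv ℝ (fun z => G z - F z) z = fderiv ℝ G z - fderiv ℝ F z := fun z =>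
      fderiv_fun_sub (P.c11.diff z) (hFd.diff z)
    have h1 := norm_sub_le_of_fderiv (f := fun z => G z - F z) (P.c11.diff.sub hFd.diff)
      (fun z => by rw [hd]; exact P.norm_fderiv_sub_le hη hF z) y (bv ⟨0, by omega⟩)
    rw [P.off _ hp, sub_self, sub_zero] at h1
    have h2 := _root_.norm_sub_le y (bv ⟨0, by omega⟩)
    rw [norm_bv] at h2
    have h3 := mem_UB.1 hy
    nlinarith
  · rw [P.off y hy, sub_self, norm_zero]; positivity

end

end Pasting

open Pasting in
/-- Weak pasting lemma for conservative diffeomorphisms (Euclidean version):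
near a point, a C² volume-preserving diffeomorphism can be C¹-perturbed, within the
class of volume-preserving C^{1+α} diffeomorphisms, so as to coincide with its
linearization near the point and with the original map away from it. -/
theorem weak_pasting_lemma (n : ℕ) (hn : 2 ≤ n)
    (f : EuclideanSpace ℝ (Fin n) → EuclideanSpace ℝ (Fin n))
    (hf : ContDiff ℝ 2 f) (hfbij : Function.Bijective f)
    (hfinv : ContDiff ℝ 2 (Function.invFun f))
    (hfvol : ∀ y, LinearMap.det (fderiv ℝ f y).toLinearMap = 1)
    (hDf : ∃ M : ℝ, ∀ y, ‖fderiv ℝ f y‖ ≤ M)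
    (hD2f : ∃ M : ℝ, ∀ y, ‖iteratedFDeriv ℝ 2 f y‖ ≤ M)
    (x : EuclideanSpace ℝ (Fin n)) (α : ℝ) (hα : α ∈ Set.Ioo (0:ℝ) 1)
    (ε : ℝ) (hε : 0 < ε) :
    ∃ (r : ℝ) (g : EuclideanSpace ℝ (Fin n) → EuclideanSpace ℝ (Fin n)),
      0 < r ∧
      Function.Bijective g ∧ C1Holder α g ∧ C1Holder α (Function.invFun g) ∧
      (∀ y, LinearMap.det (fderiv ℝ g y).toLinearMap = 1) ∧
      (∀ y ∉ Metric.ball x r, g y = f y) ∧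
      (∀ y ∈ Metric.ball x (r / 2), g y = f x + fderiv ℝ f x (y - x)) ∧
      (∀ y, ‖g y - f y‖ + ‖fderiv ℝ g y - fderiv ℝ f y‖ < ε) := by
  obtain ⟨M, hM⟩ := hDf
  obtain ⟨M2, hM2⟩ := hD2f
  replace hM2 : ∀ y, ‖fderiv ℝ (fderiv ℝ f) y‖ ≤ M2 := fun y => by
    rw [← norm_iteratedFDeriv_one, norm_iteratedFDeriv_fderiv]; exact hM2 y
  have hd : Differentiable ℝ f := hf.differentiable (by norm_num)
  obtain ⟨m, hm⟩ := exists_inv_bound (E := Eu n) M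
  obtain ⟨L, hL, -⟩ := hm _ (hM x) (hfvol x)
  set K := ‖(L : Eu n →L[ℝ] Eu n)‖ with hK
  have hK0 : 0 ≤ K := norm_nonneg _
  set η := ε / (12 * (K + 1)) with hη
  have hη0 : 0 < η := by positivity
  obtain ⟨r, hr, hF, G, P⟩ := exists_pasted_rescaled hn hf hfbij hL hfvol hM hM2 hη0
  have hr0 := hr.1
  have hrne := hr0.ne'
  have hC : C11 (rescaled f x L r) := (C11.of_contDiff_two hf ⟨M, hM⟩ hM2).rescaled
  set z : Eu n → Eu n := fun y => r⁻¹ • (y - x) with hz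
  set g : Eu n → Eu n := fun y => f x + L (r • G (z y)) with hg
  have hxz : ∀ y, x + r • z y = y := fun y => by simp [hz, smul_smul, hrne]
  have hfz : ∀ y, f y = f x + L (r • rescaled f x L r (z y)) := fun y => by
    rw [← apply_rescaled hrne, hxz]
  have hnz : ∀ y, ‖y - x‖ = r * ‖z y‖ := fun y => by
    rw [hz, norm_smul, norm_inv, Real.norm_of_nonneg hr0.le, mul_inv_cancel_left₀ hrne]
  have hzd : ∀ y, HasFDerivAt z (r⁻¹ • ContinuousLinearMap.id ℝ (Eu n)) y := fun y =>
    ((hasFDerivAt_id y).sub_const x).const_smul r⁻¹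
  have hgd : ∀ y, HasFDerivAt g ((L : Eu n →L[ℝ] Eu n).comp (fderiv ℝ G (z y))) y := fun y => by
    have h1 : HasFDerivAt (fun y => r • G (z y))
        (r • (fderiv ℝ G (z y)).comp (r⁻¹ • ContinuousLinearMap.id ℝ (Eu n))) y :=
      ((P.c11.diff (z y)).hasFDerivAt.comp y (hzd y)).const_smul r
    refine (((L : Eu n →L[ℝ] Eu n).hasFDerivAt.comp y h1).const_add (f x)).congr_fderiv ?_
    ext v
    simp [smul_smul, hrne]
  have hfd : ∀ y, fderiv ℝ f y =
      (L : Eu n →L[ℝ] Eu n).comp (fderiv ℝ (rescaled f x L r) (z y)) := fun y => by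
    rw [(hasFDerivAt_rescaled hd hrne (z y)).fderiv, hxz]
    ext v; simp
  have hdet : ∀ y, LinearMap.det (fderiv ℝ g y).toLinearMap = 1 := fun y => by
    rw [(hgd y).fderiv]
    by_cases hy : z y ∈ UB n
    · rw [det_clm_comp, P.det _ hy, mul_one, hL, hfvol]
    · rw [P.fderiv_off _ hy, ← hfd, hfvol]
  have hgC : C11 g := by
    have h1 := P.c11.comp (C11.affine (r⁻¹ • ContinuousLinearMap.id ℝ (Eu n)) (-(r⁻¹ • x)))
    have h2 := (C11.affine (r • (L : Eu n →L[ℝ] Eu n)) (f x)).comp h1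
    refine (funext fun y => ?_ : _ = g) ▸ h2
    simp [hg, hz, add_comm (f x), sub_eq_add_neg]
  have hgbij : Function.Bijective g := by
    have h1 : Function.Bijective z :=
      (LinearEquiv.smulOfNeZero ℝ (Eu n) r⁻¹ (inv_ne_zero hrne)).bijective.comp
        (Equiv.subRight x).bijective
    have h2 : Function.Bijective fun y : Eu n => f x + L (r • y) :=
      (Equiv.addLeft (f x)).bijective.comp
        (L.bijective.comp (LinearEquiv.smulOfNeZero ℝ (Eu n) r hrne).bijective)
    exact h2.comp (P.bij.comp h1)
  refine ⟨r, g, hr0, hgbij, hgC.c1Holder hα, (hgC.inverse_of_det_eq_one hgbij hdet).c1Holder hα,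
    hdet, fun y hy => ?_, fun y hy => ?_, fun y => ?_⟩
  · have h1 : z y ∉ UB n := by
      rw [Metric.mem_ball, dist_eq_norm, hnz] at hy
      rw [mem_UB]
      contrapose! hy
      nlinarith
    rw [hfz y, ← P.off _ h1]
  · have h1 : ‖z y‖ < 1 / 2 := by
      rw [Metric.mem_ball, dist_eq_norm, hnz] at hy
      nlinarith
    simp only [hg]
    rw [P.inner _ h1, ← hL, hz, smul_smul, mul_inv_cancel₀ hrne, one_smul]
    rfl
  · have h1 : ‖g y - f y‖ ≤ K * (4 * η) := by
      rw [hfz y, hg, add_sub_add_left_eq_sub, ← map_sub, ← smul_sub]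
      refine (L : Eu n →L[ℝ] Eu n).le_opNorm_of_le ?_
      rw [norm_smul, Real.norm_of_nonneg hr0.le]
      have := P.norm_sub_le hn hη0.le hC hF (z y)
      nlinarith [hr.2.1, norm_nonneg (G (z y) - rescaled f x L r (z y))]
    have h2 : ‖fderiv ℝ g y - fderiv ℝ f y‖ ≤ K * (2 * η) := by
      rw [(hgd y).fderiv, hfd, ← ContinuousLinearMap.comp_sub]
      exact (ContinuousLinearMap.opNorm_comp_le _ _).trans
        (mul_le_mul_of_nonneg_left (P.norm_fderiv_sub_le hη0.le hF _) hK0)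
    have h3 : η * (12 * (K + 1)) = ε := by rw [hη]; field_simp
    nlinarith
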